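/- Let G be a minor-minimal enemy. Then the minimum degree of G is exactly 6. -/

import Mathlib

open SimpleGraph

/-- `K7vee` is the graph obtained from `K 7` by deleting two edges with a common end. -/
def K7vee : SimpleGraph (Fin 7) :=
  (completeGraph (Fin 7)).deleteEdges {s(0, 1), s(0, 2)}

/-- `K6vee` is the graph obtained from `K 6` by deleting two edges with a common end. -/
def K6vee : SimpleGraph (Fin 6) :=
  (completeGraph (Fin 6)).deleteEdges {s(0, 1), s(0, 2)}

/-- The complete multipartite graph with four parts of size two. -/
def K2222 : SimpleGraph (Fin 4 × Fin 2) :=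
  SimpleGraph.comap Prod.fst (completeGraph (Fin 4))

/-- `H` is a minor of `G`: there is a model of `H` in `G`, i.e. a family of pairwise disjoint
nonempty connected branch sets, one for each vertex of `H`, with edges of `G` between branch
sets corresponding to adjacent vertices of `H`. -/
def IsMinor {W V : Type} (H : SimpleGraph W) (G : SimpleGraph V) : Prop :=
  ∃ bag : W → Set V,
    (∀ w, (G.induce (bag w)).Connected) ∧
    (∀ w w', w ≠ w' → Disjoint (bag w) (bag w')) ∧
    (∀ w w', H.Adj w w' → ∃ u ∈ bag w, ∃ v ∈ bag w', G.Adj u v)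

/-- A graph is `k`-connected if it has more than `k` vertices and stays connected after
removing any set of fewer than `k` vertices. -/
def IsKConnected {V : Type} [Fintype V] (k : ℕ) (G : SimpleGraph V) : Prop :=
  k < Fintype.card V ∧ ∀ S : Set V, S.ncard < k → (G.induce (Sᶜ : Set V)).Connected

/-- A separation of `G`: `A ∪ B = V(G)` and no edge joins `A - B` to `B - A`. -/
def IsSeparation {V : Type} (G : SimpleGraph V) (A B : Set V) : Prop :=
  A ∪ B = Set.univ ∧ ∀ ⦃u v : V⦄, G.Adj u v → ¬(u ∈ A \ B ∧ v ∈ B \ A)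

/-- `(G, Z)` is internally `k`-connected: every separation `(A,B)` of `G` with `Z ⊆ A`
and `B - A ≠ ∅` has order at least `k`. -/
def InternallyConnected {V : Type} (G : SimpleGraph V) (Z : Set V) (k : ℕ) : Prop :=
  ∀ A B : Set V, IsSeparation G A B → Z ⊆ A → (B \ A).Nonempty →
    k ≤ (A ∩ B).ncard

/-- A `Z`-rooted `K₄`-model in `G`. -/
def HasRootedK4Model {V : Type} (G : SimpleGraph V) (Z : Set V) : Prop :=
  ∃ B : Fin 4 → Set V,
    (∀ i, (G.induce (B i)).Connected) ∧
    (∀ i j, i ≠ j → Disjoint (B i) (B j)) ∧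
    (∀ i, ∃! z : V, z ∈ Z ∧ z ∈ B i) ∧
    (∀ z ∈ Z, ∃ i, z ∈ B i) ∧
    (∀ i j, i ≠ j → ∃ u ∈ B i, ∃ v ∈ B j, G.Adj u v)

/-- A `Z`-rooted `K*₄,₂`-model in `G`. -/
def HasRootedK42starModel {V : Type} (G : SimpleGraph V) (Z : Set V) : Prop :=
  ∃ (B : Fin 4 → Set V) (C : Fin 2 → Set V),
    (∀ i, (G.induce (B i)).Connected) ∧
    (∀ j, (G.induce (C j)).Connected) ∧
    (∀ i j, i ≠ j → Disjoint (B i) (B j)) ∧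
    (∀ i j, i ≠ j → Disjoint (C i) (C j)) ∧
    (∀ i j, Disjoint (B i) (C j)) ∧
    (∀ i, ∃! z : V, z ∈ Z ∧ z ∈ B i) ∧
    (∀ z ∈ Z, ∃ i, z ∈ B i) ∧
    (∀ i j, ∃ u ∈ B i, ∃ v ∈ C j, G.Adj u v) ∧
    (∃ u ∈ C 0, ∃ v ∈ C 1, G.Adj u v)

/-- An enemy: a `4`-connected graph with `|E(G)| ≥ 4|V(G)| - 8`, with no `K7vee`-minor,
not isomorphic to `K_{2,2,2,2}`. -/
def Enemy {V : Type} [Fintype V] (G : SimpleGraph V) : Prop :=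
  IsKConnected 4 G ∧
    4 * (Fintype.card V : ℤ) - 8 ≤ (G.edgeSet.ncard : ℤ) ∧
    ¬ IsMinor K7vee G ∧
    IsEmpty (G ≃g K2222)

/-- A minor-minimal enemy: an enemy, no minor of which, other than itself, is an enemy. -/
def MinorMinimalEnemy {V : Type} [Fintype V] (G : SimpleGraph V) : Prop :=
  Enemy G ∧ ∀ (W : Type) [Fintype W] (H : SimpleGraph W),
    IsMinor H G → Enemy H → Nonempty (H ≃g G)

/-- The simple graph obtained from `G` by contracting the edge `uv`
(`v` is merged into `u`). -/
def contractEdge {V : Type} (G : SimpleGraph V) (u v : V) :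
    SimpleGraph {x : V // x ≠ v} :=
  SimpleGraph.fromRel (fun x y => G.Adj ↑x ↑y ∨ ((x : V) = u ∧ G.Adj v ↑y))

/-- A graph is `7`-contraction-critical if its chromatic number is `7` and
every minor of it, other than itself, has chromatic number less than `7`. -/
def ContractionCritical7 {V : Type} [Fintype V] (G : SimpleGraph V) : Prop :=
  G.chromaticNumber = 7 ∧
    ∀ (W : Type) [Fintype W] (H : SimpleGraph W),
      IsMinor H G → IsEmpty (H ≃g G) → H.chromaticNumber < 7

namespace MinEnemy

open Finset

section

open scoped Classical

variable {V : Type}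

/-- `X` is nonempty and induces a connected subgraph of `H`. -/
def Conn (H : SimpleGraph V) (X : Finset V) : Prop :=
  X.Nonempty ∧ ∀ Y ⊆ X, Y.Nonempty → (X \ Y).Nonempty → ∃ a ∈ Y, ∃ b ∈ X \ Y, H.Adj a b

/-- Some edge of `H` joins `X` to `Y`. -/
def Touch (H : SimpleGraph V) (X Y : Finset V) : Prop := ∃ a ∈ X, ∃ b ∈ Y, H.Adj a b

lemma Touch.symm {H : SimpleGraph V} {X Y : Finset V} (h : Touch H X Y) : Touch H Y X := by
  obtain ⟨a, ha, b, hb, hab⟩ := h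
  exact ⟨b, hb, a, ha, hab.symm⟩

lemma Touch.mono {H H' : SimpleGraph V} {X Y X' Y' : Finset V} (h : Touch H X Y) (hH : H ≤ H')
    (hX : X ⊆ X') (hY : Y ⊆ Y') : Touch H' X' Y' := by
  obtain ⟨a, ha, b, hb, hab⟩ := h
  exact ⟨a, hX ha, b, hY hb, hH hab⟩

lemma Touch.sub {H : SimpleGraph V} {X Y X' Y' : Finset V} (h : Touch H X Y)
    (hX : X ⊆ X') (hY : Y ⊆ Y') : Touch H X' Y' := h.mono le_rfl hX hY

lemma Conn.congr {H H' : SimpleGraph V} {X : Finset V} (h : Conn H X)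
    (hH : ∀ a ∈ X, ∀ b ∈ X, H.Adj a b → H'.Adj a b) : Conn H' X := by
  refine ⟨h.1, fun Y hY h1 h2 => ?_⟩
  obtain ⟨a, ha, b, hb, hab⟩ := h.2 Y hY h1 h2
  exact ⟨a, ha, b, hb, hH a (hY ha) b (mem_sdiff.1 hb).1 hab⟩

lemma Conn.mono {H H' : SimpleGraph V} {X : Finset V} (h : Conn H X) (hH : H ≤ H') : Conn H' X :=
  h.congr fun _ _ _ _ hab => hH hab

lemma conn_singleton (H : SimpleGraph V) (a : V) : Conn H {a} := by
  refine ⟨singleton_nonempty a, fun Y hY h1 h2 => ?_⟩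
  rcases subset_singleton_iff.1 hY with rfl | rfl
  · simp at h1
  · simp at h2

lemma Conn.biUnion {W : Type} {H' : SimpleGraph W} {H : SimpleGraph V} {X : Finset W}
    {β : W → Finset V} (hX : Conn H' X) (hβ : ∀ a ∈ X, Conn H (β a))
    (ht : ∀ a ∈ X, ∀ b ∈ X, H'.Adj a b → Touch H (β a) (β b) ∨ ¬ Disjoint (β a) (β b)) :
    Conn H (X.biUnion β) := by
  refine ⟨?_, fun Y hY h1 h2 => ?_⟩
  · obtain ⟨a, ha⟩ := hX.1
    obtain ⟨b, hb⟩ := (hβ a ha).1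
    exact ⟨b, mem_biUnion.2 ⟨a, ha, hb⟩⟩
  by_cases hs : ∃ a ∈ X, (Y ∩ β a).Nonempty ∧ (β a \ Y).Nonempty
  · obtain ⟨a, ha, hs1, hs2⟩ := hs
    have := (hβ a ha).2 (Y ∩ β a) inter_subset_right hs1
      (by obtain ⟨x, hx⟩ := hs2; exact ⟨x, by grind⟩)
    obtain ⟨x, hx, y, hy, hxy⟩ := this
    refine ⟨x, by grind, y, ?_, hxy⟩
    rw [mem_sdiff, mem_biUnion]
    exact ⟨⟨a, ha, by grind⟩, by grind⟩
  have hs' : ∀ a ∈ X, ∀ x ∈ β a, x ∈ Y → ∀ y ∈ β a, y ∈ Y := by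
    intro a ha x hx hxY y hy
    by_contra hyY
    exact hs ⟨a, ha, ⟨x, by grind⟩, ⟨y, by grind⟩⟩
  obtain ⟨y, hy⟩ := h1
  obtain ⟨a, ha, hya⟩ := mem_biUnion.1 (hY hy)
  obtain ⟨z, hz⟩ := h2
  rw [mem_sdiff, mem_biUnion] at hz
  obtain ⟨⟨b, hb, hzb⟩, hzY⟩ := hz
  obtain ⟨p, hp, q, hq, hpq⟩ := hX.2 (X.filter fun c => β c ⊆ Y) (filter_subset _ _)
    ⟨a, by rw [mem_filter]; exact ⟨ha, fun y' hy' => hs' a ha y hya hy y' hy'⟩⟩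
    ⟨b, by simp only [mem_sdiff, mem_filter]; exact ⟨hb, fun h => hzY (h.2 hzb)⟩⟩
  simp only [mem_sdiff, mem_filter, not_and] at hp hq
  have hqn : ∀ t ∈ β q, t ∉ Y := fun t ht htY => hq.2 hq.1 fun y' hy' => hs' q hq.1 t ht htY y' hy'
  rcases ht p hp.1 q hq.1 hpq with ⟨s, hs, t, ht, hst⟩ | hd
  · exact ⟨s, hp.2 hs, t, by rw [mem_sdiff, mem_biUnion]; exact ⟨⟨q, hq.1, ht⟩, hqn t ht⟩, hst⟩
  · exfalso
    apply hd
    rw [Finset.disjoint_left]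
    exact fun t h1 h2 => hqn t h2 (hp.2 h1)

lemma conn_pair {H : SimpleGraph V} {a b : V} (h : H.Adj a b) : Conn H {a, b} := by
  refine ⟨⟨a, by simp⟩, fun Y hY ⟨y, hy⟩ ⟨z, hz⟩ => ?_⟩
  have := hY hy
  have := h.symm
  refine ⟨y, hy, z, hz, ?_⟩
  grind

lemma conn_union_aux {H : SimpleGraph V} {X Y : Finset V} (hX : Conn H X) (hY : Conn H Y)
    (h : Touch H X Y ∨ ¬ Disjoint X Y) : Conn H (X ∪ Y) := by
  have hc : (⊤ : SimpleGraph Bool).Adj true false := by simp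
  have := Conn.biUnion (H := H) (β := fun b => if b then X else Y) (conn_pair hc) (by simp [hX, hY])
    (by
      have h' : Touch H Y X ∨ ¬ Disjoint Y X := by
        rcases h with h | h
        · exact Or.inl h.symm
        · exact Or.inr fun h' => h h'.symm
      simp [h, h'])
  simpa using this

lemma Conn.union {H : SimpleGraph V} {X Y : Finset V} (hX : Conn H X) (hY : Conn H Y)
    (h : Touch H X Y) : Conn H (X ∪ Y) := conn_union_aux hX hY (Or.inl h)

lemma Conn.union_of_mem {H : SimpleGraph V} {X Y : Finset V} (hX : Conn H X) (hY : Conn H Y)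
    {a : V} (h1 : a ∈ X) (h2 : a ∈ Y) : Conn H (X ∪ Y) :=
  conn_union_aux hX hY (Or.inr fun h => Finset.disjoint_left.1 h h1 h2)

lemma Conn.insert {H : SimpleGraph V} {X : Finset V} (hX : Conn H X) {a b : V} (hb : b ∈ X)
    (h : H.Adj a b) : Conn H (insert a X) := by
  rw [insert_eq]
  exact (conn_singleton H a).union hX ⟨a, by simp, b, hb, h⟩

/-- The component of `a` in the subgraph induced by `W`. -/
lemma exists_comp (H : SimpleGraph V) {W : Finset V} {a : V} (ha : a ∈ W) :
    ∃ K ⊆ W, a ∈ K ∧ Conn H K ∧ ∀ x ∈ K, ∀ y ∈ W, H.Adj x y → y ∈ K := by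
  obtain ⟨K, hK, hmax⟩ := (W.powerset.filter fun K => a ∈ K ∧ Conn H K).exists_max_image card
    ⟨{a}, by simp [ha, conn_singleton]⟩
  simp only [mem_filter, mem_powerset] at hK hmax
  refine ⟨K, hK.1, hK.2.1, hK.2.2, fun x hx y hy hxy => ?_⟩
  by_contra hyK
  have := hmax (insert y K) ⟨by grind, by grind, hK.2.2.insert hx hxy.symm⟩
  rw [card_insert_of_notMem hyK] at this
  omega

lemma Conn.subset_of_closed {H : SimpleGraph V} {K L W : Finset V} (hK : Conn H K)
    (hKW : K ⊆ W) (hL : ∀ x ∈ L, ∀ y ∈ W, H.Adj x y → y ∈ L) {a : V} (ha : a ∈ K) (ha' : a ∈ L) :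
    K ⊆ L := by
  by_contra hn
  obtain ⟨y, hy, hyL⟩ := not_subset.1 hn
  obtain ⟨p, hp, q, hq, hpq⟩ := hK.2 (K ∩ L) inter_subset_left ⟨a, by grind⟩ ⟨y, by grind⟩
  have := hL p (by grind) q (by grind) hpq
  grind

lemma conn_iff_connected (H : SimpleGraph V) (X : Finset V) :
    Conn H X ↔ (H.induce (X : Set V)).Connected := by
  constructor
  · intro h
    obtain ⟨a, ha⟩ := h.1
    have key : ∀ b : (X : Set V), (H.induce (X : Set V)).Reachable ⟨a, ha⟩ b := by
      by_contra hb
      push Not at hb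
      obtain ⟨⟨b, hbX⟩, hb⟩ := hb
      obtain ⟨p, hp, q, hq, hpq⟩ := h.2
        (X.filter fun x => ∃ hx : x ∈ X, (H.induce (X : Set V)).Reachable ⟨a, ha⟩ ⟨x, hx⟩)
        (filter_subset _ _) ⟨a, by simp [ha]⟩ ⟨b, by
          rw [mem_sdiff, mem_filter]; exact ⟨hbX, fun h' => hb h'.2.2⟩⟩
      rw [mem_filter] at hp
      rw [mem_sdiff, mem_filter] at hq
      obtain ⟨hp1, hp2, hp3⟩ := hp
      refine hq.2 ⟨hq.1, hq.1, hp3.trans ?_⟩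
      exact SimpleGraph.Adj.reachable (by simpa using hpq)
    rw [SimpleGraph.connected_iff]
    exact ⟨fun x y => (key x).symm.trans (key y), ⟨⟨a, ha⟩⟩⟩
  · intro h
    obtain ⟨⟨a, ha⟩⟩ := h.nonempty
    refine ⟨⟨a, ha⟩, fun Y hY ⟨y, hy⟩ ⟨z, hz⟩ => ?_⟩
    by_contra hno
    push Not at hno
    have hz1 := (mem_sdiff.1 hz).1
    obtain ⟨w⟩ := h.preconnected ⟨y, hY hy⟩ ⟨z, hz1⟩
    have : ∀ (s t : (X : Set V)) (w : (H.induce (X : Set V)).Walk s t),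
        (s : V) ∈ Y → (t : V) ∈ Y := by
      intro s t w
      induction w with
      | nil => exact id
      | @cons s r t hsr _ ih =>
        intro hs
        apply ih
        by_contra hr
        exact hno s hs r (mem_sdiff.2 ⟨r.2, hr⟩) (by simpa using hsr)
    exact (mem_sdiff.1 hz).2 (this _ _ w hy)

/-- The number of edges of `H` with both ends in `A`. -/
noncomputable def eI (H : SimpleGraph V) (A : Finset V) : ℕ :=
  #{e ∈ A.sym2 | e ∈ H.edgeSet}

lemma mem_eI {H : SimpleGraph V} {A : Finset V} {e : Sym2 V} :
    e ∈ ({e ∈ A.sym2 | e ∈ H.edgeSet} : Finset (Sym2 V)) ↔ (∀ v ∈ e, v ∈ A) ∧ e ∈ H.edgeSet := by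
  rw [mem_filter, mem_sym2_iff]

lemma eI_mono (H : SimpleGraph V) {A B : Finset V} (h : A ⊆ B) : eI H A ≤ eI H B := by
  apply card_le_card
  intro e
  simp only [mem_eI]
  exact fun he => ⟨fun v hv => h (he.1 v hv), he.2⟩

lemma eI_mono_graph {H H' : SimpleGraph V} {A : Finset V}
    (h : ∀ a ∈ A, ∀ b ∈ A, H.Adj a b → H'.Adj a b) : eI H A ≤ eI H' A := by
  apply card_le_card
  intro e
  simp only [mem_eI]
  induction e with
  | _ a b =>
    simp only [Sym2.mem_iff, forall_eq_or_imp, forall_eq, mem_edgeSet]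
    exact fun he => ⟨he.1, h a he.1.1 b he.1.2 he.2⟩

lemma eI_congr {H H' : SimpleGraph V} {A : Finset V}
    (h : ∀ a ∈ A, ∀ b ∈ A, H.Adj a b ↔ H'.Adj a b) : eI H A = eI H' A :=
  le_antisymm (eI_mono_graph fun a ha b hb => (h a ha b hb).1)
    (eI_mono_graph fun a ha b hb => (h a ha b hb).2)

lemma eI_union (H : SimpleGraph V) (A B : Finset V)
    (h : ∀ a ∈ A \ B, ∀ b ∈ B \ A, ¬ H.Adj a b) :
    eI H (A ∪ B) + eI H (A ∩ B) = eI H A + eI H B := by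
  unfold eI
  rw [← card_union_add_card_inter {e ∈ A.sym2 | e ∈ H.edgeSet} {e ∈ B.sym2 | e ∈ H.edgeSet}]
  congr 2
  · ext e
    simp only [mem_union, mem_eI]
    induction e with
    | _ a b =>
      simp only [Sym2.mem_iff, forall_eq_or_imp, forall_eq, mem_edgeSet]
      have h1 := h a
      have h2 := h b
      have := H.adj_comm a b
      have h1 := h a
      have h2 := h b
      simp only [mem_sdiff] at h1 h2
      by_cases a ∈ A <;> by_cases a ∈ B <;> by_cases b ∈ A <;> by_cases b ∈ B <;> simp_all
  · ext e
    simp only [mem_inter, mem_eI, forall_and, imp_and]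
    tauto

lemma eI_insert (H : SimpleGraph V) (A : Finset V) {v : V} (hv : v ∉ A) :
    eI H (insert v A) = eI H A + #{x ∈ A | H.Adj v x} := by
  unfold eI
  have : ({e ∈ (insert v A).sym2 | e ∈ H.edgeSet} : Finset (Sym2 V)) =
      ({e ∈ A.sym2 | e ∈ H.edgeSet} : Finset (Sym2 V)) ∪
        ({x ∈ A | H.Adj v x} : Finset V).image (fun x => s(v, x)) := by
    ext e
    simp only [mem_union, mem_image, mem_filter, mem_sym2_iff]
    induction e with
    | _ a b =>
      simp only [Sym2.mem_iff, forall_eq_or_imp, forall_eq, mem_edgeSet, mem_insert, Sym2.eq_iff]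
      have := H.adj_comm a b
      have := H.irrefl (v := v)
      constructor
      · rintro ⟨⟨rfl | ha, rfl | hb⟩, hab⟩
        · grind
        · exact Or.inr ⟨b, ⟨hb, hab⟩, by simp⟩
        · exact Or.inr ⟨a, ⟨ha, hab.symm⟩, by simp⟩
        · exact Or.inl ⟨⟨ha, hb⟩, hab⟩
      · rintro (⟨⟨ha, hb⟩, hab⟩ | ⟨x, ⟨hx, hvx⟩, ⟨rfl, rfl⟩ | ⟨rfl, rfl⟩⟩)
        · exact ⟨⟨Or.inr ha, Or.inr hb⟩, hab⟩
        · exact ⟨⟨Or.inl rfl, Or.inr hx⟩, hvx⟩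
        · exact ⟨⟨Or.inr hx, Or.inl rfl⟩, hvx.symm⟩
  rw [this, card_union_of_disjoint, card_image_of_injective]
  · intro x y hxy
    simp only [Sym2.eq_iff] at hxy
    grind
  · rw [Finset.disjoint_left]
    intro e he he'
    simp only [mem_image, mem_filter, mem_sym2_iff] at he he'
    obtain ⟨x, -, rfl⟩ := he'
    exact hv (he.1 v (by simp))

lemma eI_erase (H : SimpleGraph V) {A : Finset V} {v : V} (hv : v ∈ A) :
    eI H A = eI H (A.erase v) + #{x ∈ A | H.Adj v x} := by
  have := eI_insert H (A.erase v) (notMem_erase v A)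
  rw [insert_erase hv] at this
  rw [this]
  congr 2
  ext x
  have := H.irrefl (v := v)
  grind

lemma eI_empty (H : SimpleGraph V) : eI H ∅ = 0 := by
  simp [eI]

lemma sum_deg (H : SimpleGraph V) (A : Finset V) :
    ∑ v ∈ A, #{x ∈ A | H.Adj v x} = 2 * eI H A := by
  induction A using Finset.induction_on with
  | empty => simp [eI_empty]
  | insert v A hv ih =>
    rw [sum_insert hv, eI_insert H A hv]
    have h1 : #{x ∈ insert v A | H.Adj v x} = #{x ∈ A | H.Adj v x} := by
      congr 1
      ext x
      have := H.irrefl (v := v)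
      grind
    have h2 : ∀ w ∈ A, #{x ∈ insert v A | H.Adj w x}
        = #{x ∈ A | H.Adj w x} + if H.Adj v w then 1 else 0 := by
      intro w hw
      rw [filter_insert, H.adj_comm w v]
      split_ifs
      · rw [card_insert_of_notMem (by grind)]
      · rfl
    rw [h1, sum_congr rfl h2, sum_add_distrib, ih, ← card_filter]
    omega

lemma eI_le_choose (H : SimpleGraph V) (A : Finset V) : 2 * eI H A + #A ≤ #A * #A := by
  rw [← sum_deg, ← smul_eq_mul, ← sum_const, card_eq_sum_ones, ← sum_add_distrib,
    ← card_eq_sum_ones]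
  apply sum_le_sum
  intro v hv
  have : ({x ∈ A | H.Adj v x} : Finset V) ⊆ A.erase v := by
    intro x
    have := H.irrefl (v := v)
    grind
  have := card_le_card this
  rw [card_erase_of_mem hv] at this
  have : 0 < #A := card_pos.2 ⟨v, hv⟩
  omega

/-- The complete graph on the vertex set `S` (all other vertices are isolated). -/
def cliq (S : Finset V) : SimpleGraph V where
  Adj a b := a ∈ S ∧ b ∈ S ∧ a ≠ b
  symm := ⟨fun _ _ h => ⟨h.2.1, h.1, h.2.2.symm⟩⟩
  loopless := ⟨fun _ h => h.2.2 rfl⟩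

end

section

open scoped Classical
variable {V : Type}

/-- `(A, B)` is a separation of the subgraph of `H` induced by `U`. -/
def Sepn (H : SimpleGraph V) (U A B : Finset V) : Prop :=
  A ∪ B = U ∧ ∀ a ∈ A \ B, ∀ b ∈ B \ A, ¬ H.Adj a b

lemma Sepn.symm {H : SimpleGraph V} {U A B : Finset V} (h : Sepn H U A B) : Sepn H U B A :=
  ⟨by rw [union_comm, h.1], fun a ha b hb hab => h.2 b hb a ha hab.symm⟩

lemma eI_pos_of_adj {H : SimpleGraph V} {U : Finset V} {x y : V} (hx : x ∈ U) (hy : y ∈ U)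
    (h : H.Adj x y) : eI (H.deleteEdges {s(x, y)}) U + 1 = eI H U := by
  have : eI (H.deleteEdges {s(x, y)}) U =
      #(({e ∈ U.sym2 | e ∈ H.edgeSet} : Finset (Sym2 V)).erase s(x, y)) := by
    unfold eI
    congr 1
    ext e
    simp only [mem_filter, edgeSet_deleteEdges, mem_erase, Set.mem_diff, Set.mem_singleton_iff]
    tauto
  rw [this, card_erase_add_one, eI]
  simp only [mem_filter, mem_sym2_iff, Sym2.mem_iff, mem_edgeSet]
  exact ⟨by grind, h⟩

lemma eI_lt_of_delete {H : SimpleGraph V} {U A : Finset V} {x y : V} (hA : A ⊆ U) (hx : x ∈ U)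
    (hy : y ∈ U) (h : H.Adj x y) : eI (H.deleteEdges {s(x, y)}) A < eI H U := by
  have := eI_pos_of_adj hx hy h
  have := eI_mono (H.deleteEdges {s(x, y)}) hA
  omega

/-- A `Z`-`X` linkage in `H[U]` of size `k`, indexed by its ends in `X`. -/
def Linkage (H : SimpleGraph V) (U Z X : Finset V) (k : ℕ) : Prop :=
  ∃ T ⊆ X, #T = k ∧ ∃ P : V → Finset V,
    (∀ t ∈ T, t ∈ P t ∧ Conn H (P t) ∧ P t ⊆ U ∧ (P t ∩ Z).Nonempty) ∧
    ∀ s ∈ T, ∀ t ∈ T, s ≠ t → Disjoint (P s) (P t)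

lemma glue {H H' : SimpleGraph V} (hle : H' ≤ H) {U Z X A B : Finset V} {k : ℕ} {x y : V}
    (hAB : A ∪ B = U) (hxA : x ∈ A) (hxB : x ∉ B) (hyB : y ∈ B) (hyA : y ∉ A) (hxy : H.Adj x y)
    (hS : #(A ∩ B) + 1 = k) (h1 : Linkage H' A Z (insert x (A ∩ B)) k)
    (h2 : Linkage H' B (insert y (A ∩ B)) X k) : Linkage H U Z X k := by
  obtain ⟨T, hT, hTk, P, hP, hPd⟩ := h1
  have hTe : T = insert x (A ∩ B) := by
    apply eq_of_subset_of_card_le hT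
    rw [card_insert_of_notMem (by grind)]
    omega
  subst hTe
  obtain ⟨T', hT', hTk', Q, hQ, hQd⟩ := h2
  choose! g hg using fun t ht => (hQ t ht).2.2.2
  have hg' : ∀ t ∈ T', g t ∈ Q t ∧ g t ∈ insert y (A ∩ B) := fun t ht => by
    simpa using hg t ht
  have hinj : ∀ s ∈ T', ∀ t ∈ T', g s = g t → s = t := by
    intro s hs t ht hst
    by_contra hne
    exact Finset.disjoint_left.1 (hQd s hs t ht hne) (hg' s hs).1 (hst ▸ (hg' t ht).1)
  have hsurj : ∀ r ∈ insert y (A ∩ B), ∃ t ∈ T', g t = r := by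
    have := surjOn_of_injOn_of_card_le (s := T') (t := insert y (A ∩ B)) g
      (fun t ht => (hg' t ht).2) (fun s hs t ht => hinj s hs t ht)
      (by rw [card_insert_of_notMem (by grind)]; omega)
    intro r hr
    obtain ⟨t, ht, h⟩ := this hr
    exact ⟨t, ht, h⟩
  let f : V → V := fun t => if g t = y then x else g t
  have hf : ∀ t ∈ T', f t ∈ insert x (A ∩ B) := by
    intro t ht
    have := (hg' t ht).2
    simp only [f]
    grind
  have hcross : ∀ t ∈ T', ∀ r ∈ insert x (A ∩ B), r ≠ f t → Disjoint (P r) (Q t) := by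
    intro t ht r hr hrt
    rw [Finset.disjoint_left]
    intro c hc1 hc2
    have hcA := (hP r hr).2.2.1 hc1
    have hcB := (hQ t ht).2.2.1 hc2
    have hcS : c ∈ A ∩ B := by grind
    have hcr : c = r := by
      by_contra hne
      exact Finset.disjoint_left.1 (hPd c (by grind) r hr hne) (hP c (by grind)).1 hc1
    subst hcr
    obtain ⟨t', ht', h'⟩ := hsurj c (by grind)
    have : t = t' := by
      by_contra hne
      exact Finset.disjoint_left.1 (hQd t ht t' ht' hne) hc2 (h' ▸ (hg' t' ht').1)
    subst this
    apply hrt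
    simp only [f]
    grind
  refine ⟨T', hT', hTk', fun t => P (f t) ∪ Q t, fun t ht => ⟨?_, ?_, ?_, ?_⟩, ?_⟩
  · exact mem_union_right _ (hQ t ht).1
  · have c1 := (hP _ (hf t ht)).2.1.mono hle
    have c2 := (hQ t ht).2.1.mono hle
    by_cases hgy : g t = y
    · have hfx : f t = x := by simp [f, hgy]
      exact c1.union c2 ⟨x, hfx ▸ (hP _ (hf t ht)).1, y, hgy ▸ (hg' t ht).1, hxy⟩
    · have hfx : f t = g t := by simp [f, hgy]
      exact c1.union_of_mem c2 (a := f t) (hP _ (hf t ht)).1 (hfx ▸ (hg' t ht).1)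
  · rw [← hAB]
    exact union_subset_union (hP _ (hf t ht)).2.2.1 (hQ t ht).2.2.1
  · obtain ⟨z, hz⟩ := (hP _ (hf t ht)).2.2.2
    exact ⟨z, by grind⟩
  · intro s hs t ht hst
    have hfne : f s ≠ f t := by
      intro h
      apply hst
      apply hinj s hs t ht
      have h3 := (hg' s hs).2
      have h4 := (hg' t ht).2
      simp only [f] at h
      grind
    have d1 := hPd _ (hf s hs) _ (hf t ht) hfne
    have d2 := hQd s hs t ht hst
    have d3 := hcross t ht _ (hf s hs) hfne
    have d4 := hcross s hs _ (hf t ht) hfne.symm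
    rw [disjoint_union_left, disjoint_union_right, disjoint_union_right]
    exact ⟨⟨d1, d3⟩, d4.symm, d2⟩

/-- Menger's theorem, for connected sets instead of paths. -/
theorem menger (n : ℕ) : ∀ (H : SimpleGraph V) (U Z X : Finset V) (k : ℕ), eI H U = n →
    Z ⊆ U → X ⊆ U → (∀ A B, Sepn H U A B → Z ⊆ A → X ⊆ B → k ≤ #(A ∩ B)) →
    Linkage H U Z X k := by
  induction n using Nat.strong_induction_on with
  | _ n ih =>
  intro H U Z X k hn hZ hX h
  by_cases hE : ∃ x ∈ U, ∃ y ∈ U, H.Adj x y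
  swap
  · push Not at hE
    have := h (U \ (X \ Z)) X ⟨by grind, fun a ha b hb => hE a (by grind) b (by grind)⟩
      (by grind) le_rfl
    obtain ⟨T, hT, hTk⟩ := exists_subset_card_eq this
    refine ⟨T, by grind, hTk, fun t => {t}, fun t ht => ⟨by simp, conn_singleton _ _, by grind,
      ⟨t, by grind⟩⟩, fun s _ t _ hst => by simpa using hst⟩
  obtain ⟨x, hx, y, hy, hxy⟩ := hE
  set H' := H.deleteEdges {s(x, y)} with hH'
  have hle : H' ≤ H := deleteEdges_le _
  have hadj : ∀ a b, H.Adj a b → ¬ H'.Adj a b → (a = x ∧ b = y) ∨ (a = y ∧ b = x) := by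
    intro a b h1 h2
    rw [hH', deleteEdges_adj] at h2
    simp only [Set.mem_singleton_iff, Sym2.eq_iff] at h2
    tauto
  by_cases h' : ∀ A B, Sepn H' U A B → Z ⊆ A → X ⊆ B → k ≤ #(A ∩ B)
  · obtain ⟨T, hT, hTk, P, hP, hPd⟩ := ih _ (hn ▸ eI_lt_of_delete le_rfl hx hy hxy) H' U Z X k rfl
      hZ hX h'
    exact ⟨T, hT, hTk, P, fun t ht => ⟨(hP t ht).1, (hP t ht).2.1.mono hle, (hP t ht).2.2⟩, hPd⟩
  push Not at h'
  obtain ⟨A, B, hAB, hZA, hXB, hk⟩ := h'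
  have key : ∀ x y : V, H.Adj x y → H' = H.deleteEdges {s(x, y)} →
      (∀ a b, H.Adj a b → ¬ H'.Adj a b → (a = x ∧ b = y) ∨ (a = y ∧ b = x)) →
      x ∈ A \ B → y ∈ B \ A → Linkage H U Z X k := by
    intro x y hxy hH' hadj hxA hyB
    have hAU : A ⊆ U := by rw [← hAB.1]; exact subset_union_left
    have hBU : B ⊆ U := by rw [← hAB.1]; exact subset_union_right
    have hxU : x ∈ U := hAU (by grind)
    have hyU : y ∈ U := hBU (by grind)
    have hkk := h (insert y A) B ⟨by have := hAB.1; grind, by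
      intro a ha b hb hab
      have h1 := hAB.2 a
      have h2 := hadj a b hab
      grind⟩ (by grind) hXB
    have hc : insert y A ∩ B = insert y (A ∩ B) := by grind
    rw [hc, card_insert_of_notMem (by grind)] at hkk
    refine glue hle hAB.1 (by grind) (by grind) (by grind) (by grind) hxy (by omega)
      (ih _ ?_ H' A Z _ k rfl hZA (by grind) ?_) (ih _ ?_ H' B _ X k rfl (by grind) hXB ?_)
    · rw [← hn, hH']
      exact eI_lt_of_delete hAU hxU hyU hxy
    · intro A' B' hAB' h1 h2
      have := h A' (B' ∪ B) ⟨by have := hAB.1; have := hAB'.1; grind, by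
        intro a ha b hb hab
        have e1 := hAB.2 a
        have e2 := hadj a b hab
        have e3 := hAB'.2 a
        have := hAB'.1
        grind⟩ h1 (by grind)
      have hc : A' ∩ (B' ∪ B) = A' ∩ B' := by
        have := hAB'.1
        grind
      rwa [hc] at this
    · rw [← hn, hH']
      exact eI_lt_of_delete hBU hxU hyU hxy
    · intro A' B' hAB' h1 h2
      have := h (A' ∪ A) B' ⟨by have := hAB.1; have := hAB'.1; grind, by
        intro a ha b hb hab
        have e1 := hAB.2 a
        have e2 := hadj a b hab
        have e3 := hAB'.2 a
        have := hAB'.1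
        grind⟩ (by grind) h2
      have hc : (A' ∪ A) ∩ B' = A' ∩ B' := by
        have := hAB'.1
        grind
      rwa [hc] at this
  by_cases hs : Sepn H U A B
  · exact absurd (h A B hs hZA hXB) (by omega)
  have : ∃ a ∈ A \ B, ∃ b ∈ B \ A, H.Adj a b := by
    by_contra hno
    push Not at hno
    exact hs ⟨hAB.1, hno⟩
  obtain ⟨a, ha, b, hb, hab⟩ := this
  rcases hadj a b hab (hAB.2 a ha b hb) with ⟨rfl, rfl⟩ | ⟨rfl, rfl⟩
  · exact key a b hab hH' hadj ha hb
  · exact key a b hab (by rw [hH', Sym2.eq_swap]) (fun c d h1 h2 => (hadj c d h1 h2).symm) ha hb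

/-- Linking a set `Z` completely to a set `X`: disjoint connected sets, one for each `z ∈ Z`,
each with a vertex `e z ∈ X`. -/
lemma link {H : SimpleGraph V} {U Z X : Finset V} (hZ : Z ⊆ U) (hX : X ⊆ U)
    (h : ∀ A B, Sepn H U A B → Z ⊆ A → X ⊆ B → #Z ≤ #(A ∩ B)) :
    ∃ (P : V → Finset V) (e : V → V),
      (∀ z ∈ Z, z ∈ P z ∧ Conn H (P z) ∧ P z ⊆ U ∧ e z ∈ X ∧ e z ∈ P z) ∧
      ∀ s ∈ Z, ∀ t ∈ Z, s ≠ t → Disjoint (P s) (P t) := by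
  obtain ⟨T, hT, hTk, P, hP, hPd⟩ := menger _ H U X Z #Z rfl hX hZ
    (fun A B hAB h1 h2 => by rw [inter_comm]; exact h B A hAB.symm h2 h1)
  have : T = Z := eq_of_subset_of_card_le hT hTk.ge
  subst this
  choose! e he using fun t ht => (hP t ht).2.2.2
  exact ⟨P, e, fun z hz => ⟨(hP z hz).1, (hP z hz).2.1, (hP z hz).2.2.1, by
    have := he z hz; grind⟩, hPd⟩

/-- A connected set containing `z` and meeting `X` contains a connected set that contains `z`
and meets `X` in precisely one vertex, which is not a cut vertex. -/
lemma trim {H : SimpleGraph V} {B X : Finset V} {z : V} (hB : Conn H B) (hz : z ∈ B)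
    (hX : (B ∩ X).Nonempty) (hzX : z ∉ X) :
    ∃ K ⊆ B \ X, ∃ x ∈ B ∩ X, z ∈ K ∧ Conn H K ∧ ∃ y ∈ K, H.Adj y x := by
  obtain ⟨K, hK, hzK, hKc, hcl⟩ := exists_comp H (W := B \ X) (a := z) (by grind)
  obtain ⟨x, hx⟩ := hX
  obtain ⟨a, ha, b, hb, hab⟩ := hB.2 K (by grind) ⟨z, hzK⟩ ⟨x, by grind⟩
  have := hcl a ha b
  exact ⟨K, hK, b, by grind, hzK, hKc, a, ha, hab⟩

/-- Linking `Z` to `X` such that each linking set meets `X` in only one vertex. -/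
lemma link_trim {H : SimpleGraph V} {U Z X : Finset V} (hZ : Z ⊆ U) (hX : X ⊆ U)
    (h : ∀ A B, Sepn H U A B → Z ⊆ A → X ⊆ B → #Z ≤ #(A ∩ B)) :
    ∃ (P : V → Finset V) (e : V → V),
      (∀ z ∈ Z, z ∈ P z ∧ Conn H (P z) ∧ P z ⊆ U ∧ P z ∩ X = {e z}) ∧
      ∀ s ∈ Z, ∀ t ∈ Z, s ≠ t → Disjoint (P s) (P t) := by
  obtain ⟨P, e, hP, hPd⟩ := link hZ hX h
  have : ∀ z ∈ Z, ∃ (Q : Finset V) (x : V), Q ⊆ P z ∧ z ∈ Q ∧ Conn H Q ∧ Q ∩ X = {x} := by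
    intro z hz
    obtain ⟨h1, h2, h3, h4, h5⟩ := hP z hz
    by_cases hzX : z ∈ X
    · exact ⟨{z}, z, by grind, by simp, conn_singleton _ _, by grind⟩
    · obtain ⟨K, hK, x, hx, hzK, hKc, y, hy, hyx⟩ := trim h2 h1 ⟨e z, by grind⟩ hzX
      refine ⟨insert x K, x, by grind, by grind, hKc.insert hy hyx.symm, ?_⟩
      ext t
      grind
  choose! Q x hQ using this
  exact ⟨Q, x, fun z hz => ⟨(hQ z hz).2.1, (hQ z hz).2.2.1, (hQ z hz).1.trans (hP z hz).2.2.1,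
    (hQ z hz).2.2.2⟩, fun s hs t ht hst => (hPd s hs t ht hst).mono (hQ s hs).1 (hQ t ht).1⟩

end

section

open scoped Classical
variable {V : Type}

/-- A `Z`-rooted model of `K*₄,₂` (for `#Z = 4`) in `H[U]`: the bags `β z` for `z ∈ Z` and
the two bags `C₀`, `C₁`. -/
structure K42Data (H : SimpleGraph V) (U Z : Finset V) (β : V → Finset V) (C₀ C₁ : Finset V) :
    Prop where
  mem : ∀ z ∈ Z, z ∈ β z
  conn : ∀ z ∈ Z, Conn H (β z)
  sub : ∀ z ∈ Z, β z ⊆ U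
  disj : ∀ z ∈ Z, ∀ y ∈ Z, z ≠ y → Disjoint (β z) (β y)
  conn₀ : Conn H C₀
  conn₁ : Conn H C₁
  sub₀ : C₀ ⊆ U
  sub₁ : C₁ ⊆ U
  disj₀₁ : Disjoint C₀ C₁
  disj₀ : ∀ z ∈ Z, Disjoint (β z) C₀
  disj₁ : ∀ z ∈ Z, Disjoint (β z) C₁
  touch₀₁ : Touch H C₀ C₁
  touch₀ : ∀ z ∈ Z, Touch H (β z) C₀
  touch₁ : ∀ z ∈ Z, Touch H (β z) C₁

/-- `H[U]` has a `Z`-rooted model of `K*₄,₂`. -/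
def K42 (H : SimpleGraph V) (U Z : Finset V) : Prop := ∃ β C₀ C₁, K42Data H U Z β C₀ C₁

lemma K42.mono {H : SimpleGraph V} {U U' Z Z' : Finset V} (h : K42 H U Z) (hU : U ⊆ U')
    (hZ : Z' ⊆ Z) : K42 H U' Z' := by
  obtain ⟨β, C₀, C₁, h⟩ := h
  exact ⟨β, C₀, C₁, fun z hz => h.mem z (hZ hz), fun z hz => h.conn z (hZ hz),
    fun z hz => (h.sub z (hZ hz)).trans hU, fun z hz y hy => h.disj z (hZ hz) y (hZ hy), h.conn₀,
    h.conn₁, h.sub₀.trans hU, h.sub₁.trans hU, h.disj₀₁, fun z hz => h.disj₀ z (hZ hz),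
    fun z hz => h.disj₁ z (hZ hz), h.touch₀₁, fun z hz => h.touch₀ z (hZ hz),
    fun z hz => h.touch₁ z (hZ hz)⟩

/-- Edges with both ends in `Z` are irrelevant for `Z`-rooted models. -/
lemma K42.congr {H H' : SimpleGraph V} {U Z : Finset V} (h : K42 H U Z)
    (hH : ∀ a b, H.Adj a b → H'.Adj a b ∨ (a ∈ Z ∧ b ∈ Z)) : K42 H' U Z := by
  obtain ⟨β, C₀, C₁, h⟩ := h
  have hz : ∀ z ∈ Z, ∀ a ∈ β z, a ∈ Z → a = z := by
    intro z hz a ha haZ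
    by_contra hne
    exact Finset.disjoint_left.1 (h.disj a haZ z hz hne) (h.mem a haZ) ha
  have h0 : ∀ a ∈ C₀, a ∉ Z := fun a ha haZ =>
    Finset.disjoint_left.1 (h.disj₀ a haZ) (h.mem a haZ) ha
  have h1 : ∀ a ∈ C₁, a ∉ Z := fun a ha haZ =>
    Finset.disjoint_left.1 (h.disj₁ a haZ) (h.mem a haZ) ha
  have ht : ∀ X Y : Finset V, (∀ y ∈ Y, y ∉ Z) → Touch H X Y → Touch H' X Y := by
    rintro X Y hY ⟨a, ha, b, hb, hab⟩
    exact ⟨a, ha, b, hb, (hH a b hab).resolve_right fun h' => hY b hb h'.2⟩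
  refine ⟨β, C₀, C₁, h.mem, fun z hzZ => (h.conn z hzZ).congr fun a ha b hb hab => ?_, h.sub,
    h.disj, h.conn₀.congr fun a ha b hb hab => ?_, h.conn₁.congr fun a ha b hb hab => ?_, h.sub₀,
    h.sub₁, h.disj₀₁, h.disj₀, h.disj₁, ht _ _ h1 h.touch₀₁, fun z hz => ht _ _ h0 (h.touch₀ z hz),
    fun z hz => ht _ _ h1 (h.touch₁ z hz)⟩
  · refine (hH a b hab).resolve_right fun h' => hab.ne ?_
    rw [hz z hzZ a ha h'.1, hz z hzZ b hb h'.2]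
  · exact (hH a b hab).resolve_right fun h' => h0 a ha h'.1
  · exact (hH a b hab).resolve_right fun h' => h1 a ha h'.1

lemma K42.mono_graph {H H' : SimpleGraph V} {U Z : Finset V} (h : K42 H U Z) (hH : H ≤ H') :
    K42 H' U Z := h.congr fun _ _ hab => Or.inl (hH hab)

/-- `β` is a model of `H'[U']` in `H[U]`. -/
structure Model {W : Type} (H' : SimpleGraph W) (U' : Finset W) (H : SimpleGraph V) (U : Finset V)
    (β : W → Finset V) : Prop where
  conn : ∀ a ∈ U', Conn H (β a)
  sub : ∀ a ∈ U', β a ⊆ U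
  disj : ∀ a ∈ U', ∀ b ∈ U', a ≠ b → Disjoint (β a) (β b)
  touch : ∀ a ∈ U', ∀ b ∈ U', H'.Adj a b → Touch H (β a) (β b)

section
variable {W : Type} {H' : SimpleGraph W} {U' : Finset W} {H : SimpleGraph V} {U : Finset V}
    {β : W → Finset V}

lemma Model.conn_biUnion (h : Model H' U' H U β) {X : Finset W} (hX : Conn H' X) (hXU : X ⊆ U') :
    Conn H (X.biUnion β) :=
  hX.biUnion (fun a ha => h.conn a (hXU ha))
    (fun a ha b hb hab => Or.inl (h.touch a (hXU ha) b (hXU hb) hab))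

lemma Model.sub_biUnion (h : Model H' U' H U β) {X : Finset W} (hXU : X ⊆ U') :
    X.biUnion β ⊆ U :=
  biUnion_subset.2 fun a ha => h.sub a (hXU ha)

lemma Model.touch_biUnion (h : Model H' U' H U β) {X Y : Finset W} (hXY : Touch H' X Y)
    (hXU : X ⊆ U') (hYU : Y ⊆ U') : Touch H (X.biUnion β) (Y.biUnion β) := by
  obtain ⟨a, ha, b, hb, hab⟩ := hXY
  exact (h.touch a (hXU ha) b (hYU hb) hab).sub (subset_biUnion_of_mem β ha)
    (subset_biUnion_of_mem β hb)

lemma Model.disj_biUnion (h : Model H' U' H U β) {X Y : Finset W} (hXY : Disjoint X Y)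
    (hXU : X ⊆ U') (hYU : Y ⊆ U') : Disjoint (X.biUnion β) (Y.biUnion β) := by
  rw [disjoint_biUnion_left]
  intro a ha
  rw [disjoint_biUnion_right]
  intro b hb
  exact h.disj a (hXU ha) b (hYU hb) (by rintro rfl; exact Finset.disjoint_left.1 hXY ha hb)

lemma Model.comp {W₂ : Type} {H₂ : SimpleGraph W₂} {U₂ : Finset W₂} {γ : W₂ → Finset W}
    (h : Model H' U' H U β) (h₂ : Model H₂ U₂ H' U' γ) :
    Model H₂ U₂ H U (fun a => (γ a).biUnion β) where
  conn a ha := h.conn_biUnion (h₂.conn a ha) (h₂.sub a ha)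
  sub a ha := h.sub_biUnion (h₂.sub a ha)
  disj a ha b hb hab := h.disj_biUnion (h₂.disj a ha b hb hab) (h₂.sub a ha) (h₂.sub b hb)
  touch a ha b hb hab := h.touch_biUnion (h₂.touch a ha b hb hab) (h₂.sub a ha) (h₂.sub b hb)

end

lemma K42.lift {H' H : SimpleGraph V} {U' U Z : Finset V} {β : V → Finset V}
    (h : K42 H' U' Z) (hm : Model H' U' H U β) (hZ : ∀ z ∈ Z, z ∈ β z) : K42 H U Z := by
  obtain ⟨γ, C₀, C₁, h⟩ := h
  exact ⟨fun a => (γ a).biUnion β, C₀.biUnion β, C₁.biUnion β,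
    fun z hz => mem_biUnion.2 ⟨z, h.mem z hz, hZ z hz⟩,
    fun z hz => hm.conn_biUnion (h.conn z hz) (h.sub z hz),
    fun z hz => hm.sub_biUnion (h.sub z hz),
    fun z hz y hy hzy => hm.disj_biUnion (h.disj z hz y hy hzy) (h.sub z hz) (h.sub y hy),
    hm.conn_biUnion h.conn₀ h.sub₀, hm.conn_biUnion h.conn₁ h.sub₁, hm.sub_biUnion h.sub₀,
    hm.sub_biUnion h.sub₁, hm.disj_biUnion h.disj₀₁ h.sub₀ h.sub₁,
    fun z hz => hm.disj_biUnion (h.disj₀ z hz) (h.sub z hz) h.sub₀,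
    fun z hz => hm.disj_biUnion (h.disj₁ z hz) (h.sub z hz) h.sub₁,
    hm.touch_biUnion h.touch₀₁ h.sub₀ h.sub₁,
    fun z hz => hm.touch_biUnion (h.touch₀ z hz) (h.sub z hz) h.sub₀,
    fun z hz => hm.touch_biUnion (h.touch₁ z hz) (h.sub z hz) h.sub₁⟩

/-- Extending a rooted model along a linkage. -/
lemma K42.glue {H : SimpleGraph V} {A B S Z : Finset V} {P : V → Finset V} {e : V → V}
    (h : K42 H B S) (hAB : A ∩ B ⊆ S)
    (hP : ∀ z ∈ Z, z ∈ P z ∧ Conn H (P z) ∧ P z ⊆ A ∧ e z ∈ S ∧ e z ∈ P z)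
    (hd : ∀ s ∈ Z, ∀ t ∈ Z, s ≠ t → Disjoint (P s) (P t)) : K42 H (A ∪ B) Z := by
  obtain ⟨β, C₀, C₁, h⟩ := h
  have hβ : ∀ s ∈ S, ∀ a ∈ β s, a ∈ A → a = s := by
    intro s hs a ha haA
    have haS : a ∈ S := hAB (mem_inter.2 ⟨haA, h.sub s hs ha⟩)
    by_contra hne
    exact Finset.disjoint_left.1 (h.disj a haS s hs hne) (h.mem a haS) ha
  have h0 : ∀ a ∈ C₀, a ∉ A := fun a ha haA => by
    have haS : a ∈ S := hAB (mem_inter.2 ⟨haA, h.sub₀ ha⟩)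
    exact Finset.disjoint_left.1 (h.disj₀ a haS) (h.mem a haS) ha
  have h1 : ∀ a ∈ C₁, a ∉ A := fun a ha haA => by
    have haS : a ∈ S := hAB (mem_inter.2 ⟨haA, h.sub₁ ha⟩)
    exact Finset.disjoint_left.1 (h.disj₁ a haS) (h.mem a haS) ha
  have hcross : ∀ s ∈ Z, ∀ t ∈ Z, s ≠ t → Disjoint (P s) (β (e t)) := by
    intro s hs t ht hst
    rw [Finset.disjoint_left]
    intro a ha ha'
    obtain ⟨p1, p2, p3, p4, p5⟩ := hP s hs
    obtain ⟨q1, q2, q3, q4, q5⟩ := hP t ht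
    have := hβ _ q4 a ha' (p3 ha)
    exact Finset.disjoint_left.1 (hd s hs t ht hst) ha (this ▸ q5)
  have hinj : ∀ s ∈ Z, ∀ t ∈ Z, s ≠ t → e s ≠ e t := by
    intro s hs t ht hst hest
    exact Finset.disjoint_left.1 (hd s hs t ht hst) (hP s hs).2.2.2.2 (hest ▸ (hP t ht).2.2.2.2)
  refine ⟨fun z => P z ∪ β (e z), C₀, C₁, fun z hz => mem_union_left _ (hP z hz).1,
    fun z hz => ?_, fun z hz => ?_, fun s hs t ht hst => ?_, h.conn₀, h.conn₁,
    h.sub₀.trans subset_union_right, h.sub₁.trans subset_union_right, h.disj₀₁, fun z hz => ?_,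
    fun z hz => ?_, h.touch₀₁, fun z hz => ?_, fun z hz => ?_⟩
  · obtain ⟨p1, p2, p3, p4, p5⟩ := hP z hz
    exact p2.union_of_mem (h.conn _ p4) p5 (h.mem _ p4)
  · obtain ⟨p1, p2, p3, p4, p5⟩ := hP z hz
    exact union_subset_union p3 (h.sub _ p4)
  · rw [disjoint_union_left, disjoint_union_right, disjoint_union_right]
    exact ⟨⟨hd s hs t ht hst, hcross s hs t ht hst⟩, (hcross t ht s hs hst.symm).symm,
      h.disj _ (hP s hs).2.2.2.1 _ (hP t ht).2.2.2.1 (hinj s hs t ht hst)⟩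
  · obtain ⟨p1, p2, p3, p4, p5⟩ := hP z hz
    rw [disjoint_union_left]
    exact ⟨Finset.disjoint_right.2 fun a ha ha' => h0 a ha (p3 ha'), h.disj₀ _ p4⟩
  · obtain ⟨p1, p2, p3, p4, p5⟩ := hP z hz
    rw [disjoint_union_left]
    exact ⟨Finset.disjoint_right.2 fun a ha ha' => h1 a ha (p3 ha'), h.disj₁ _ p4⟩
  · obtain ⟨p1, p2, p3, p4, p5⟩ := hP z hz
    exact (h.touch₀ _ p4).sub subset_union_right le_rfl
  · obtain ⟨p1, p2, p3, p4, p5⟩ := hP z hz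
    exact (h.touch₁ _ p4).sub subset_union_right le_rfl

/-- A rooted `K*₄,₂`-model yields a rooted model of a complete graph if all pairs of roots other
than `a`, `b` are adjacent. -/
lemma K42.rooted_clique {H : SimpleGraph V} {B S : Finset V} (h : K42 H B S) {a b : V}
    (ha : a ∈ S) (hb : b ∈ S) (hab : a ≠ b)
    (hS : ∀ x ∈ S, ∀ y ∈ S, x ≠ y → x ≠ a → x ≠ b → y ≠ a → y ≠ b → H.Adj x y) :
    ∃ γ, Model (cliq S) S H B γ ∧ ∀ s ∈ S, s ∈ γ s := by
  obtain ⟨β, C₀, C₁, h⟩ := h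
  let γ : V → Finset V := fun x => if x = a then β a ∪ C₀ else if x = b then β b ∪ C₁ else β x
  have ga : γ a = β a ∪ C₀ := by simp [γ]
  have gb : γ b = β b ∪ C₁ := by simp [γ, hab.symm]
  have gx : ∀ x, x ≠ a → x ≠ b → γ x = β x := fun x h1 h2 => by simp [γ, h1, h2]
  have hsub : ∀ x, β x ⊆ γ x := by
    intro x
    by_cases h1 : x = a
    · subst h1; rw [ga]; exact subset_union_left
    by_cases h2 : x = b
    · subst h2; rw [gb]; exact subset_union_left
    rw [gx x h1 h2]
  have hc0 : C₀ ⊆ γ a := by rw [ga]; exact subset_union_right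
  have hc1 : C₁ ⊆ γ b := by rw [gb]; exact subset_union_right
  have hta : ∀ y ∈ S, y ≠ a → Touch H (γ a) (γ y) := by
    intro y hy hya
    exact (h.touch₀ y hy).symm.sub hc0 (hsub y)
  have htb : ∀ y ∈ S, y ≠ b → Touch H (γ b) (γ y) := by
    intro y hy hya
    exact (h.touch₁ y hy).symm.sub hc1 (hsub y)
  refine ⟨γ, ⟨fun x hx => ?_, fun x hx => ?_, fun x hx y hy hxy => ?_, fun x hx y hy hxy => ?_⟩,
    fun s hs => hsub s (h.mem s hs)⟩
  · by_cases h1 : x = a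
    · subst h1; rw [ga]; exact (h.conn _ hx).union h.conn₀ (h.touch₀ _ hx)
    by_cases h2 : x = b
    · subst h2; rw [gb]; exact (h.conn _ hx).union h.conn₁ (h.touch₁ _ hx)
    rw [gx x h1 h2]
    exact h.conn _ hx
  · by_cases h1 : x = a
    · subst h1; rw [ga]; exact union_subset (h.sub _ hx) h.sub₀
    by_cases h2 : x = b
    · subst h2; rw [gb]; exact union_subset (h.sub _ hx) h.sub₁
    rw [gx x h1 h2]
    exact h.sub _ hx
  · have d := h.disj x hx y hy hxy
    have d1 := h.disj₀ x hx
    have d2 := h.disj₀ y hy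
    have d3 := h.disj₁ x hx
    have d4 := h.disj₁ y hy
    have d5 := h.disj₀₁
    rw [Finset.disjoint_left] at d d1 d2 d3 d4 d5 ⊢
    intro t
    simp only [γ]
    split_ifs <;> grind
  · have hne := hxy.2.2
    by_cases h1 : x = a
    · subst h1; exact hta y hy hne.symm
    by_cases h2 : x = b
    · subst h2; exact htb y hy hne.symm
    by_cases h3 : y = a
    · subst h3; exact (hta x hx hne).symm
    by_cases h4 : y = b
    · subst h4; exact (htb x hx hne).symm
    exact ⟨x, hsub x (h.mem x hx), y, hsub y (h.mem y hy), hS x hx y hy hne h1 h2 h3 h4⟩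

lemma K42.rooted_clique_of_card_le {H : SimpleGraph V} {B S : Finset V} (h : K42 H B S)
    (hS : #S ≤ 3) : ∃ γ, Model (cliq S) S H B γ ∧ ∀ s ∈ S, s ∈ γ s := by
  by_cases h1 : #S ≤ 1
  · obtain ⟨β, C₀, C₁, h⟩ := h
    refine ⟨β, ⟨h.conn, h.sub, h.disj, fun x hx y hy hxy => ?_⟩, h.mem⟩
    exact absurd (card_le_one.1 h1 x hx y hy) hxy.2.2
  obtain ⟨a, ha, b, hb, hab⟩ := one_lt_card.1 (not_le.1 h1)
  refine h.rooted_clique ha hb hab fun x hx y hy hxy h1 h2 h3 h4 => ?_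
  exfalso
  have : ({a, b, x, y} : Finset V) ⊆ S := by grind
  have := card_le_card this
  rw [card_insert_of_notMem (by grind), card_insert_of_notMem (by grind),
    card_pair hxy] at this
  omega

/-- Adding a clique on `S` to one side of a separation can be simulated by a rooted model of
a clique in the other side. -/
lemma Model.of_rooted {H : SimpleGraph V} {A B S : Finset V} {γ : V → Finset V}
    (h : Model (cliq S) S H B γ) (hS : ∀ s ∈ S, s ∈ γ s) (hAB : A ∩ B ⊆ S) :
    Model (H ⊔ cliq S) A H (A ∪ B) (fun x => if x ∈ S then γ x else {x}) := by
  have hm : ∀ x, x ∈ (if x ∈ S then γ x else {x}) := by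
    intro x
    split_ifs with hx
    · exact hS x hx
    · simp
  refine ⟨fun x hx => ?_, fun x hx => ?_, fun x hx y hy hxy => ?_, fun x hx y hy hxy => ?_⟩
  · split_ifs with hxS
    · exact h.conn x hxS
    · exact conn_singleton _ _
  · split_ifs with hxS
    · exact (h.sub x hxS).trans subset_union_right
    · simp [hx]
  · split_ifs with h1 h2 h2
    · exact h.disj x h1 y h2 hxy
    · rw [disjoint_singleton_right]
      exact fun hy' => h2 (hAB (mem_inter.2 ⟨hy, h.sub x h1 hy'⟩))
    · rw [disjoint_singleton_left]
      exact fun hy' => h1 (hAB (mem_inter.2 ⟨hx, h.sub y h2 hy'⟩))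
    · simpa using hxy
  · rcases hxy with hxy | hxy
    · exact ⟨x, hm x, y, hm y, hxy⟩
    · simp only [hxy.1, hxy.2.1, if_true]
      exact h.touch x hxy.1 y hxy.2.1 hxy

lemma eI_diff {H H' : SimpleGraph V} {Z A : Finset V} (hZ : Z ⊆ A)
    (h : ∀ a ∈ A, ∀ b ∈ A, H.Adj a b → ¬ (a ∈ Z ∧ b ∈ Z) → H'.Adj a b) :
    eI H A + eI H' Z ≤ eI H' A + eI H Z := by
  have key : ∀ H : SimpleGraph V, eI H A =
      eI H Z + #{e ∈ A.sym2 | e ∈ H.edgeSet ∧ ¬ ∀ v ∈ e, v ∈ Z} := by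
    intro H
    unfold eI
    rw [← card_union_of_disjoint]
    · congr 1
      ext e
      simp only [mem_filter, mem_union, mem_sym2_iff]
      constructor
      · intro he
        by_cases hz : ∀ v ∈ e, v ∈ Z
        · exact Or.inl ⟨hz, he.2⟩
        · exact Or.inr ⟨he.1, he.2, hz⟩
      · rintro (he | he)
        · exact ⟨fun v hv => hZ (he.1 v hv), he.2⟩
        · exact ⟨he.1, he.2.1⟩
    · rw [Finset.disjoint_left]
      intro e
      simp only [mem_filter, mem_sym2_iff]
      exact fun h1 h2 => h2.2.2 h1.1
  have : #{e ∈ A.sym2 | e ∈ H.edgeSet ∧ ¬ ∀ v ∈ e, v ∈ Z} ≤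
      #{e ∈ A.sym2 | e ∈ H'.edgeSet ∧ ¬ ∀ v ∈ e, v ∈ Z} := by
    apply card_le_card
    intro e
    simp only [mem_filter, mem_sym2_iff]
    induction e with
    | _ a b =>
      simp only [Sym2.mem_iff, forall_eq_or_imp, forall_eq, mem_edgeSet]
      exact fun he => ⟨he.1, h a he.1.1 b he.1.2 he.2.1 he.2.2, he.2.2⟩
  rw [key H, key H']
  omega

/-- The extremal condition forcing a `Z`-rooted model of `K*₄,₂` in `H[U]`. -/
structure Massed (H : SimpleGraph V) (U Z : Finset V) : Prop where
  sub : Z ⊆ U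
  edges : eI H Z + 4 * #(U \ Z) + 1 ≤ eI H U
  sparse : ∀ A B, Sepn H U A B → Z ⊆ A → #(A ∩ B) < #Z → eI H U ≤ eI H A + 4 * #(B \ A)

lemma Sepn.sub_left {H : SimpleGraph V} {U A B : Finset V} (h : Sepn H U A B) : A ⊆ U := by
  rw [← h.1]; exact subset_union_left

lemma Sepn.sub_right {H : SimpleGraph V} {U A B : Finset V} (h : Sepn H U A B) : B ⊆ U := by
  rw [← h.1]; exact subset_union_right

lemma Sepn.eI {H : SimpleGraph V} {U A B : Finset V} (h : Sepn H U A B) :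
    eI H U + eI H (A ∩ B) = eI H A + eI H B := by
  rw [← h.1]; exact eI_union H A B h.2

/-- Refining a separation `(C, D)` by a separation of its right side. -/
lemma Sepn.refine {H : SimpleGraph V} {U C D A B : Finset V} (h : Sepn H U C D)
    (h' : Sepn H D A B) (hA : C ∩ D ⊆ A) : Sepn H U (C ∪ A) B ∧ (C ∪ A) ∩ B = A ∩ B ∧
      B \ (C ∪ A) = B \ A ∧ Sepn H (C ∪ A) C A ∧ C ∩ A = C ∩ D := by
  have e1 := h.1
  have e2 := h'.1
  have e3 := h.2
  have e4 := h'.2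
  refine ⟨⟨by grind, fun a ha b hb hab => ?_⟩, by grind, by grind,
    ⟨rfl, fun a ha b hb => e3 a (by grind) b (by grind)⟩, by grind⟩
  by_cases haA : a ∈ A
  · exact e4 a (by grind) b (by grind) hab
  · exact e3 a (by grind) b (by grind) hab

lemma massed_of_dense {H : SimpleGraph V} {U C D : Finset V} (h : Sepn H U C D)
    (hd : eI H C + 4 * #(D \ C) < eI H U)
    (hs : ∀ A B, Sepn H U A B → C ⊆ A → #(A ∩ B) < #(C ∩ D) → eI H U ≤ eI H A + 4 * #(B \ A)) :
    Massed H D (C ∩ D) := by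
  have he := h.eI
  refine ⟨inter_subset_right, ?_, fun A B hAB hA hlt => ?_⟩
  · have : D \ (C ∩ D) = D \ C := by grind
    rw [this]
    omega
  · obtain ⟨r1, r2, r3, r4, r5⟩ := h.refine hAB hA
    have h1 := hs _ _ r1 subset_union_left (by rw [r2]; exact hlt)
    have h2 := r4.eI
    rw [r3] at h1
    rw [r5] at h2
    omega

lemma exists_massed_of_not_sparse {H : SimpleGraph V} {U Z : Finset V}
    (h : ¬ ∀ A B, Sepn H U A B → Z ⊆ A → #(A ∩ B) < #Z → eI H U ≤ eI H A + 4 * #(B \ A)) :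
    ∃ C D, Sepn H U C D ∧ Z ⊆ C ∧ #(C ∩ D) < #Z ∧ eI H C + 4 * #(D \ C) < eI H U ∧
      Massed H D (C ∩ D) := by
  have hex : ∃ n, ∃ C D, Sepn H U C D ∧ Z ⊆ C ∧ #(C ∩ D) < #Z ∧
      eI H C + 4 * #(D \ C) < eI H U ∧ #(C ∩ D) = n := by
    push Not at h
    obtain ⟨A, B, h1, h2, h3, h4⟩ := h
    exact ⟨_, A, B, h1, h2, h3, h4, rfl⟩
  obtain ⟨C, D, h1, h2, h3, h4, h5⟩ := Nat.find_spec hex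
  refine ⟨C, D, h1, h2, h3, h4, massed_of_dense h1 h4 fun A B hAB hCA hlt => ?_⟩
  by_contra hd
  exact Nat.find_min hex (h5 ▸ hlt) ⟨A, B, hAB, h2.trans hCA, by omega, by omega, rfl⟩

end

section

open scoped Classical
variable {V : Type}

/-- Extending a rooted model through a rooted clique model on the other side. -/
lemma K42.lift_rooted {H : SimpleGraph V} {A B S Z : Finset V} {γ : V → Finset V}
    (h : K42 (H ⊔ cliq S) A Z) (hγ : Model (cliq S) S H B γ) (hS : ∀ s ∈ S, s ∈ γ s)
    (hAB : A ∩ B ⊆ S) : K42 H (A ∪ B) Z :=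
  h.lift (hγ.of_rooted hS hAB) fun z _ => by
    split_ifs with hz
    · exact hS z hz
    · simp

/-- The induction hypothesis in the proof that massed rooted graphs have rooted models. -/
def RootedBelow (V : Type) (n : ℕ) : Prop :=
  ∀ (U : Finset V), #U < n → ∀ (H : SimpleGraph V) (Z : Finset V), #Z ≤ 4 → Massed H U Z → K42 H U Z

lemma Sepn.shift {H : SimpleGraph V} {U A B C D : Finset V} (h : Sepn H U A B)
    (h' : Sepn H A C D) (hD : A ∩ B ⊆ D) : Sepn H U C (D ∪ B) ∧ C ∩ (D ∪ B) = C ∩ D := by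
  have e1 := h.1
  have e2 := h'.1
  have e3 := h.2
  have e4 := h'.2
  refine ⟨⟨by grind, fun a ha b hb hab => ?_⟩, by grind⟩
  by_cases hbA : b ∈ A
  · exact e4 a (by grind) b (by grind) hab
  · exact e3 a (by grind) b (by grind) hab

/-- In a massed graph without rooted model, no small separation has a rooted model on its
right side. -/
lemma Massed.not_K42_right {H : SimpleGraph V} {U Z : Finset V} (hM : Massed H U Z) (hZ4 : #Z ≤ 4)
    (ih : RootedBelow V #U) (hno : ¬ K42 H U Z) {A B : Finset V} (h : Sepn H U A B)
    (hZA : Z ⊆ A) (hle : #(A ∩ B) ≤ #Z) : ¬ K42 H B (A ∩ B) := by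
  induction hn : #A using Nat.strong_induction_on generalizing A B with
  | _ n ihA =>
  subst hn
  intro hK
  have hU := h.1
  have hAU : #A < #U := by
    obtain ⟨β, C₀, C₁, hK⟩ := hK
    obtain ⟨c, hc⟩ := hK.conn₀.1
    refine card_lt_card ⟨h.sub_left, fun hUA => ?_⟩
    have hcS : c ∈ A ∩ B := by
      have := hK.sub₀ hc
      have := h.sub_right this
      grind
    exact Finset.disjoint_left.1 (hK.disj₀ c hcS) (hK.mem c hcS) hc
  rcases hle.lt_or_eq with hlt | heq
  · have hsp := hM.sparse A B h hZA hlt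
    obtain ⟨γ, hγ, hγS⟩ := hK.rooted_clique_of_card_le (by omega)
    set G' := H ⊔ cliq (A ∩ B) with hG'
    have hHG : H ≤ G' := le_sup_left
    by_cases hs : ∀ C D, Sepn G' A C D → Z ⊆ C → #(C ∩ D) < #Z → eI G' A ≤ eI G' C + 4 * #(D \ C)
    · have hM' : Massed G' A Z := by
        refine ⟨hZA, ?_, hs⟩
        have e1 := hM.edges
        have e2 := eI_diff (H := H) (H' := G') hZA (fun a _ b _ hab _ => hHG hab)
        have e3 : #(U \ Z) = #(A \ Z) + #(B \ A) := by
          rw [← card_union_of_disjoint]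
          · congr 1
            grind
          · rw [Finset.disjoint_left]
            grind
        omega
      have := (ih A hAU G' Z hZ4 hM').lift_rooted hγ hγS le_rfl
      rw [hU] at this
      exact hno this
    · obtain ⟨C, D, h1, h2, h3, h4, h5⟩ := exists_massed_of_not_sparse hs
      have h1H : Sepn H A C D := ⟨h1.1, fun a ha b hb hab => h1.2 a ha b hb (hHG hab)⟩
      have hcl : A ∩ B ⊆ C ∨ A ∩ B ⊆ D := by
        by_contra hcon
        push Not at hcon
        obtain ⟨a, ha, haC⟩ := not_subset.1 hcon.1
        obtain ⟨b, hb, hbD⟩ := not_subset.1 hcon.2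
        have := h1.1
        have := h1.2 b (by grind) a (by grind)
        exact this (Or.inr ⟨hb, ha, by grind⟩)
      have hA := h1.1
      by_cases hSC : A ∩ B ⊆ C
      · have h6 : Sepn H U (C ∪ B) D :=
          (h.shift h1H.symm hSC).1.symm
        have hCD : (C ∪ B) ∩ D = C ∩ D := by grind
        have h7 := hM.sparse _ _ h6 (by grind) (by rw [hCD]; exact h3)
        have h8 : D \ (C ∪ B) = D \ C := by grind
        have h9 := h6.eI
        have h10 := h1.eI
        have h11 := eI_diff (H := G') (H' := H) (Z := C ∩ D) (A := D) inter_subset_right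
          (fun a ha b hb hab hn => by
            rcases hab with hab | hab
            · exact hab
            · exact absurd ⟨by have := hSC hab.1; grind, by have := hSC hab.2.1; grind⟩ hn)
        rw [h8] at h7
        rw [hCD] at h9
        omega
      · have hSD := hcl.resolve_left hSC
        have hDU : #D < #U := lt_of_le_of_lt (card_le_card h1.sub_right) hAU
        have hK' := ih D hDU G' _ (by omega) h5
        have hK'' := hK'.lift_rooted hγ hγS (by have := h1.sub_right; grind)
        obtain ⟨s1, s2⟩ := h.shift h1H hSD
        refine ihA #C (card_lt_card ⟨h1.sub_left, fun hAC => hSC fun a ha => hAC (by grind)⟩) s1 h2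
          (by rw [s2]; omega) rfl ?_
        rw [s2]
        exact hK''
  · by_cases hl : ∀ C D, Sepn H A C D → Z ⊆ C → A ∩ B ⊆ D → #Z ≤ #(C ∩ D)
    · obtain ⟨P, e, hP, hPd⟩ := link hZA inter_subset_left hl
      have := hK.glue (A := A) le_rfl hP hPd
      rw [hU] at this
      exact hno this
    · have hex : ∃ n, ∃ C D, Sepn H A C D ∧ Z ⊆ C ∧ A ∩ B ⊆ D ∧ #(C ∩ D) < #Z ∧ #(C ∩ D) = n := by
        push Not at hl
        obtain ⟨C, D, h1, h2, h3, h4⟩ := hl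
        exact ⟨_, C, D, h1, h2, h3, h4, rfl⟩
      obtain ⟨C, D, h1, h2, h3, h4, h5⟩ := Nat.find_spec hex
      have hA := h1.1
      obtain ⟨P, e, hP, hPd⟩ := link (H := H) (U := D) (Z := C ∩ D) (X := A ∩ B)
        inter_subset_right h3 (fun A' B' hAB' hA' hB' => by
          by_contra hlt
          obtain ⟨r1, r2, -⟩ := h1.refine hAB' hA'
          refine Nat.find_min hex (m := #(A' ∩ B')) (by omega)
            ⟨_, _, r1, h2.trans subset_union_left, hB', ?_, ?_⟩
          · rw [r2]; omega
          · rw [r2])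
      have hK' := hK.glue (A := D) (by have := h1.sub_right; grind) hP hPd
      obtain ⟨s1, s2⟩ := h.shift h1 h3
      refine ihA #C (card_lt_card ⟨h1.sub_left, fun hAC => ?_⟩) s1 h2
        (by rw [s2]; omega) rfl (by rw [s2]; exact hK')
      have : #(A ∩ B) ≤ #(C ∩ D) := card_le_card fun a ha => by
        have := h3 ha
        grind
      omega

/-- In a massed graph without rooted model, the right side of every small separation
is sparse. -/
lemma Massed.dense {H : SimpleGraph V} {U Z : Finset V} (hM : Massed H U Z) (hZ4 : #Z ≤ 4)
    (ih : RootedBelow V #U) (hno : ¬ K42 H U Z) {A B : Finset V} (h : Sepn H U A B)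
    (hZA : Z ⊆ A) (hle : #(A ∩ B) ≤ #Z) (hB : B ≠ U) : eI H U ≤ eI H A + 4 * #(B \ A) := by
  by_contra hd
  have hBU : #B < #U := card_lt_card ⟨h.sub_right, fun h' => hB (h.sub_right.antisymm h')⟩
  rcases hle.lt_or_eq with hlt | heq
  · exact hd (hM.sparse A B h hZA hlt)
  · exact hM.not_K42_right hZ4 ih hno h hZA hle (ih B hBU H _ (by omega)
      (massed_of_dense h (by omega) fun A' B' h1 h2 h3 => hM.sparse A' B' h1 (hZA.trans h2)
        (by omega)))

end

section

open scoped Classical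
variable {V : Type}

/-- A vertex `v` with few neighbours, whose neighbourhood is dense, yields a rooted model. -/
lemma K42.of_nbrs {H : SimpleGraph V} {B S N : Finset V} {v : V} {P : V → Finset V} {e : V → V}
    (hvB : v ∈ B) (hNB : N ⊆ B) (hN : ∀ x ∈ N, H.Adj v x) (hS : #S ≤ 4) (hN5 : 5 ≤ #N)
    (hN7 : #N ≤ 7) (hd : ∀ x ∈ N, 4 ≤ #{y ∈ N | H.Adj x y})
    (hP : ∀ z ∈ S, z ∈ P z ∧ Conn H (P z) ∧ P z ⊆ B.erase v ∧ P z ∩ N = {e z})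
    (hPd : ∀ s ∈ S, ∀ t ∈ S, s ≠ t → Disjoint (P s) (P t)) : K42 H B S := by
  have hez : ∀ z ∈ S, e z ∈ P z ∧ e z ∈ N := fun z hz => mem_inter.1 (by
    rw [(hP z hz).2.2.2]
    exact mem_singleton_self _)
  set E := S.image e with hE
  have hEN : E ⊆ N := by
    intro x hx
    obtain ⟨z, hz, rfl⟩ := mem_image.1 hx
    exact (hez z hz).2
  have hE4 : #E ≤ 4 := card_image_le.trans hS
  have hR : #(N \ E) = #N - #E := card_sdiff_of_subset hEN
  have hL : ∃ L ⊆ N \ E, Conn H L ∧ ∀ x ∈ E, ∃ y ∈ L, H.Adj x y := by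
    obtain ⟨r, hr⟩ : (N \ E).Nonempty := card_pos.1 (by omega)
    obtain ⟨K, hK, hrK, hKc, hcl⟩ := exists_comp H hr
    by_cases hKR : K = N \ E
    · refine ⟨K, hK, hKc, fun x hx => ?_⟩
      by_contra hno
      push Not at hno
      have h1 : {y ∈ N | H.Adj x y} ⊆ E.erase x := by
        intro y hy
        rw [mem_filter] at hy
        have := hno y
        have := hy.2.ne
        grind
      have h2 := card_le_card h1
      rw [card_erase_of_mem hx] at h2
      have := hd x (hEN hx)
      omega
    · obtain ⟨r', hr', hr'K⟩ : ∃ r' ∈ N \ E, r' ∉ K := by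
        by_contra hno
        push Not at hno
        exact hKR (hK.antisymm hno)
      obtain ⟨K', hK', hrK', hKc', hcl'⟩ := exists_comp H hr'
      have hdis : Disjoint K K' := by
        rw [Finset.disjoint_left]
        intro x hx hx'
        have : K' ⊆ K := hKc'.subset_of_closed hK' hcl hx' hx
        exact hr'K (this hrK')
      have hcard : #K + #K' ≤ #(N \ E) := by
        rw [← card_union_of_disjoint hdis]
        exact card_le_card (union_subset hK hK')
      have key : ∀ L ⊆ N \ E, Conn H L → (∀ x ∈ L, ∀ y ∈ N \ E, H.Adj x y → y ∈ L) →
          2 * #L ≤ #(N \ E) → ∀ x ∈ E, ∃ y ∈ L, H.Adj x y := by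
        intro L hLR hLc hLcl hL2 x hx
        by_contra hno
        push Not at hno
        obtain ⟨y, hy⟩ := hLc.1
        have h1 : {t ∈ N | H.Adj y t} ⊆ L.erase y ∪ E.erase x := by
          intro t ht
          rw [mem_filter] at ht
          have h1 := hno y hy
          have h2 := hLcl y hy t
          have h3 := ht.2.ne
          have h4 : t ≠ x := by
            rintro rfl
            exact h1 ht.2.symm
          grind
        have h2 := (card_le_card h1).trans (card_union_le _ _)
        rw [card_erase_of_mem hx, card_erase_of_mem hy] at h2
        have := hd y (by have := hLR hy; grind)
        have := card_pos.2 ⟨y, hy⟩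
        have := card_pos.2 ⟨x, hx⟩
        omega
      by_cases hle : #K ≤ #K'
      · exact ⟨K, hK, hKc, key K hK hKc hcl (by omega)⟩
      · exact ⟨K', hK', hKc', key K' hK' hKc' hcl' (by omega)⟩
  obtain ⟨L, hLR, hLc, hLt⟩ := hL
  obtain ⟨l, hl⟩ := hLc.1
  refine ⟨P, {v}, L, fun z hz => (hP z hz).1, fun z hz => (hP z hz).2.1,
    fun z hz => (hP z hz).2.2.1.trans (erase_subset _ _), hPd, conn_singleton _ _, hLc,
    by simpa using hvB, fun x hx => hNB (by have := hLR hx; grind), ?_, fun z hz => ?_,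
    fun z hz => ?_, ⟨v, by simp, l, hl, hN l (by have := hLR hl; grind)⟩, fun z hz => ?_,
    fun z hz => ?_⟩
  · rw [disjoint_singleton_left]
    intro hv
    exact (hN v (by have := hLR hv; grind)).ne rfl
  · rw [disjoint_singleton_right]
    intro hv
    have := (hP z hz).2.2.1 hv
    grind
  · rw [Finset.disjoint_left]
    intro a ha haL
    have h1 := hLR haL
    have h2 := (hP z hz).2.2.2
    have h3 : e z ∈ E := mem_image_of_mem e hz
    have h4 : a ∈ P z ∩ N := by grind
    rw [h2] at h4
    grind
  · exact ⟨e z, (hez z hz).1, v, by simp, (hN _ (hez z hz).2).symm⟩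
  · obtain ⟨y, hy, hyx⟩ := hLt (e z) (mem_image_of_mem e hz)
    exact ⟨e z, (hez z hz).1, y, hy, hyx⟩

/-- The graph obtained by contracting the bags `β`. -/
def contr (H : SimpleGraph V) (β : V → Finset V) : SimpleGraph V where
  Adj a b := a ≠ b ∧ Touch H (β a) (β b)
  symm := ⟨fun _ _ h => ⟨h.1.symm, h.2.symm⟩⟩
  loopless := ⟨fun _ h => h.1 rfl⟩

/-- The bags for the contraction of the edge `uv` onto `v`. -/
noncomputable def edgeBag (u v : V) : V → Finset V := fun a => if a = v then {u, v} else {a}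

lemma mem_edgeBag (u v a : V) : a ∈ edgeBag u v a := by
  unfold edgeBag
  split_ifs with h <;> simp [h]

lemma contr_adj_of_adj {H : SimpleGraph V} {u v a b : V} (h : H.Adj a b) :
    (contr H (edgeBag u v)).Adj a b :=
  ⟨h.ne, a, mem_edgeBag u v a, b, mem_edgeBag u v b, h⟩

lemma contr_adj_right {H : SimpleGraph V} {u v a : V} (h : H.Adj a u) (hv : a ≠ v) :
    (contr H (edgeBag u v)).Adj a v :=
  ⟨hv, a, mem_edgeBag u v a, u, by simp [edgeBag], h⟩

lemma contr_adj_iff_of_ne {H : SimpleGraph V} {u v a b : V} (ha : a ≠ v) (hb : b ≠ v) :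
    (contr H (edgeBag u v)).Adj a b ↔ H.Adj a b := by
  refine ⟨?_, contr_adj_of_adj⟩
  rintro ⟨-, x, hx, y, hy, hxy⟩
  simp only [edgeBag, ha, hb, if_false, mem_singleton] at hx hy
  subst hx hy
  exact hxy

lemma contr_adj_iff {H : SimpleGraph V} {u v a : V} (ha : a ≠ v) :
    (contr H (edgeBag u v)).Adj v a ↔ H.Adj v a ∨ H.Adj u a := by
  constructor
  · rintro ⟨-, x, hx, y, hy, hxy⟩
    simp only [edgeBag, ha, if_false, if_true, mem_singleton, mem_insert] at hx hy
    subst hy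
    rcases hx with rfl | rfl
    · exact Or.inr hxy
    · exact Or.inl hxy
  · rintro (h | h)
    · exact contr_adj_of_adj h
    · exact (contr_adj_right h.symm ha).symm

lemma contr_model {H : SimpleGraph V} {u v : V} (huv : H.Adj u v) {X Y : Finset V} (hX : X ⊆ Y)
    (hu : u ∉ X) (huY : v ∈ X → u ∈ Y) :
    Model (contr H (edgeBag u v)) X H Y (edgeBag u v) := by
  refine ⟨fun a _ => ?_, fun a ha => ?_, fun a ha b hb hab => ?_, fun a _ b _ hab => hab.2⟩
  · unfold edgeBag
    split_ifs
    · exact conn_pair huv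
    · exact conn_singleton _ _
  · unfold edgeBag
    split_ifs <;> grind
  · rw [Finset.disjoint_left]
    unfold edgeBag
    split_ifs <;> grind

lemma eI_contr {H : SimpleGraph V} {u v : V} (huv : H.Adj u v) {X : Finset V} (hu : u ∉ X)
    (hv : v ∈ X) : eI (contr H (edgeBag u v)) X + 1 + #{x ∈ X | H.Adj u x ∧ H.Adj v x} =
      eI H (insert u X) := by
  have h1 := eI_erase (contr H (edgeBag u v)) hv
  have h2 := eI_insert H X hu
  have h3 := eI_erase H hv
  have h4 : eI (contr H (edgeBag u v)) (X.erase v) = eI H (X.erase v) :=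
    eI_congr fun a ha b hb => contr_adj_iff_of_ne (by grind) (by grind)
  have h5 : {x ∈ X | (contr H (edgeBag u v)).Adj v x} =
      {x ∈ X | H.Adj v x} ∪ {x ∈ X | H.Adj u x}.erase v := by
    ext x
    by_cases hx : x = v
    · subst hx
      simp
    · simp only [mem_filter, mem_union, mem_erase, contr_adj_iff hx]
      tauto
  have h6 : {x ∈ X | H.Adj u x ∧ H.Adj v x} =
      {x ∈ X | H.Adj v x} ∩ {x ∈ X | H.Adj u x}.erase v := by
    ext x
    have : H.Adj v x → x ≠ v := fun h => h.ne'
    simp only [mem_filter, mem_inter, mem_erase]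
    tauto
  have h7 := card_union_add_card_inter {x ∈ X | H.Adj v x} ({x ∈ X | H.Adj u x}.erase v)
  have h8 := card_erase_add_one (s := {x ∈ X | H.Adj u x}) (a := v) (by simp [hv, huv])
  rw [← h5, ← h6] at h7
  omega

end

section

open scoped Classical
variable {V : Type}

lemma sdiff_card_insert {A B : Finset V} {u : V} (hu : u ∈ B) (huA : u ∉ A) :
    #(B \ A) = #(B \ insert u A) + 1 := by
  rw [← card_insert_of_notMem (s := B \ insert u A) (a := u) (by grind)]
  congr 1
  grind

/-- In a massed graph without rooted model, every edge not inside `Z` lies in at least four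
triangles. -/
lemma Massed.common_nbrs {H : SimpleGraph V} {U Z : Finset V} (hM : Massed H U Z) (hZ4 : #Z ≤ 4)
    (ih : RootedBelow V #U) (hno : ¬ K42 H U Z) (hcl : ∀ a ∈ Z, ∀ b ∈ Z, a ≠ b → H.Adj a b)
    {u v : V} (huU : u ∈ U) (huZ : u ∉ Z) (hvU : v ∈ U) (huv : H.Adj u v) :
    4 ≤ #{x ∈ U | H.Adj u x ∧ H.Adj v x} := by
  by_contra ht
  set H' := contr H (edgeBag u v) with hH'
  have hle : ∀ a b, H.Adj a b → H'.Adj a b := fun a b hab => contr_adj_of_adj hab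
  set U' := U.erase u with hU'
  have hins : insert u U' = U := insert_erase huU
  have hvU' : v ∈ U' := by have := huv.ne; grind
  have hUU : #U' < #U := card_erase_lt_of_mem huU
  have hcnt := eI_contr huv (X := U') (by grind) hvU'
  rw [hins, ← hH'] at hcnt
  have htt : #{x ∈ U' | H.Adj u x ∧ H.Adj v x} ≤ #{x ∈ U | H.Adj u x ∧ H.Adj v x} :=
    card_le_card (filter_subset_filter _ (erase_subset _ _))
  have hZU' : Z ⊆ U' := by have := hM.sub; grind
  by_cases hs : ∀ C D, Sepn H' U' C D → Z ⊆ C → #(C ∩ D) < #Z → eI H' U' ≤ eI H' C + 4 * #(D \ C)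
  · have hM' : Massed H' U' Z := by
      refine ⟨hZU', ?_, hs⟩
      have e1 := hM.edges
      have e2 : eI H' Z ≤ eI H Z := eI_mono_graph fun a ha b hb hab => hcl a ha b hb hab.ne
      have e3 : #(U \ Z) = #(U' \ Z) + 1 := by
        rw [sdiff_card_insert huU huZ]
        congr 2
        grind
      omega
    exact hno ((ih U' hUU H' Z hZ4 hM').lift
      (contr_model huv (erase_subset _ _) (by grind) (fun _ => huU)) fun z _ => mem_edgeBag u v z)
  · obtain ⟨C, D, h1, h2, h3, h4, h5⟩ := exists_massed_of_not_sparse hs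
    have hCD := h1.1
    have huC : u ∉ C := fun h => by have := h1.sub_left h; grind
    have huD : u ∉ D := fun h => by have := h1.sub_right h; grind
    have hK := ih D (lt_of_le_of_lt (card_le_card h1.sub_right) hUU) H' _ (by omega) h5
    by_cases hvC : v ∈ C
    · by_cases hvD : v ∈ D
      · have hc1 : insert u C ∩ insert u D = insert u (C ∩ D) := by grind
        have hc2 : insert u D \ insert u C = D \ C := by grind
        have hd := hM.dense hZ4 ih hno (A := insert u C) (B := insert u D) ⟨by grind,
          fun a ha b hb hab => h1.2 a (by grind) b (by grind) (hle _ _ hab)⟩ (by grind)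
          (by rw [hc1, card_insert_of_notMem (by grind)]; omega) (fun hB => by
            have : Z ⊆ C ∩ D := by have := hM.sub; grind
            have := card_le_card this
            omega)
        rw [hc2] at hd
        have hcC := eI_contr huv huC hvC
        rw [← hH'] at hcC
        have htC : #{x ∈ C | H.Adj u x ∧ H.Adj v x} ≤ #{x ∈ U' | H.Adj u x ∧ H.Adj v x} :=
          card_le_card (filter_subset_filter _ h1.sub_left)
        omega
      · have hK' : K42 H D (C ∩ D) := hK.lift
          (contr_model huv le_rfl huD fun h => absurd h hvD) fun z _ => mem_edgeBag u v z
        have hc1 : insert u C ∩ D = C ∩ D := by grind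
        refine hM.not_K42_right hZ4 ih hno (A := insert u C) (B := D) ⟨by grind,
          fun a ha b hb hab => ?_⟩ (by grind) (by rw [hc1]; omega) (by rw [hc1]; exact hK')
        by_cases hau : a = u
        · subst hau
          exact h1.2 v (by grind) b (by grind) (contr_adj_right hab.symm (by grind)).symm
        · exact h1.2 a (by grind) b (by grind) (hle _ _ hab)
    · have hvD : v ∈ D := by grind
      have hK' : K42 H (insert u D) (C ∩ D) := hK.lift
        (contr_model huv (subset_insert _ _) huD fun _ => mem_insert_self _ _)
          fun z _ => mem_edgeBag u v z
      have hc1 : C ∩ insert u D = C ∩ D := by grind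
      refine hM.not_K42_right hZ4 ih hno (A := C) (B := insert u D) ⟨by grind,
        fun a ha b hb hab => ?_⟩ (by grind) (by rw [hc1]; omega) (by rw [hc1]; exact hK')
      by_cases hbu : b = u
      · subst hbu
        exact h1.2 a (by grind) v (by grind) (contr_adj_right hab (by grind))
      · exact h1.2 a (by grind) b (by grind) (hle _ _ hab)

lemma not_isolated {H : SimpleGraph V} {U Z : Finset V} (hM : Massed H U Z) (hZ4 : #Z ≤ 4)
    (ih : RootedBelow V #U) (hno : ¬ K42 H U Z) {v : V} (hvU : v ∈ U) (hvZ : v ∉ Z) :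
    ∃ x ∈ U, H.Adj v x := by
  by_contra hiso
  push Not at hiso
  have key : ∀ X ⊆ U.erase v, eI H (insert v X) = eI H X := by
    intro X hX
    rw [eI_insert H X (fun h => by have := hX h; grind), filter_false_of_mem]
    · simp
    · exact fun x hx => hiso x (by have := hX hx; grind)
  have hins : insert v (U.erase v) = U := insert_erase hvU
  have h1 := key _ le_rfl
  rw [hins] at h1
  refine hno ((ih (U.erase v) (card_erase_lt_of_mem hvU) H Z hZ4 ⟨by have := hM.sub; grind, ?_,
    fun A B hAB hZA hlt => ?_⟩).mono (erase_subset _ _) le_rfl)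
  · have e1 := hM.edges
    have : #(U.erase v \ Z) ≤ #(U \ Z) := card_le_card (by grind)
    omega
  · have hvA : v ∉ A := fun h => by have := hAB.sub_left h; grind
    have hvB : v ∉ B := fun h => by have := hAB.sub_right h; grind
    have e1 := hAB.1
    have hc1 : insert v A ∩ B = A ∩ B := by grind
    have hc2 : B \ insert v A = B \ A := by grind
    have := hM.sparse (insert v A) B ⟨by grind, fun a ha b hb hab => ?_⟩ (by grind)
      (by rw [hc1]; exact hlt)
    · rw [h1, key A hAB.sub_left, hc2] at this
      exact this
    · by_cases hav : a = v
      · subst hav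
        exact hiso b (by grind) hab
      · exact hAB.2 a (by grind) b (by grind) hab

lemma card_filter_sdiff_add {A Z : Finset V} (h : Z ⊆ A) (p : V → Prop) :
    #{x ∈ A | p x} = #{x ∈ Z | p x} + #{x ∈ A \ Z | p x} := by
  rw [← card_union_of_disjoint]
  · congr 1
    ext x
    simp only [mem_filter, mem_union, mem_sdiff]
    have := @h x
    tauto
  · rw [Finset.disjoint_left]
    grind

/-- The tight case of the existence of rooted models. -/
lemma Massed.tight {H : SimpleGraph V} {U Z : Finset V} (hM : Massed H U Z) (hZ4 : #Z = 4)
    (ih : RootedBelow V #U) (hcl : ∀ a ∈ Z, ∀ b ∈ Z, a ≠ b → H.Adj a b)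
    (he : eI H U = eI H Z + 4 * #(U \ Z) + 1) : K42 H U Z := by
  by_contra hno
  have hZU := hM.sub
  have hzn : ∀ z ∈ Z, 1 ≤ #{x ∈ U \ Z | H.Adj z x} := by
    intro z hz
    by_contra hlt
    have h0 : {x ∈ U \ Z | H.Adj z x} = ∅ := by
      rw [← card_eq_zero]; omega
    have hc1 : Z ∩ U.erase z = Z.erase z := by grind
    have hc2 : U.erase z \ Z = U \ Z := by grind
    have := hM.sparse Z (U.erase z) ⟨by grind, fun a ha b hb hab => ?_⟩ le_rfl
      (by rw [hc1, card_erase_of_mem hz]; omega)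
    · rw [hc2] at this
      omega
    · have haz : a = z := by grind
      have : b ∈ ({x ∈ U \ Z | H.Adj z x} : Finset V) := by
        rw [mem_filter, ← haz]
        exact ⟨by grind, hab⟩
      rw [h0] at this
      exact notMem_empty _ this
  obtain ⟨v, hv, hv7⟩ : ∃ v ∈ U \ Z, #{x ∈ U | H.Adj v x} ≤ 7 := by
    by_contra hall
    push Not at hall
    have s1 := sum_deg H U
    have s2 := sum_deg H Z
    rw [← sum_sdiff hZU] at s1
    have s3 : ∑ v ∈ U \ Z, 8 ≤ ∑ v ∈ U \ Z, #{x ∈ U | H.Adj v x} :=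
      sum_le_sum fun v hv => hall v hv
    have s4 : ∑ z ∈ Z, (#{x ∈ Z | H.Adj z x} + 1) ≤ ∑ z ∈ Z, #{x ∈ U | H.Adj z x} := by
      refine sum_le_sum fun z hz => ?_
      rw [card_filter_sdiff_add hZU]
      have := hzn z hz
      omega
    rw [sum_add_distrib] at s4
    simp only [sum_const, smul_eq_mul, mul_one] at s3 s4
    omega
  have hvU : v ∈ U := by grind
  have hvZ : v ∉ Z := by grind
  set N := {x ∈ U | H.Adj v x} with hN
  have hmN : ∀ x, x ∈ N ↔ x ∈ U ∧ H.Adj v x := fun x => mem_filter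
  have hd : ∀ x ∈ N, 4 ≤ #{y ∈ N | H.Adj x y} := by
    intro x hx
    have := hM.common_nbrs hZ4.le ih hno hcl hvU hvZ ((hmN x).1 hx).1 ((hmN x).1 hx).2
    rwa [hN, filter_filter]
  obtain ⟨x₀, hx₀⟩ := not_isolated hM hZ4.le ih hno hvU hvZ
  have hN5 : 5 ≤ #N := by
    have h1 := hd x₀ ((hmN _).2 hx₀)
    have h2 : {y ∈ N | H.Adj x₀ y} ⊆ N.erase x₀ := by
      intro y hy
      rw [mem_filter] at hy
      have := hy.2.ne
      grind
    have h3 := card_le_card h2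
    rw [card_erase_of_mem ((hmN _).2 hx₀)] at h3
    omega
  have hex : ∃ n, ∃ A B, Sepn H U A B ∧ Z ⊆ A ∧ N ⊆ B ∧ v ∈ B \ A ∧ #(A ∩ B) ≤ #Z ∧
      #(A ∩ B) = n :=
    ⟨_, Z, U, ⟨by grind, fun a ha => by grind⟩, le_rfl, filter_subset _ _, by grind,
      card_le_card inter_subset_left, rfl⟩
  obtain ⟨A, B, h1, h2, h3, h4, h5, h6⟩ := Nat.find_spec hex
  have hvB : v ∈ B := by grind
  have hvN : v ∉ N := fun h => ((hmN v).1 h).2.ne rfl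
  obtain ⟨P, e, hP, hPd⟩ := link_trim (H := H) (U := B.erase v) (Z := A ∩ B) (X := N) (by grind)
    (by grind) fun A' B' hAB' hA' hB' => by
      by_contra hlt
      have hvA' : v ∉ A' := fun h => by have := hAB'.sub_left h; grind
      have e1 := hAB'.1
      obtain ⟨r1, r2, -⟩ := h1.refine (A := A') (B := insert v B')
        ⟨by grind, fun a ha b hb hab => by
        by_cases hbv : b = v
        · subst hbv
          have : a ∈ N := (hmN a).2 ⟨h1.sub_right (by have := hAB'.sub_left; grind), hab.symm⟩
          grind
        · exact hAB'.2 a (by grind) b (by grind) hab⟩ hA'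
      have hc : A' ∩ insert v B' = A' ∩ B' := by grind
      rw [hc] at r2
      exact Nat.find_min hex (m := #(A' ∩ B')) (by omega) ⟨_, _, r1, by grind, by grind, by grind,
        by rw [r2]; omega, by rw [r2]⟩
  exact hM.not_K42_right hZ4.le ih hno h1 h2 h5 (K42.of_nbrs hvB h3 (fun x hx => ((hmN x).1 hx).2)
    (by omega) hN5 hv7 hd hP hPd)

lemma massed_sup_cliq {H : SimpleGraph V} {U Z : Finset V} (hM : Massed H U Z) :
    Massed (H ⊔ cliq Z) U Z ∧
      eI (H ⊔ cliq Z) U + eI H Z = eI H U + eI (H ⊔ cliq Z) Z := by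
  have key : ∀ A, Z ⊆ A → eI (H ⊔ cliq Z) A + eI H Z = eI H A + eI (H ⊔ cliq Z) Z := by
    intro A hA
    have h1 := eI_diff (H := H) (H' := H ⊔ cliq Z) hA (fun a _ b _ hab _ => Or.inl hab)
    have h2 := eI_diff (H := H ⊔ cliq Z) (H' := H) hA
      (fun a _ b _ hab hn => hab.resolve_right fun h => hn ⟨h.1, h.2.1⟩)
    omega
  have hU := key U hM.sub
  refine ⟨⟨hM.sub, ?_, fun A B hAB hZA hlt => ?_⟩, hU⟩
  · have := hM.edges
    omega
  · have h1 := hM.sparse A B ⟨hAB.1, fun a ha b hb hab => hAB.2 a ha b hb (Or.inl hab)⟩ hZA hlt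
    have := key A hZA
    omega

lemma Massed.of_card_eq {H : SimpleGraph V} {U Z : Finset V} (hM : Massed H U Z) (hZ4 : #Z = 4)
    (ih : RootedBelow V #U) : K42 H U Z := by
  induction hn : eI H U using Nat.strong_induction_on generalizing H with
  | _ n ihE =>
  subst hn
  have hZU := hM.sub
  by_cases ht : eI H U = eI H Z + 4 * #(U \ Z) + 1
  · obtain ⟨hM', he⟩ := massed_sup_cliq hM
    refine (hM'.tight hZ4 ih (fun a ha b hb hab => Or.inr ⟨ha, hb, hab⟩) (by omega)).congr
      fun a b hab => ?_
    exact hab.imp id fun h => ⟨h.1, h.2.1⟩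
  by_contra hno
  have hed := hM.edges
  obtain ⟨x, hx, y, hy, hxy, hxyZ⟩ : ∃ x ∈ U, ∃ y ∈ U, H.Adj x y ∧ ¬ (x ∈ Z ∧ y ∈ Z) := by
    by_contra hall
    push Not at hall
    have := eI_diff (H := H) (H' := ⊥) hZU (fun a ha b hb hab hn => hn (hall a ha b hb hab))
    have h0 : eI (⊥ : SimpleGraph V) U = 0 := by
      simp [eI]
    omega
  set H' := H.deleteEdges {s(x, y)} with hH'
  have hle : H' ≤ H := deleteEdges_le _
  have hadj : ∀ a b, H.Adj a b → ¬ H'.Adj a b → (a = x ∧ b = y) ∨ (a = y ∧ b = x) := by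
    intro a b h1 h2
    rw [hH', deleteEdges_adj] at h2
    simp only [Set.mem_singleton_iff, Sym2.eq_iff] at h2
    tauto
  have hcU := eI_pos_of_adj hx hy hxy
  rw [← hH'] at hcU
  have hmonoZ : eI H' Z ≤ eI H Z := eI_mono_graph fun a _ b _ hab => hle hab
  by_cases hs : ∀ C D, Sepn H' U C D → Z ⊆ C → #(C ∩ D) < #Z → eI H' U ≤ eI H' C + 4 * #(D \ C)
  · exact hno ((ihE _ (by omega) ⟨hZU, by omega, hs⟩ rfl).mono_graph hle)
  push Not at hs
  obtain ⟨A, B, h1, h2, h3, h4⟩ := hs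
  have h11 := h1.1
  by_cases hsep : Sepn H U A B
  · have e1 := hM.sparse A B hsep h2 h3
    have e2 : eI H A ≤ eI H' A + 1 := by
      by_cases hxyA : x ∈ A ∧ y ∈ A
      · have := eI_pos_of_adj hxyA.1 hxyA.2 hxy
        rw [← hH'] at this
        exact this.ge
      · refine le_trans (eI_mono_graph fun a ha b hb hab => ?_) (Nat.le_succ _)
        by_contra hab'
        rcases hadj a b hab hab' with ⟨rfl, rfl⟩ | ⟨rfl, rfl⟩
        · exact hxyA ⟨ha, hb⟩
        · exact hxyA ⟨hb, ha⟩
    omega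
  obtain ⟨a, ha, b, hb, hab⟩ : ∃ a ∈ A \ B, ∃ b ∈ B \ A, H.Adj a b := by
    by_contra hno'
    push Not at hno'
    exact hsep ⟨h1.1, hno'⟩
  have hcr := hadj a b hab (h1.2 a ha b hb)
  have hother : ∀ c ∈ A \ B, ∀ d ∈ B \ A, H.Adj c d → c = a ∧ d = b := by
    intro c hc d hd hcd
    have := hadj c d hcd (h1.2 c hc d hd)
    grind
  have hd := hM.dense hZ4.le ih hno (A := insert b A) (B := B) ⟨by grind, fun c hc d hd hcd => by
    have := hother c (by grind) d (by grind) hcd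
    grind⟩ (by grind)
    (by rw [insert_inter_of_mem (by grind)]; exact (card_insert_le _ _).trans (by omega))
    (by grind)
  have e1 := eI_insert H A (v := b) (by grind)
  have e2 : #{z ∈ A | H.Adj b z} ≤ 4 := by
    have : {z ∈ A | H.Adj b z} ⊆ insert a (A ∩ B) := by
      intro z hz
      rw [mem_filter] at hz
      have := hother z
      have := hz.2.symm
      grind
    exact (card_le_card this).trans ((card_insert_le _ _).trans (by omega))
  have e3 := sdiff_card_insert (A := A) (B := B) (u := b) (by grind) (by grind)
  have e4 : eI H A ≤ eI H' A := eI_mono_graph fun c hc d hd hcd => by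
    by_contra hcd'
    have := hadj c d hcd hcd'
    grind
  omega

lemma Massed.of_below {H : SimpleGraph V} {U Z : Finset V} (hM : Massed H U Z) (hZ4 : #Z ≤ 4)
    (ih : RootedBelow V #U) : K42 H U Z := by
  induction hn : 4 - #Z generalizing Z with
  | zero => exact hM.of_card_eq (by omega) ih
  | succ n ihn =>
  by_contra hno
  have hed := hM.edges
  have hZU := hM.sub
  obtain ⟨z, hz⟩ : (U \ Z).Nonempty := by
    rw [nonempty_iff_ne_empty]
    intro h0
    have : U = Z := (sdiff_eq_empty_iff_subset.1 h0).antisymm hZU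
    subst this
    omega
  have hzZ : z ∉ Z := by grind
  have hc := card_insert_of_notMem hzZ
  refine hno ((ihn (Z := insert z Z) ⟨by grind, ?_, fun A B hAB hZA hlt => ?_⟩ (by omega)
    (by omega)).mono le_rfl (subset_insert _ _))
  · have e1 := eI_insert H Z hzZ
    have e2 := card_filter_le Z (fun x => H.Adj z x)
    have e3 := sdiff_card_insert (A := Z) (B := U) (u := z) (by grind) (by grind)
    omega
  · refine hM.dense hZ4 ih hno hAB (by grind) (by omega) fun hB => ?_
    have : insert z Z ⊆ A ∩ B := by have := hAB.sub_left; grind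
    have := card_le_card this
    omega

/-- Every massed rooted graph with at most four roots has a rooted model of `K*₄,₂`. -/
theorem Massed.K42 {H : SimpleGraph V} {U Z : Finset V} (hM : Massed H U Z) (hZ4 : #Z ≤ 4) :
    K42 H U Z := by
  have : ∀ n, RootedBelow V n := by
    intro n
    induction n with
    | zero => exact fun U hU => absurd hU (by omega)
    | succ n ih =>
      intro U hU H Z hZ hM
      rcases Nat.lt_succ_iff_lt_or_eq.1 hU with h | h
      · exact ih U h H Z hZ hM
      · exact hM.of_below hZ (h ▸ ih)
  exact hM.of_below hZ4 (this _)

end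

section

open scoped Classical
variable {V : Type}

/-- `H[U]` is `4`-connected. -/
def FC (H : SimpleGraph V) (U : Finset V) : Prop :=
  5 ≤ #U ∧ ∀ P Q, P ⊆ U → Q ⊆ U → P.Nonempty → Q.Nonempty → Disjoint P Q →
    (∀ a ∈ P, ∀ b ∈ Q, ¬ H.Adj a b) → 4 ≤ #(U \ (P ∪ Q))

/-- Each vertex of `H[U]` has a unique non-neighbour in `H[U]` other than itself, and `#U = 8`. -/
def IsOcta (H : SimpleGraph V) (U : Finset V) : Prop :=
  #U = 8 ∧ ∀ a ∈ U, ∃ c ∈ U, c ≠ a ∧ ∀ b ∈ U, H.Adj a b ↔ b ≠ a ∧ b ≠ c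

/-- The properties of minor-minimal enemies, in terms of finsets. -/
structure Crit [Fintype V] (G : SimpleGraph V) : Prop where
  fc : FC G univ
  edges : 4 * #(univ : Finset V) ≤ eI G univ + 8
  no_minor : ∀ β : Fin 7 → Finset V, ¬ Model K7vee univ G univ β
  min : ∀ (H : SimpleGraph V) (U : Finset V) (β : V → Finset V), Model H U G univ β → FC H U →
    4 * #U ≤ eI H U + 8 → #U < #(univ : Finset V) → IsOcta H U

lemma isMinor_of_model {W : Type} [Fintype V] {H : SimpleGraph W} {U : Finset W}
    {G : SimpleGraph V} {β : W → Finset V} (h : Model H U G univ β) :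
    IsMinor (H.induce (U : Set W)) G := by
  refine ⟨fun w => β w, fun w => (conn_iff_connected _ _).1 (h.conn _ w.2), fun w w' hw => ?_,
    fun w w' hw => h.touch _ w.2 _ w'.2 hw⟩
  exact Finset.disjoint_coe.2 (h.disj _ w.2 _ w'.2 fun h => hw (Subtype.ext h))

lemma model_of_isMinor {W : Type} [Fintype W] {H : SimpleGraph W} {G : SimpleGraph V}
    {U : Finset V} (h : IsMinor H (G.induce (U : Set V))) : ∃ β, Model H univ G U β := by
  obtain ⟨bag, h1, h2, h3⟩ := h
  have hc : ∀ w, Conn (G.induce (U : Set V)) (bag w).toFinset := fun w =>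
    (conn_iff_connected _ _).2 (by rw [Set.coe_toFinset]; exact h1 w)
  refine ⟨fun w => (bag w).toFinset.map (Function.Embedding.subtype _), fun w _ => ?_,
    fun w _ => ?_, fun w _ w' _ hw => ?_, fun w _ w' _ hw => ?_⟩
  · have := Conn.biUnion (H' := G.induce (U : Set V)) (H := G) (β := fun a => {(a : V)})
      (hc w) (fun a _ => conn_singleton _ _)
      fun a _ b _ hab => Or.inl ⟨a, by simp, b, by simp, hab⟩
    convert this using 1
    ext x
    simp
  · intro x hx
    obtain ⟨y, -, rfl⟩ := mem_map.1 hx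
    exact y.2
  · rw [Finset.disjoint_map, Set.disjoint_toFinset]
    exact h2 w w' hw
  · obtain ⟨u, hu, v, hv, huv⟩ := h3 w w' hw
    exact ⟨u, by simpa using hu, v, by simpa using hv, huv⟩

lemma ncard_edgeSet_induce (H : SimpleGraph V) (U : Finset V) :
    (H.induce (U : Set V)).edgeSet.ncard = eI H U := by
  rw [← Set.ncard_image_of_injective _ (Sym2.map.injective Subtype.val_injective)]
  unfold eI
  rw [← Set.ncard_coe_finset]
  congr 1
  ext e
  simp only [Set.mem_image, coe_filter, Set.mem_setOf_eq, mem_sym2_iff]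
  constructor
  · rintro ⟨e, he, rfl⟩
    induction e with
    | _ a b =>
      have := a.2
      have := b.2
      simp_all
  · induction e with
    | _ a b =>
      simp only [Sym2.mem_iff, forall_eq_or_imp, forall_eq, mem_edgeSet]
      rintro ⟨⟨ha, hb⟩, hab⟩
      exact ⟨s(⟨a, ha⟩, ⟨b, hb⟩), by simpa using hab, rfl⟩

lemma ncard_edgeSet [Fintype V] (H : SimpleGraph V) : H.edgeSet.ncard = eI H univ := by
  unfold eI
  rw [← Set.ncard_coe_finset]
  congr 1
  ext e
  simp

lemma fc_of_isKConnected [Fintype V] {G : SimpleGraph V} (h : IsKConnected 4 G) : FC G univ := by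
  refine ⟨h.1, fun P Q _ _ hP hQ hd hno => ?_⟩
  by_contra hlt
  have := h.2 ↑(univ \ (P ∪ Q)) (by rw [Set.ncard_coe_finset]; omega)
  have hc : ((↑(univ \ (P ∪ Q)) : Set V))ᶜ = ↑(P ∪ Q) := by
    ext x
    simp
    tauto
  rw [hc, ← conn_iff_connected] at this
  obtain ⟨a, ha, b, hb, hab⟩ := this.2 P subset_union_left hP
    (hQ.mono fun x hx => by rw [Finset.disjoint_right] at hd; have := hd hx; grind)
  exact hno a ha b (by grind) hab

lemma conn_of {H : SimpleGraph V} {X : Finset V} (hX : X.Nonempty)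
    (h : ∀ Y ⊆ X, Y.Nonempty → ∀ c ∈ X, c ∉ Y → ∃ a ∈ Y, ∃ b ∈ X, b ∉ Y ∧ H.Adj a b) :
    Conn H X := by
  refine ⟨hX, fun Y hY hYn ⟨c, hc⟩ => ?_⟩
  obtain ⟨a, ha, b, hb, hbY, hab⟩ := h Y hY hYn c (by grind) (by grind)
  exact ⟨a, ha, b, by grind, hab⟩

lemma FC.isKConnected {H : SimpleGraph V} {U : Finset V} (h : FC H U) :
    IsKConnected 4 (H.induce (U : Set V)) := by
  refine ⟨?_, fun S hS => ?_⟩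
  · simpa using Nat.lt_of_succ_le h.1
  set X : Finset (U : Set V) := Sᶜ.toFinset with hX
  have hXS : (X : Set (U : Set V)) = Sᶜ := Set.coe_toFinset _
  rw [← hXS, ← conn_iff_connected]
  let φ : (U : Set V) ↪ V := Function.Embedding.subtype _
  have hsub : ∀ Y : Finset (U : Set V), Y.map φ ⊆ U := by
    intro Y x hx
    obtain ⟨y, -, rfl⟩ := mem_map.1 hx
    exact y.2
  have hcard : #(U \ X.map φ) < 4 := by
    refine lt_of_le_of_lt ?_ hS
    have : U \ X.map φ ⊆ (S.toFinset).map φ := by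
      intro x hx
      rw [mem_sdiff] at hx
      refine mem_map.2 ⟨⟨x, hx.1⟩, ?_, rfl⟩
      by_contra hxS
      exact hx.2 (mem_map.2 ⟨⟨x, hx.1⟩, by simpa [X] using hxS, rfl⟩)
    refine (card_le_card this).trans ?_
    rw [card_map, Set.ncard_eq_toFinset_card']
  refine conn_of ?_ ?_
  · rw [nonempty_iff_ne_empty]
    intro h0
    rw [h0] at hcard
    have := h.1
    simp at hcard
    omega
  · intro Y hY hYn c hcX hcY
    by_contra hno
    push Not at hno
    have hun : X.map φ = Y.map φ ∪ (X.filter (· ∉ Y)).map φ := by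
      ext x
      simp only [mem_map, mem_union, mem_filter]
      constructor
      · rintro ⟨y, hy, rfl⟩
        by_cases hyY : y ∈ Y
        · exact Or.inl ⟨y, hyY, rfl⟩
        · exact Or.inr ⟨y, ⟨hy, hyY⟩, rfl⟩
      · rintro (⟨y, hy, rfl⟩ | ⟨y, hy, rfl⟩)
        · exact ⟨y, hY hy, rfl⟩
        · exact ⟨y, hy.1, rfl⟩
    have hd : Disjoint (Y.map φ) ((X.filter (· ∉ Y)).map φ) := by
      rw [Finset.disjoint_map, Finset.disjoint_left]
      exact fun x hx hx' => (mem_filter.1 hx').2 hx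
    have hn' : ∀ a ∈ Y.map φ, ∀ b ∈ (X.filter (· ∉ Y)).map φ, ¬ H.Adj a b := by
      intro a ha b hb hab
      obtain ⟨p, hp, rfl⟩ := mem_map.1 ha
      obtain ⟨q, hq, rfl⟩ := mem_map.1 hb
      exact hno p hp q (mem_filter.1 hq).1 (mem_filter.1 hq).2 hab
    have hp : (Y.map φ).Nonempty := map_nonempty.2 hYn
    have hq : ((X.filter (· ∉ Y)).map φ).Nonempty := map_nonempty.2 ⟨c, mem_filter.2 ⟨hcX, hcY⟩⟩
    have h4 := h.2 _ _ (hsub _) (hsub _) hp hq hd hn'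
    rw [← hun] at h4
    omega

lemma isOcta_of_iso {H : SimpleGraph V} {U : Finset V}
    (h : Nonempty (H.induce (U : Set V) ≃g K2222)) : IsOcta H U := by
  obtain ⟨φ⟩ := h
  constructor
  · have := Fintype.card_congr φ.toEquiv
    simpa using this
  · intro a ha
    set x := φ ⟨a, ha⟩ with hx
    have hK : ∀ y : Fin 4 × Fin 2, K2222.Adj x y ↔ y ≠ x ∧ y ≠ (x.1, x.2 + 1) := by
      intro y
      have h2 : ∀ s t : Fin 2, t = s ∨ t = s + 1 := by decide
      have h3 : ∀ s : Fin 2, s + 1 ≠ s := by decide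
      have := h2 x.2 y.2
      simp only [K2222, comap_adj, completeGraph, top_adj, ne_eq, Prod.ext_iff]
      generalize x.2 + 1 = t at *
      tauto
    refine ⟨φ.symm (x.1, x.2 + 1), (φ.symm (x.1, x.2 + 1)).2, fun hne => ?_, fun b hb => ?_⟩
    · have : φ.symm (x.1, x.2 + 1) = ⟨a, ha⟩ := Subtype.ext hne
      rw [RelIso.symm_apply_eq, ← hx, Prod.ext_iff] at this
      have h2 : ∀ s : Fin 2, s + 1 ≠ s := by decide
      exact h2 _ this.2
    · have h1 : H.Adj a b ↔ K2222.Adj x (φ ⟨b, hb⟩) := by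
        rw [hx, φ.map_adj_iff]
        rfl
      rw [h1, hK, hx, φ.injective.ne_iff]
      have h3 : φ ⟨b, hb⟩ = (x.1, x.2 + 1) ↔ b = φ.symm (x.1, x.2 + 1) := by
        constructor
        · intro h
          rw [← h]
          simp
        · intro h
          have : φ.symm (x.1, x.2 + 1) = ⟨b, hb⟩ := Subtype.ext h.symm
          rw [← this]
          simp
      simp [← hx, h3]

lemma crit_of_minorMinimal [Fintype V] {G : SimpleGraph V} (h : MinorMinimalEnemy G) :
    Crit G := by
  obtain ⟨⟨h1, h2, h3, h4⟩, h5⟩ := h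
  have hno : ∀ β : Fin 7 → Finset V, ¬ Model K7vee univ G univ β := fun β hβ => by
    refine h3 ⟨fun w => β w, fun w => (conn_iff_connected _ _).1 (hβ.conn _ (mem_univ _)),
      fun w w' hw => Finset.disjoint_coe.2 (hβ.disj _ (mem_univ _) _ (mem_univ _) hw),
      fun w w' hw => hβ.touch _ (mem_univ _) _ (mem_univ _) hw⟩
  refine ⟨fc_of_isKConnected h1, ?_, hno, fun H U β hβ hfc he hlt => ?_⟩
  · rw [ncard_edgeSet] at h2
    rw [card_univ]
    omega
  · apply isOcta_of_iso
    by_contra hiso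
    have hE : Enemy (H.induce (U : Set V)) := by
      refine ⟨hfc.isKConnected, ?_, fun hm => ?_, not_nonempty_iff.1 hiso⟩
      · rw [ncard_edgeSet_induce]
        simp only [SetLike.coe_sort_coe, Fintype.card_coe]
        omega
      · obtain ⟨γ, hγ⟩ := model_of_isMinor hm
        exact hno _ (hβ.comp hγ)
    obtain ⟨φ⟩ := h5 _ _ (isMinor_of_model hβ) hE
    have := Fintype.card_congr φ.toEquiv
    simp only [SetLike.coe_sort_coe, Fintype.card_coe] at this
    rw [card_univ] at hlt
    omega

end

section

open scoped Classical
variable {V : Type}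

lemma eI_sup_cliq {H : SimpleGraph V} {Z A : Finset V} (hA : Z ⊆ A) :
    eI (H ⊔ cliq Z) A + eI H Z = eI H A + eI (H ⊔ cliq Z) Z := by
  have h1 := eI_diff (H := H) (H' := H ⊔ cliq Z) hA (fun a _ b _ hab _ => Or.inl hab)
  have h2 := eI_diff (H := H ⊔ cliq Z) (H' := H) hA
    (fun a _ b _ hab hn => hab.resolve_right fun h => hn ⟨h.1, h.2.1⟩)
  omega

lemma eI_sup_cliq_self {H : SimpleGraph V} {Z : Finset V} :
    2 * eI (H ⊔ cliq Z) Z = #Z * (#Z - 1) := by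
  rw [← sum_deg, sum_const_nat]
  intro v hv
  rw [← card_erase_of_mem hv]
  congr 1
  ext x
  simp only [mem_filter, mem_erase]
  constructor
  · exact fun h => ⟨h.2.ne', h.1⟩
  · exact fun h => ⟨h.2, Or.inr ⟨hv, h.2, h.1.symm⟩⟩

lemma eI_of_isOcta {H : SimpleGraph V} {U : Finset V} (h : IsOcta H U) : eI H U = 24 := by
  have : ∑ v ∈ U, #{x ∈ U | H.Adj v x} = #U * 6 := by
    apply sum_const_nat
    intro a ha
    obtain ⟨a', ha', hne, hadj⟩ := h.2 a ha
    have : {x ∈ U | H.Adj a x} = (U.erase a).erase a' := by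
      ext x
      simp only [mem_filter, mem_erase]
      have := hadj x
      tauto
    rw [this, card_erase_of_mem (by simp [ha', hne]), card_erase_of_mem ha, h.1]
  rw [sum_deg, h.1] at this
  omega

lemma exists_four {S : Finset V} (hS : #S = 4) : ∃ a b c d, S = {a, b, c, d} ∧ a ≠ b ∧ a ≠ c ∧
    a ≠ d ∧ b ≠ c ∧ b ≠ d ∧ c ≠ d := by
  obtain ⟨a, T, ha, rfl, hT⟩ := card_eq_succ.1 hS
  obtain ⟨b, c, d, h1, h2, h3, rfl⟩ := card_eq_three.1 hT
  exact ⟨a, b, c, d, rfl, by grind⟩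

lemma eI_four {H : SimpleGraph V} {a b c d : V} (h1 : a ≠ b) (h2 : a ≠ c) (h3 : a ≠ d)
    (h4 : b ≠ c) (h5 : b ≠ d) (h6 : c ≠ d) : eI H {a, b, c, d} =
      (if H.Adj a b then 1 else 0) + (if H.Adj a c then 1 else 0) + (if H.Adj a d then 1 else 0) +
      (if H.Adj b c then 1 else 0) + (if H.Adj b d then 1 else 0) +
      (if H.Adj c d then 1 else 0) := by
  have hd : eI H {d} = 0 := by
    have := eI_insert H ∅ (v := d) (by simp)
    rw [eI_empty] at this
    simpa using this
  rw [eI_insert H _ (by grind), eI_insert H _ (by grind), eI_insert H _ (by grind), hd]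
  simp only [filter_insert, filter_singleton]
  split_ifs <;> simp [*]

lemma four_props {p q r s t w : Prop}
    (he : 4 ≤ (if p then 1 else 0) + (if q then 1 else 0) + (if r then 1 else 0) +
      (if s then 1 else 0) + (if t then 1 else 0) + (if w then 1 else 0))
    (ha : ¬ (s ∧ t ∧ w)) (hb : ¬ (q ∧ r ∧ w)) (hc : ¬ (p ∧ r ∧ t)) (hd : ¬ (p ∧ q ∧ s)) :
    (¬ p ∧ ¬ w ∧ q ∧ r ∧ s ∧ t) ∨ (¬ q ∧ ¬ t ∧ p ∧ r ∧ s ∧ w) ∨ (¬ r ∧ ¬ s ∧ p ∧ q ∧ t ∧ w) := by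
  by_cases p <;> by_cases q <;> by_cases r <;> by_cases s <;> by_cases t <;> by_cases w <;>
  simp_all

lemma four_cases {H : SimpleGraph V} {S : Finset V} (hS : #S = 4) (he : 4 ≤ eI H S) :
    (∃ s ∈ S, ∀ x ∈ S, ∀ y ∈ S, x ≠ y → x ≠ s → y ≠ s → H.Adj x y) ∨
    (eI H S = 4 ∧ ∃ a b c d, S = {a, b, c, d} ∧ a ≠ b ∧ a ≠ c ∧ a ≠ d ∧ b ≠ c ∧ b ≠ d ∧ c ≠ d ∧
      H.Adj a c ∧ H.Adj a d ∧ H.Adj b c ∧ H.Adj b d) := by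
  obtain ⟨a, b, c, d, rfl, h1, h2, h3, h4, h5, h6⟩ := exists_four hS
  have hf := eI_four (H := H) h1 h2 h3 h4 h5 h6
  have tri : ∀ x y z, H.Adj x y → H.Adj x z → H.Adj y z → ∀ p ∈ ({x, y, z} : Finset V),
      ∀ q ∈ ({x, y, z} : Finset V), p ≠ q → H.Adj p q := by
    intro x y z e1 e2 e3 p hp q hq hpq
    simp only [mem_insert, mem_singleton] at hp hq
    rcases hp with rfl | rfl | rfl <;> rcases hq with rfl | rfl | rfl <;>
      first | exact absurd rfl hpq | assumption | (apply SimpleGraph.Adj.symm; assumption)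
  by_cases hs : ∃ s ∈ ({a, b, c, d} : Finset V), ∀ x ∈ ({a, b, c, d} : Finset V),
      ∀ y ∈ ({a, b, c, d} : Finset V), x ≠ y → x ≠ s → y ≠ s → H.Adj x y
  · exact Or.inl hs
  right
  have h (s : V) (hm : s ∈ ({a, b, c, d} : Finset V)) (x y z : V)
      (hc : ∀ p ∈ ({a, b, c, d} : Finset V), p ≠ s → p ∈ ({x, y, z} : Finset V)) :
      ¬ (H.Adj x y ∧ H.Adj x z ∧ H.Adj y z) := fun e =>
    hs ⟨s, hm, fun p hp q hq hpq hps hqs =>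
      tri x y z e.1 e.2.1 e.2.2 p (hc p hp hps) q (hc q hq hqs) hpq⟩
  have key := four_props (hf ▸ he) (h a (by simp) b c d (by simp +contextual))
    (h b (by simp) a c d (by simp +contextual)) (h c (by simp) a b d (by simp +contextual))
    (h d (by simp) a b c (by simp +contextual))
  rcases key with ⟨e1, e2, e3, e4, e5, e6⟩ | ⟨e1, e2, e3, e4, e5, e6⟩ | ⟨e1, e2, e3, e4, e5, e6⟩
  · refine ⟨?_, a, b, c, d, rfl, h1, h2, h3, h4, h5, h6, e3, e4, e5, e6⟩
    rw [hf, if_neg e1, if_neg e2, if_pos e3, if_pos e4, if_pos e5, if_pos e6]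
  · refine ⟨?_, a, c, b, d, by grind, h2, h1, h3, h4.symm, h6, h5, e3, e4, e5.symm, e6⟩
    rw [hf, if_neg e1, if_neg e2, if_pos e3, if_pos e4, if_pos e5, if_pos e6]
  · refine ⟨?_, a, d, b, c, by grind, h3, h1, h2, h5.symm, h6.symm, h4, e3, e4, e5.symm, e6.symm⟩
    rw [hf, if_neg e1, if_neg e2, if_pos e3, if_pos e4, if_pos e5, if_pos e6]

section
variable [Fintype V] {G : SimpleGraph V}

/-- `S` is a `4`-cut separating `X` from `Y`. -/
structure Sep4 (G : SimpleGraph V) (X S Y : Finset V) : Prop where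
  left : X.Nonempty
  right : Y.Nonempty
  card : #S = 4
  disjXS : Disjoint X S
  disjYS : Disjoint Y S
  disjXY : Disjoint X Y
  cover : ∀ x, x ∈ X ∨ x ∈ S ∨ x ∈ Y
  no_edge : ∀ a ∈ X, ∀ b ∈ Y, ¬ G.Adj a b

lemma Sep4.symm {X S Y : Finset V} (h : Sep4 G X S Y) : Sep4 G Y S X :=
  ⟨h.right, h.left, h.card, h.disjYS, h.disjXS, h.disjXY.symm, fun x => by have := h.cover x; tauto,
    fun a ha b hb hab => h.no_edge b hb a ha hab.symm⟩

lemma Sep4.eI {X S Y : Finset V} (h : Sep4 G X S Y) :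
    eI G univ + eI G S = eI G (X ∪ S) + eI G (Y ∪ S) := by
  have h1 := h.disjXS
  have h2 := h.disjYS
  have h3 := h.disjXY
  rw [Finset.disjoint_left] at h1 h2 h3
  have e1 : (univ : Finset V) = (X ∪ S) ∪ (Y ∪ S) := by
    ext x
    have := h.cover x
    grind
  have e2 : S = (X ∪ S) ∩ (Y ∪ S) := by
    ext x
    grind
  have := eI_union G (X ∪ S) (Y ∪ S) fun a ha b hb => h.no_edge a (by grind) b (by grind)
  rwa [← e1, ← e2] at this

lemma Sep4.card_univ {X S Y : Finset V} (h : Sep4 G X S Y) :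
    #(univ : Finset V) = #X + #Y + 4 := by
  have h1 := h.disjXS
  have h2 := h.disjYS
  have e1 : (univ : Finset V) = (X ∪ Y) ∪ S := by
    ext x
    have := h.cover x
    grind
  rw [e1, card_union_of_disjoint (disjoint_union_left.2 ⟨h1, h2⟩),
    card_union_of_disjoint h.disjXY, h.card]

lemma Sep4.K42_of_dense {X S Y : Finset V} (hG : FC G univ) (h : Sep4 G X S Y)
    (he : MinEnemy.eI G S + 4 * #X + 1 ≤ MinEnemy.eI G (X ∪ S)) : K42 G (X ∪ S) S := by
  have h1 := h.disjXS
  have h2 := h.disjYS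
  have h3 := h.disjXY
  rw [Finset.disjoint_left] at h1 h2 h3
  refine Massed.K42 ⟨subset_union_right, ?_, fun A B hAB hA hlt => ?_⟩ h.card.le
  · have : (X ∪ S) \ S = X := by grind
    rwa [this]
  · by_cases hBA : (B \ A).Nonempty
    · exfalso
      have hB' := hAB.sub_right
      have hBX : B \ A ⊆ X := fun x hx => by
        have := hB' (mem_sdiff.1 hx).1
        have := fun h => (mem_sdiff.1 hx).2 (hA h)
        grind
      have := hG.2 (B \ A) ((A \ B) ∪ Y) (subset_univ _) (subset_univ _) hBA
        (h.right.mono subset_union_right) (by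
          rw [Finset.disjoint_left]
          intro x hx
          have := h3 (hBX hx)
          grind) (fun a ha b hb hab => by
          rcases mem_union.1 hb with hb | hb
          · exact hAB.2 b hb a ha hab.symm
          · exact h.no_edge a (hBX ha) b hb hab)
      have hc : univ \ (B \ A ∪ (A \ B ∪ Y)) ⊆ A ∩ B := by
        intro x hx
        have hx1 : x ∉ Y := by
          simp only [mem_sdiff, mem_union] at hx
          tauto
        have hx2 : x ∈ X ∪ S := mem_union.2 ((h.cover x).imp_right fun h => h.resolve_right hx1)
        rw [← hAB.1] at hx2
        simp only [mem_sdiff, mem_union, mem_univ, true_and] at hx hx2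
        rw [mem_inter]
        tauto
      have := this.trans (card_le_card hc)
      have := h.card
      omega
    · rw [not_nonempty_iff_eq_empty] at hBA
      have e1 := hAB.1
      have : A = X ∪ S := by
        rw [← e1]
        exact (union_eq_left.2 (sdiff_eq_empty_iff_subset.1 hBA)).symm
      rw [this]
      omega

lemma fc_side (hG : FC G univ) {X S Y : Finset V} (h : Sep4 G X S Y) :
    FC (G ⊔ cliq S) (Y ∪ S) := by
  have h1 := h.disjXS
  have h2 := h.disjYS
  have h3 := h.disjXY
  refine ⟨?_, ?_⟩
  · rw [card_union_of_disjoint h2, h.card]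
    have := h.right.card_pos
    omega
  rw [Finset.disjoint_left] at h1 h2 h3
  have key : ∀ P Q, P ⊆ Y ∪ S → Q ⊆ Y ∪ S → P.Nonempty → Q.Nonempty → Disjoint P Q →
      (∀ a ∈ P, ∀ b ∈ Q, ¬ (G ⊔ cliq S).Adj a b) → (∀ a ∈ P, a ∉ S) →
      4 ≤ #((Y ∪ S) \ (P ∪ Q)) := by
    intro P Q hP hQ hPn hQn hd hno hPS
    rw [Finset.disjoint_left] at hd
    have := hG.2 P (Q ∪ X) (subset_univ _) (subset_univ _) hPn (hQn.mono subset_union_left) (by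
        rw [Finset.disjoint_left]
        grind) (fun a ha b hb hab => by
        rcases mem_union.1 hb with hb | hb
        · exact hno a ha b hb (Or.inl hab)
        · exact h.no_edge b hb a (by grind) hab.symm)
    have hc : univ \ (P ∪ (Q ∪ X)) = (Y ∪ S) \ (P ∪ Q) := by
      ext x
      have := h.cover x
      grind
    rwa [hc] at this
  intro P Q hP hQ hPn hQn hd hno
  by_cases hPS : ∀ a ∈ P, a ∉ S
  · exact key P Q hP hQ hPn hQn hd hno hPS
  · rw [union_comm P]
    refine key Q P hQ hP hQn hPn hd.symm (fun a ha b hb hab => hno b hb a ha hab.symm)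
      fun b hb hbS => ?_
    push Not at hPS
    obtain ⟨a, ha, haS⟩ := hPS
    exact hno a ha b hb (Or.inr ⟨haS, hbS, by rintro rfl; exact Finset.disjoint_left.1 hd ha hb⟩)

lemma side_bound (hG : Crit G) {X S Y : Finset V} (h : Sep4 G X S Y) {u v : V} (hu : u ∈ S)
    (hv : v ∈ S) (huv : G.Adj u v) (hK : K42 G (X ∪ S) S) :
    MinEnemy.eI G (Y ∪ S) ≤ MinEnemy.eI G S + 4 * #Y + 2 ∧
    (MinEnemy.eI G (Y ∪ S) = MinEnemy.eI G S + 4 * #Y + 2 → IsOcta (G ⊔ cliq S) (Y ∪ S)) := by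
  have h1 := h.disjXS
  have h2 := h.disjYS
  have h3 := h.disjXY
  have hYS := card_union_of_disjoint h2
  rw [h.card] at hYS
  have hcl : ∃ γ, Model (cliq S) S G (X ∪ S) γ ∧ ∀ s ∈ S, s ∈ γ s := by
    have hc : #((S.erase u).erase v) = 2 := by
      rw [card_erase_of_mem (by have := huv.ne'; grind), card_erase_of_mem hu, h.card]
    obtain ⟨s, t, hst, hST⟩ := card_eq_two.1 hc
    have hs : s ∈ (S.erase u).erase v := by rw [hST]; simp
    have ht : t ∈ (S.erase u).erase v := by rw [hST]; simp
    refine hK.rooted_clique (a := s) (b := t) (by grind) (by grind) hst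
      fun x hx y hy hxy h1 h2 h3 h4 => ?_
    have : ∀ w ∈ S, w ≠ s → w ≠ t → w = u ∨ w = v := by
      intro w hw hws hwt
      by_contra hn
      have : w ∈ (S.erase u).erase v := by grind
      rw [hST] at this
      grind
    have h1 := this x hx h1 h2
    have h2 := this y hy h3 h4
    have := huv.symm
    grind
  obtain ⟨γ, hγ, hγS⟩ := hcl
  rw [Finset.disjoint_left] at h1 h2 h3
  have hm := hγ.of_rooted (A := Y ∪ S) hγS (by grind)
  have hc : (Y ∪ S) ∪ (X ∪ S) = univ := by
    ext x
    have := h.cover x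
    grind
  rw [hc] at hm
  have hfc := fc_side hG.fc h
  have e1 := eI_sup_cliq (H := G) (Z := S) (A := Y ∪ S) subset_union_right
  have e2 := eI_sup_cliq_self (H := G) (Z := S)
  rw [h.card] at e2
  have hmin := hG.min _ _ _ hm hfc
  have hlt : #(Y ∪ S) < #(univ : Finset V) := by
    rw [h.card_univ, hYS]
    have := h.left.card_pos
    omega
  have key : MinEnemy.eI G S + 4 * #Y + 2 ≤ MinEnemy.eI G (Y ∪ S) →
      IsOcta (G ⊔ cliq S) (Y ∪ S) := fun hge => hmin (by omega) hlt
  refine ⟨?_, fun he => key he.ge⟩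
  by_contra hgt
  have ho := key (by omega)
  have e3 := eI_of_isOcta ho
  have e4 := ho.1
  omega

end

end

section

open scoped Classical
variable {V : Type}
variable [Fintype V] {G : SimpleGraph V}

lemma Crit.no_bags (hG : Crit G) {W : Type} {S : Finset W} (hS : #S = 4) {B : W → Finset V}
    {D C₀ C₁ : Finset V} (hB : ∀ z ∈ S, Conn G (B z)) (hD : Conn G D) (h₀ : Conn G C₀)
    (h₁ : Conn G C₁) (hBd : ∀ z ∈ S, ∀ y ∈ S, z ≠ y → Disjoint (B z) (B y))
    (hDd : ∀ z ∈ S, Disjoint D (B z)) (h₀d : ∀ z ∈ S, Disjoint C₀ (B z))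
    (h₁d : ∀ z ∈ S, Disjoint C₁ (B z)) (hD₀ : Disjoint D C₀) (hD₁ : Disjoint D C₁)
    (h₀₁ : Disjoint C₀ C₁) (hBt : ∀ z ∈ S, ∀ y ∈ S, z ≠ y → Touch G (B z) (B y))
    (hDt : ∀ z ∈ S, Touch G D (B z)) (h₀t : ∀ z ∈ S, Touch G C₀ (B z))
    (h₁t : ∀ z ∈ S, Touch G C₁ (B z)) (h₀₁t : Touch G C₀ C₁) : False := by
  let e := (S.equivFinOfCardEq hS).symm
  have hne : ∀ i j, i ≠ j → (e i : W) ≠ e j := fun i j hij h => hij (e.injective (Subtype.ext h))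
  have h7 : ∀ i : Fin 7, i = 0 ∨ i = 1 ∨ i = 2 ∨ ∃ j : Fin 4, i = j.succ.succ.succ := by decide
  refine hG.no_minor (Fin.cons D (Fin.cons C₀ (Fin.cons C₁ fun i => B (e i)))) ⟨?_, ?_, ?_, ?_⟩
  · intro i _
    refine Fin.cases hD (Fin.cases h₀ (Fin.cases h₁ fun i => hB _ (e i).2)) i
  · exact fun _ _ => subset_univ _
  · suffices h : ∀ i j, i ≠ j → _ from fun i _ j _ => h i j
    intro i j hij
    obtain rfl | rfl | rfl | ⟨i, rfl⟩ := h7 i <;> obtain rfl | rfl | rfl | ⟨j, rfl⟩ := h7 j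
    · exact absurd rfl hij
    · exact hD₀
    · exact hD₁
    · exact hDd _ (e j).2
    · exact hD₀.symm
    · exact absurd rfl hij
    · exact h₀₁
    · exact h₀d _ (e j).2
    · exact hD₁.symm
    · exact h₀₁.symm
    · exact absurd rfl hij
    · exact h₁d _ (e j).2
    · exact (hDd _ (e i).2).symm
    · exact (h₀d _ (e i).2).symm
    · exact (h₁d _ (e i).2).symm
    · exact hBd _ (e i).2 _ (e j).2 (hne i j (by rintro rfl; exact hij rfl))
  · suffices h : ∀ i j, K7vee.Adj i j → _ from fun i _ j _ => h i j
    intro i j hij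
    obtain rfl | rfl | rfl | ⟨i, rfl⟩ := h7 i <;> obtain rfl | rfl | rfl | ⟨j, rfl⟩ := h7 j
    · exact absurd rfl hij.ne
    · exact absurd hij (by simp [K7vee])
    · exact absurd hij (by simp [K7vee])
    · exact hDt _ (e j).2
    · exact absurd hij (by simp [K7vee])
    · exact absurd rfl hij.ne
    · exact h₀₁t
    · exact h₀t _ (e j).2
    · exact absurd hij (by simp [K7vee])
    · exact h₀₁t.symm
    · exact absurd rfl hij.ne
    · exact h₁t _ (e j).2
    · exact (hDt _ (e i).2).symm
    · exact (h₀t _ (e i).2).symm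
    · exact (h₁t _ (e i).2).symm
    · exact hBt _ (e i).2 _ (e j).2 (hne i j (by rintro rfl; exact hij.ne rfl))

/-- A rooted `K₄` in `X ∪ S` together with a set touching all four bags cannot coexist with a
rooted structure in `Y ∪ S`. -/
lemma Sep4.not_filler (hG : Crit G) {X S Y : Finset V} (h : Sep4 G X S Y) (hK : K42 G (Y ∪ S) S)
    {F : V → Finset V} {D : Finset V} (hF : ∀ z ∈ S, z ∈ F z ∧ Conn G (F z) ∧ F z ⊆ X ∪ S)
    (hFd : ∀ z ∈ S, ∀ y ∈ S, z ≠ y → Disjoint (F z) (F y) ∧ Touch G (F z) (F y))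
    (hD : Conn G D) (hDX : D ⊆ X) (hDF : ∀ z ∈ S, Disjoint D (F z) ∧ Touch G D (F z)) :
    False := by
  obtain ⟨β, C₀, C₁, hβ⟩ := hK
  have h1 := h.disjXS
  have h2 := h.disjYS
  have h3 := h.disjXY
  rw [Finset.disjoint_left] at h1 h2 h3
  have hCY : ∀ C, C ⊆ Y ∪ S → (∀ z ∈ S, Disjoint C (β z)) → C ⊆ Y := by
    intro C hC hd x hx
    have hxS : x ∉ S := fun hxS => Finset.disjoint_left.1 (hd x hxS) hx (hβ.mem x hxS)
    exact (mem_union.1 (hC hx)).resolve_right hxS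
  have h₀ := hCY C₀ hβ.sub₀ fun z hz => (hβ.disj₀ z hz).symm
  have h₁ := hCY C₁ hβ.sub₁ fun z hz => (hβ.disj₁ z hz).symm
  have hβS : ∀ z ∈ S, ∀ x ∈ β z, x ∈ Y ∨ x = z := by
    intro z hz x hx
    by_contra hn
    push Not at hn
    have hxS : x ∈ S := (mem_union.1 (hβ.sub z hz hx)).resolve_left hn.1
    exact Finset.disjoint_left.1 (hβ.disj z hz x hxS hn.2.symm) hx (hβ.mem x hxS)
  have hFS : ∀ z ∈ S, ∀ x ∈ F z, x ∈ X ∨ x = z := by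
    intro z hz x hx
    by_contra hn
    push Not at hn
    have hxS : x ∈ S := (mem_union.1 ((hF z hz).2.2 hx)).resolve_left hn.1
    exact Finset.disjoint_left.1 (hFd z hz x hxS hn.2.symm).1 hx (hF x hxS).1
  have hY : ∀ C, C ⊆ Y → ∀ z ∈ S, Disjoint C (β z) → Disjoint C (β z ∪ F z) := by
    intro C hC z hz hd
    refine disjoint_union_right.2 ⟨hd, ?_⟩
    rw [Finset.disjoint_left]
    intro x hx hxF
    rcases hFS z hz x hxF with h | rfl
    · exact h3 h (hC hx)
    · exact h2 (hC hx) hz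
  refine hG.no_bags (B := fun z => β z ∪ F z) h.card
    (fun z hz => (hβ.conn z hz).union_of_mem (hF z hz).2.1 (hβ.mem z hz) (hF z hz).1) hD hβ.conn₀
    hβ.conn₁ ?_ ?_ (fun z hz => hY _ h₀ z hz (hβ.disj₀ z hz).symm)
    (fun z hz => hY _ h₁ z hz (hβ.disj₁ z hz).symm) ?_ ?_ hβ.disj₀₁
    (fun z hz y hy hzy => (hFd z hz y hy hzy).2.sub subset_union_right subset_union_right)
    (fun z hz => (hDF z hz).2.sub subset_rfl subset_union_right)
    (fun z hz => (hβ.touch₀ z hz).symm.sub subset_rfl subset_union_left)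
    (fun z hz => (hβ.touch₁ z hz).symm.sub subset_rfl subset_union_left) hβ.touch₀₁
  · intro z hz y hy hzy
    simp only [disjoint_union_left, disjoint_union_right]
    refine ⟨⟨hβ.disj z hz y hy hzy, ?_⟩, ?_, (hFd z hz y hy hzy).1⟩ <;> rw [Finset.disjoint_left]
    · intro x hx hx'
      rcases hβS _ hy x hx' with h | rfl
      · rcases hFS _ hz x hx with h' | rfl
        · exact h3 h' h
        · exact h2 h hz
      · rcases hFS _ hz x hx with h' | rfl
        · exact h1 h' hy
        · exact hzy rfl
    · intro x hx hx'
      rcases hβS _ hz x hx with h | rfl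
      · rcases hFS _ hy x hx' with h' | rfl
        · exact h3 h' h
        · exact h2 h hy
      · rcases hFS _ hy x hx' with h' | rfl
        · exact h1 h' hz
        · exact hzy rfl
  · intro z hz
    refine disjoint_union_right.2 ⟨?_, (hDF z hz).1⟩
    rw [Finset.disjoint_left]
    intro x hx hx'
    rcases hβS _ hz x hx' with h | rfl
    · exact h3 (hDX hx) h
    · exact h1 (hDX hx) hz
  · exact Finset.disjoint_of_subset_left hDX (Finset.disjoint_of_subset_right h₀ h.disjXY)
  · exact Finset.disjoint_of_subset_left hDX (Finset.disjoint_of_subset_right h₁ h.disjXY)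

lemma IsOcta.antipodes {H : SimpleGraph V} {U S : Finset V} (h : IsOcta H U) (hS : S ⊆ U)
    (hcl : ∀ x ∈ S, ∀ y ∈ S, x ≠ y → H.Adj x y) : ∃ γ : V → V, ∀ z ∈ S, γ z ∈ U ∧ γ z ∉ S ∧
      ∀ y ∈ S, y ≠ z → H.Adj z (γ y) ∧ H.Adj (γ z) (γ y) := by
  have hex : ∀ z, ∃ z', z ∈ S → z' ∈ U ∧ z' ≠ z ∧ ∀ b ∈ U, H.Adj z b ↔ b ≠ z ∧ b ≠ z' := by
    intro z
    by_cases hz : z ∈ S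
    · obtain ⟨z', h1, h2⟩ := h.2 z (hS hz)
      exact ⟨z', fun _ => ⟨h1, h2⟩⟩
    · exact ⟨z, fun h => absurd h hz⟩
  choose γ hγ using hex
  have key : ∀ z ∈ S, ∀ b ∈ U, H.Adj (γ z) b ↔ b ≠ γ z ∧ b ≠ z := by
    intro z hz b hb
    obtain ⟨h1, h2, h3⟩ := hγ z hz
    obtain ⟨w, hw, hne, hw'⟩ := h.2 (γ z) h1
    have : w = z := by
      by_contra hn
      have := (hw' z (hS hz)).2 ⟨h2.symm, fun h => hn h.symm⟩
      exact ((h3 _ h1).1 this.symm).2 rfl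
    rw [hw' b hb, this]
  refine ⟨γ, fun z hz => ⟨(hγ z hz).1, fun hS' => ?_, fun y hy hyz => ?_⟩⟩
  · have := hcl z hz _ hS' (hγ z hz).2.1.symm
    exact (((hγ z hz).2.2 _ (hγ z hz).1).1 this).2 rfl
  · have h1 : H.Adj z (γ y) := ((key y hy z (hS hz)).2 ⟨fun e => ?_, hyz.symm⟩).symm
    · refine ⟨h1, (key z hz _ (hγ y hy).1).2 ⟨fun e => ?_, h1.ne'⟩⟩
      rw [e] at h1
      exact (((hγ z hz).2.2 _ (hγ z hz).1).1 h1).2 rfl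
    · have := hcl y hy z hz hyz
      rw [e] at this
      exact (((hγ y hy).2.2 _ (hγ y hy).1).1 this).2 rfl

lemma Sep4.not_both (hG : Crit G) {X S Y : Finset V} (h : Sep4 G X S Y) {u v : V} (hu : u ∈ S)
    (hv : v ∈ S) (huv : G.Adj u v) (hX : K42 G (X ∪ S) S) (hY : K42 G (Y ∪ S) S) : False := by
  have b1 := side_bound hG h hu hv huv hX
  have b2 := side_bound hG h.symm hu hv huv hY
  have e1 := h.eI
  have e2 := hG.edges
  rw [h.card_univ] at e2
  have h1 := h.disjXS
  rw [Finset.disjoint_left] at h1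
  rcases four_cases (H := G) h.card (by omega) with ⟨s, hs, hst⟩ |
    ⟨he, a, b, c, d, rfl, hab, hac, had, hbc, hbd, hcd, eac, ead, ebc, ebd⟩
  · obtain ⟨β, C₀, C₁, hβ⟩ := hX
    have hC₁ : C₁ ⊆ X := by
      intro x hx
      refine (mem_union.1 (hβ.sub₁ hx)).resolve_right fun hxS => ?_
      exact Finset.disjoint_left.1 (hβ.disj₁ x hxS) (hβ.mem x hxS) hx
    have hsub : ∀ z, β z ⊆ if z = s then β z ∪ C₀ else β z := by
      intro z
      split_ifs
      · exact subset_union_left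
      · rfl
    have hC : C₀ ⊆ if s = s then β s ∪ C₀ else β s := by
      rw [if_pos rfl]
      exact subset_union_right
    refine h.not_filler hG hY (F := fun z => if z = s then β z ∪ C₀ else β z) (D := C₁)
      (fun z hz => ⟨hsub z (hβ.mem z hz), ?_, ?_⟩) (fun z hz y hy hzy => ⟨?_, ?_⟩) hβ.conn₁ hC₁
      fun z hz => ⟨?_, (hβ.touch₁ z hz).symm.sub subset_rfl (hsub z)⟩
    · split_ifs
      · exact (hβ.conn z hz).union hβ.conn₀ (hβ.touch₀ z hz)
      · exact hβ.conn z hz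
    · split_ifs
      · exact union_subset (hβ.sub z hz) hβ.sub₀
      · exact hβ.sub z hz
    · split_ifs with e e' e'
      · exact absurd (e.trans e'.symm) hzy
      · exact disjoint_union_left.2 ⟨hβ.disj z hz y hy hzy, (hβ.disj₀ y hy).symm⟩
      · exact disjoint_union_right.2 ⟨hβ.disj z hz y hy hzy, hβ.disj₀ z hz⟩
      · exact hβ.disj z hz y hy hzy
    · by_cases e : z = s
      · subst e
        exact (hβ.touch₀ y hy).symm.sub hC (hsub y)
      · by_cases e' : y = s
        · subst e'
          exact (hβ.touch₀ z hz).sub (hsub z) hC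
        · exact Touch.sub ⟨z, hβ.mem z hz, y, hβ.mem y hy, hst z hz y hy hzy e e'⟩ (hsub z) (hsub y)
    · split_ifs
      · exact disjoint_union_right.2 ⟨(hβ.disj₁ z hz).symm, hβ.disj₀₁.symm⟩
      · exact (hβ.disj₁ z hz).symm
  · have ho := b2.2 (by omega)
    obtain ⟨γ, hγ⟩ := ho.antipodes (S := {a, b, c, d}) subset_union_right
      fun x hx y hy hxy => Or.inr ⟨hx, hy, hxy⟩
    have hγX : ∀ z ∈ ({a, b, c, d} : Finset V), γ z ∈ X := fun z hz =>
      (mem_union.1 (hγ z hz).1).resolve_right (hγ z hz).2.1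
    have hadj : ∀ z ∈ ({a, b, c, d} : Finset V), ∀ y ∈ ({a, b, c, d} : Finset V), y ≠ z →
        G.Adj z (γ y) ∧ G.Adj (γ z) (γ y) := by
      intro z hz y hy hyz
      have := (hγ z hz).2.2 y hy hyz
      exact ⟨this.1.resolve_right fun h => (hγ y hy).2.1 h.2.1,
        this.2.resolve_right fun h => (hγ y hy).2.1 h.2.1⟩
    have ha : a ∈ ({a, b, c, d} : Finset V) := by simp
    have hb : b ∈ ({a, b, c, d} : Finset V) := by simp
    have hc : c ∈ ({a, b, c, d} : Finset V) := by simp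
    have hd : d ∈ ({a, b, c, d} : Finset V) := by simp
    have nab := hadj a ha b hb hab.symm
    have nac := hadj a ha c hc hac.symm
    have nad := hadj a ha d hd had.symm
    have nba := hadj b hb a ha hab
    have nbc := hadj b hb c hc hbc.symm
    have nbd := hadj b hb d hd hbd.symm
    have nca := hadj c hc a ha hac
    have ncb := hadj c hc b hb hbc
    have ncd := hadj c hc d hd hcd.symm
    have nda := hadj d hd a ha had
    have ndb := hadj d hd b hb hbd
    have xa := hγX a ha
    have xb := hγX b hb
    have xc := hγX c hc
    have xd := hγX d hd
    have hno : ∀ z ∈ X, z ≠ a ∧ z ≠ b ∧ z ≠ c ∧ z ≠ d := by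
      intro z hz
      have := h1 hz
      simpa using this
    have ya := hno _ xa
    have yb := hno _ xb
    have yc := hno _ xc
    have yd := hno _ xd
    let F : V → Finset V := fun z => if z = a then {a, γ c} else if z = c then {c, γ a} else {z}
    have Fa : F a = {a, γ c} := if_pos rfl
    have Fb : F b = {b} := by simp only [F, if_neg hab.symm, if_neg hbc]
    have Fc : F c = {c, γ a} := by simp only [F, if_neg hac.symm, if_pos]
    have Fd : F d = {d} := by simp only [F, if_neg had.symm, if_neg hcd.symm]
    have nab' := nab.2.ne
    have nac' := nac.2.ne
    have nad' := nad.2.ne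
    have nbc' := nbc.2.ne
    have nbd' := nbd.2.ne
    have ncd' := ncd.2.ne
    have hpair : ∀ z ∈ ({a, b, c, d} : Finset V), ∀ y ∈ ({a, b, c, d} : Finset V), z ≠ y →
        Disjoint (F z) (F y) ∧ Touch G (F z) (F y) := by
      have t : ∀ x y, (Disjoint (F x) (F y) ∧ Touch G (F x) (F y)) →
          (Disjoint (F y) (F x) ∧ Touch G (F y) (F x)) := fun x y h => ⟨h.1.symm, h.2.symm⟩
      have tab : Disjoint (F a) (F b) ∧ Touch G (F a) (F b) := by
        rw [Fa, Fb]
        exact ⟨by simp; grind, γ c, by simp, b, by simp, nbc.1.symm⟩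
      have tac : Disjoint (F a) (F c) ∧ Touch G (F a) (F c) := by
        rw [Fa, Fc]
        exact ⟨by simp; grind, a, by simp, c, by simp, eac⟩
      have tad : Disjoint (F a) (F d) ∧ Touch G (F a) (F d) := by
        rw [Fa, Fd]
        exact ⟨by simp; grind, a, by simp, d, by simp, ead⟩
      have tbc : Disjoint (F b) (F c) ∧ Touch G (F b) (F c) := by
        rw [Fb, Fc]
        exact ⟨by simp; grind, b, by simp, c, by simp, ebc⟩
      have tbd : Disjoint (F b) (F d) ∧ Touch G (F b) (F d) := by
        rw [Fb, Fd]
        exact ⟨by simp; grind, b, by simp, d, by simp, ebd⟩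
      have tcd : Disjoint (F c) (F d) ∧ Touch G (F c) (F d) := by
        rw [Fc, Fd]
        exact ⟨by simp; grind, γ a, by simp, d, by simp, nda.1.symm⟩
      intro z hz y hy hzy
      simp only [mem_insert, mem_singleton] at hz hy
      rcases hz with rfl | rfl | rfl | rfl <;> rcases hy with rfl | rfl | rfl | rfl <;>
        first | exact absurd rfl hzy | assumption | (apply t; assumption)
    refine h.not_filler hG hY (F := F) (D := {γ b, γ d}) ?_ hpair (conn_pair nbd.2) ?_ ?_
    · intro z hz
      simp only [mem_insert, mem_singleton] at hz
      rcases hz with rfl | rfl | rfl | rfl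
      · rw [Fa]
        exact ⟨by simp, conn_pair nac.1,
          insert_subset (by simp) (singleton_subset_iff.2 (mem_union_left _ xc))⟩
      · rw [Fb]; exact ⟨by simp, conn_singleton _ _, by simp⟩
      · rw [Fc]
        exact ⟨by simp, conn_pair nca.1,
          insert_subset (by simp) (singleton_subset_iff.2 (mem_union_left _ xa))⟩
      · rw [Fd]; exact ⟨by simp, conn_singleton _ _, by simp⟩
    · exact insert_subset xb (singleton_subset_iff.2 xd)
    · intro z hz
      simp only [mem_insert, mem_singleton] at hz
      rcases hz with rfl | rfl | rfl | rfl
      · rw [Fa]; exact ⟨by simp; grind, γ b, by simp, z, by simp, nab.1.symm⟩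
      · rw [Fb]; exact ⟨by simp; grind, γ d, by simp, z, by simp, nbd.1.symm⟩
      · rw [Fc]; exact ⟨by simp; grind, γ b, by simp, z, by simp, ncb.1.symm⟩
      · rw [Fd]; exact ⟨by simp; grind, γ b, by simp, z, by simp, ndb.1.symm⟩

end

section

open scoped Classical
variable {V : Type}

/-- `K` is a component of `G[W]`. -/
def Comp (G : SimpleGraph V) (W K : Finset V) : Prop :=
  K ⊆ W ∧ Conn G K ∧ ∀ x ∈ K, ∀ y ∈ W, G.Adj x y → y ∈ K

variable [Fintype V] {G : SimpleGraph V}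

/-- The neighbourhood of the set `K`. -/
noncomputable def nb (G : SimpleGraph V) (K : Finset V) : Finset V :=
  univ.filter fun x => x ∉ K ∧ ∃ k ∈ K, G.Adj k x

lemma mem_nb {K : Finset V} {x : V} : x ∈ nb G K ↔ x ∉ K ∧ ∃ k ∈ K, G.Adj k x := by
  simp [nb]

lemma FC.le_nb (hG : FC G univ) {K S : Finset V} (hK : K.Nonempty) {y : V} (hyK : y ∉ K)
    (hyS : y ∉ S) (h : ∀ k ∈ K, ∀ x, x ∉ K → G.Adj k x → x ∈ S) : 4 ≤ #S := by
  refine (hG.2 K (univ \ (K ∪ S)) (subset_univ _) (subset_univ _) hK ⟨y, by simp [hyK, hyS]⟩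
    ?_ ?_).trans (card_le_card ?_)
  · rw [Finset.disjoint_left]
    intro a ha
    simp [ha]
  · intro a ha b hb hab
    simp only [mem_sdiff, mem_union, mem_univ, true_and, not_or] at hb
    exact hb.2 (h a ha b hb.1 hab)
  · intro x
    simp only [mem_sdiff, mem_union, mem_univ, true_and]
    tauto

lemma sep4_nb {K : Finset V} (hK : K.Nonempty) (h4 : #(nb G K) = 4) {y : V} (hyK : y ∉ K)
    (hyS : y ∉ nb G K) : Sep4 G K (nb G K) (univ \ (K ∪ nb G K)) := by
  refine ⟨hK, ⟨y, by simp [hyK, hyS]⟩, h4, ?_, ?_, ?_, fun x => ?_, fun a ha b hb hab => ?_⟩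
  · rw [Finset.disjoint_right]
    exact fun x hx => (mem_nb.1 hx).1
  · rw [Finset.disjoint_left]
    intro x hx
    simp only [mem_sdiff, mem_union] at hx
    tauto
  · rw [Finset.disjoint_right]
    intro x hx
    simp only [mem_sdiff, mem_union] at hx
    tauto
  · simp only [mem_sdiff, mem_union, mem_univ, true_and]
    tauto
  · simp only [mem_sdiff, mem_union, mem_univ, true_and, not_or] at hb
    exact hb.2 (mem_nb.2 ⟨hb.1, a, ha, hab⟩)

/-- Every component of `G[W]` is cut off by a `4`-cut containing `u` and `v`, and is sparse. -/
structure Good (G : SimpleGraph V) (u v : V) (W : Finset V) : Prop where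
  left : u ∉ W
  right : v ∉ W
  card : ∀ K, Comp G W K → #(nb G K) = 4
  mem_left : ∀ K, Comp G W K → u ∈ nb G K
  mem_right : ∀ K, Comp G W K → v ∈ nb G K
  rest : ∀ K, Comp G W K → ∃ y, y ∉ K ∧ y ∉ nb G K
  not_K42 : ∀ K, Comp G W K → ¬ K42 G (K ∪ nb G K) (nb G K)

lemma good_empty (u v : V) : Good G u v ∅ := by
  have : ∀ K, ¬ Comp G ∅ K := fun K hK => hK.2.1.1.ne_empty (subset_empty.1 hK.1)
  exact ⟨by simp, by simp, fun K h => absurd h (this K), fun K h => absurd h (this K),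
    fun K h => absurd h (this K), fun K h => absurd h (this K), fun K h => absurd h (this K)⟩

lemma Comp.of_sdiff {W K L : Finset V} (hK : Comp G W K) (hL : Comp G (W \ K) L) :
    Comp G W L := by
  refine ⟨hL.1.trans sdiff_subset, hL.2.1, fun x hx y hy hxy => ?_⟩
  by_cases hyK : y ∈ K
  · have := mem_sdiff.1 (hL.1 hx)
    exact absurd (hK.2.2 y hyK x this.1 hxy.symm) this.2
  · exact hL.2.2 x hx y (mem_sdiff.2 ⟨hy, hyK⟩) hxy

lemma Good.sdiff {u v : V} {W K : Finset V} (h : Good G u v W) (hK : Comp G W K) :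
    Good G u v (W \ K) :=
  ⟨fun h' => h.left (mem_sdiff.1 h').1, fun h' => h.right (mem_sdiff.1 h').1,
    fun L hL => h.card L (hK.of_sdiff hL), fun L hL => h.mem_left L (hK.of_sdiff hL),
    fun L hL => h.mem_right L (hK.of_sdiff hL), fun L hL => h.rest L (hK.of_sdiff hL),
    fun L hL => h.not_K42 L (hK.of_sdiff hL)⟩

lemma Comp.nb_notMem {W K : Finset V} (hK : Comp G W K) {x : V} (hx : x ∈ nb G K) : x ∉ W := by
  intro hxW
  obtain ⟨h1, k, hk, hkx⟩ := mem_nb.1 hx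
  exact h1 (hK.2.2 k hk x hxW hkx)

lemma Good.count (hG : FC G univ) {u v : V} {W : Finset V} (h : Good G u v W) :
    eI G univ ≤ eI G (univ \ W) + 4 * #W := by
  induction hn : #W using Nat.strong_induction_on generalizing W with
  | _ n ih =>
  subst hn
  obtain rfl | ⟨a, ha⟩ := W.eq_empty_or_nonempty
  · simp
  obtain ⟨K, hKW, haK, hK⟩ := exists_comp G ha
  have hC : Comp G W K := ⟨hKW, hK⟩
  have hd : Disjoint K (nb G K) := by
    rw [Finset.disjoint_right]
    exact fun x hx => (mem_nb.1 hx).1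
  obtain ⟨y, hyK, hyS⟩ := h.rest K hC
  have hs := sep4_nb ⟨a, haK⟩ (h.card K hC) hyK hyS
  have hlt : eI G (K ∪ nb G K) ≤ eI G (nb G K) + 4 * #K := by
    by_contra hlt
    exact h.not_K42 K hC (hs.K42_of_dense hG (by omega))
  have hcard := card_sdiff_add_card_eq_card hKW
  have hpos := card_pos.2 ⟨a, haK⟩
  have h1 := ih #(W \ K) (by omega) (h.sdiff hC) rfl
  have h2 := eI_union G (univ \ W) (K ∪ nb G K) fun x hx k hk hxk => by
    simp only [mem_sdiff, mem_union, mem_univ, true_and, not_or, not_not] at hx hk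
    have hkK : k ∈ K := hk.1.resolve_right fun h' => hC.nb_notMem h' hk.2
    exact hx.2.2 (mem_nb.2 ⟨hx.2.1, k, hkK, hxk.symm⟩)
  have e1 : univ \ W ∪ (K ∪ nb G K) = univ \ (W \ K) := by
    ext x
    have : x ∈ nb G K → x ∉ W := hC.nb_notMem
    simp only [mem_sdiff, mem_union, mem_univ, true_and]
    tauto
  have e2 : univ \ W ∩ (K ∪ nb G K) = nb G K := by
    ext x
    have : x ∈ nb G K → x ∉ W := hC.nb_notMem
    have := @hKW x
    simp only [mem_sdiff, mem_union, mem_inter, mem_univ, true_and]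
    tauto
  rw [e1, e2] at h2
  omega

lemma Good.enlarge (hG : FC G univ) {u v : V} {W X S Y : Finset V} (h : Good G u v W)
    (hs : Sep4 G X S Y) (hu : u ∈ S) (hv : v ∈ S) (hK : ¬ K42 G (X ∪ S) S)
    (hW : ∀ w ∈ W, w ∈ X ∨ w ∈ Y) : Good G u v (W ∪ X) := by
  have h1 := hs.disjXS
  have h2 := hs.disjYS
  have h3 := hs.disjXY
  rw [Finset.disjoint_left] at h1 h2 h3
  have key : ∀ K, Comp G (W ∪ X) K → Comp G W K ∨ (K ⊆ X ∧ nb G K = S) := by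
    intro K hC
    by_cases hx : ∃ x ∈ K, x ∈ X
    · obtain ⟨x, hxK, hxX⟩ := hx
      have hKX : K ⊆ X := hC.2.1.subset_of_closed hC.1 (fun p hp q hq hpq => by
        rcases mem_union.1 hq with hq | hq
        · exact (hW q hq).resolve_right fun hqY => hs.no_edge p hp q hqY hpq
        · exact hq) hxK hxX
      refine Or.inr ⟨hKX, eq_of_subset_of_card_le (fun z hz => ?_) ?_⟩
      · obtain ⟨hzK, k, hk, hkz⟩ := mem_nb.1 hz
        rcases hs.cover z with hz | hz | hz
        · exact absurd (hC.2.2 k hk z (mem_union_right _ hz) hkz) hzK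
        · exact hz
        · exact absurd hkz (hs.no_edge k (hKX hk) z hz)
      · rw [hs.card]
        obtain ⟨y, hy⟩ := hs.right
        refine hG.le_nb ⟨x, hxK⟩ (y := y) (fun hyK => h3 (hKX hyK) hy) (fun hyN => ?_)
          fun k hk z hz hkz => mem_nb.2 ⟨hz, k, hk, hkz⟩
        obtain ⟨-, k, hk, hky⟩ := mem_nb.1 hyN
        exact hs.no_edge k (hKX hk) y hy hky
    · push Not at hx
      exact Or.inl ⟨fun x hxK => (mem_union.1 (hC.1 hxK)).resolve_right (hx x hxK), hC.2.1,
        fun p hp q hq hpq => hC.2.2 p hp q (mem_union_left _ hq) hpq⟩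
  refine ⟨?_, ?_, fun K hC => ?_, fun K hC => ?_, fun K hC => ?_, fun K hC => ?_, fun K hC => ?_⟩
  · exact fun h' => (mem_union.1 h').elim h.left fun h' => h1 h' hu
  · exact fun h' => (mem_union.1 h').elim h.right fun h' => h1 h' hv
  all_goals rcases key K hC with hC' | ⟨hKX, hKS⟩
  · exact h.card K hC'
  · rw [hKS, hs.card]
  · exact h.mem_left K hC'
  · rwa [hKS]
  · exact h.mem_right K hC'
  · rwa [hKS]
  · exact h.rest K hC'
  · obtain ⟨y, hy⟩ := hs.right
    exact ⟨y, fun hyK => h3 (hKX hyK) hy, fun hyN => h2 hy (hKS ▸ hyN)⟩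
  · exact h.not_K42 K hC'
  · rw [hKS]
    exact fun hK' => hK (hK'.mono (union_subset_union_left hKX) subset_rfl)

/-- The graph obtained by contracting `uv` onto `v` and replacing each component of `G[W]` by a
clique on its neighbours. -/
def quo (G : SimpleGraph V) (u v : V) (W : Finset V) : SimpleGraph V where
  Adj a b := a ≠ b ∧ (Touch G (edgeBag u v a) (edgeBag u v b) ∨
    ∃ K, Comp G W K ∧ Touch G K (edgeBag u v a) ∧ Touch G K (edgeBag u v b))
  symm := ⟨fun _ _ h => ⟨h.1.symm, h.2.imp (fun h => h.symm)
    fun ⟨K, h1, h2, h3⟩ => ⟨K, h1, h3, h2⟩⟩⟩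
  loopless := ⟨fun _ h => h.1 rfl⟩

lemma Good.fc (hG : Crit G) {u v : V} (huv : G.Adj u v) {W : Finset V} (h : Good G u v W)
    (hmax : ∀ W', Good G u v W' → W ⊆ W' → W' = W) (h5 : 5 ≤ #(univ \ insert u W)) :
    FC (quo G u v W) (univ \ insert u W) := by
  refine ⟨h5, fun P Q hP hQ hPn hQn hd hno => ?_⟩
  let β := edgeBag u v
  have hβ : ∀ x, x ∈ β x := mem_edgeBag u v
  have hβ' : ∀ a x, x ∈ β a → x = a ∨ (a = v ∧ x = u) := by
    intro a x hx
    simp only [β, edgeBag] at hx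
    split_ifs at hx with hav
    · rcases mem_insert.1 hx with h | h
      · exact Or.inr ⟨hav, h⟩
      · exact Or.inl ((mem_singleton.1 h).trans hav.symm)
    · exact Or.inl (mem_singleton.1 hx)
  let X := P.biUnion β ∪ W.filter fun w => ∃ K, Comp G W K ∧ w ∈ K ∧ ∃ p ∈ P, Touch G K (β p)
  let Y := Q.biUnion β ∪ W.filter fun w => ¬ ∃ K, Comp G W K ∧ w ∈ K ∧ ∃ p ∈ P, Touch G K (β p)
  have hPX : P ⊆ X := fun x hx => mem_union_left _ (mem_biUnion.2 ⟨x, hx, hβ x⟩)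
  have hQY : Q ⊆ Y := fun x hx => mem_union_left _ (mem_biUnion.2 ⟨x, hx, hβ x⟩)
  have hPW : ∀ p ∈ P, p ∉ W ∧ p ≠ u := by
    intro p hp
    have := hP hp
    simp only [mem_sdiff, mem_insert, not_or] at this
    exact ⟨this.2.2, this.2.1⟩
  have hQW : ∀ p ∈ Q, p ∉ W ∧ p ≠ u := by
    intro p hp
    have := hQ hp
    simp only [mem_sdiff, mem_insert, not_or] at this
    exact ⟨this.2.2, this.2.1⟩
  have hbW : ∀ a, a ∉ W → ∀ x ∈ β a, x ∉ W := by
    intro a ha x hx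
    rcases hβ' a x hx with rfl | ⟨-, rfl⟩
    · exact ha
    · exact h.left
  rw [Finset.disjoint_left] at hd
  have hXY : Disjoint X Y := by
    rw [Finset.disjoint_left]
    intro x hx hy
    rcases mem_union.1 hx with hx | hx <;> rcases mem_union.1 hy with hy | hy
    · obtain ⟨p, hp, hxp⟩ := mem_biUnion.1 hx
      obtain ⟨q, hq, hxq⟩ := mem_biUnion.1 hy
      have := hPW p hp
      have := hQW q hq
      rcases hβ' p x hxp with rfl | ⟨rfl, rfl⟩ <;> rcases hβ' q _ hxq with e | ⟨e, e'⟩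
      · exact hd hp (e ▸ hq)
      · exact (hPW _ hp).2 e'
      · exact (hQW q hq).2 e.symm
      · exact hd hp (e ▸ hq)
    · obtain ⟨p, hp, hxp⟩ := mem_biUnion.1 hx
      exact hbW p (hPW p hp).1 x hxp (mem_filter.1 hy).1
    · obtain ⟨p, hp, hxp⟩ := mem_biUnion.1 hy
      exact hbW p (hQW p hp).1 x hxp (mem_filter.1 hx).1
    · exact (mem_filter.1 hy).2 (mem_filter.1 hx).2
  have hne : ∀ a ∈ X, ∀ b ∈ Y, ¬ G.Adj a b := by
    intro x hx y hy hxy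
    rcases mem_union.1 hx with hx | hx <;> rcases mem_union.1 hy with hy | hy
    · obtain ⟨p, hp, hxp⟩ := mem_biUnion.1 hx
      obtain ⟨q, hq, hxq⟩ := mem_biUnion.1 hy
      exact hno p hp q hq ⟨fun e => hd hp (e ▸ hq), Or.inl ⟨x, hxp, y, hxq, hxy⟩⟩
    · obtain ⟨p, hp, hxp⟩ := mem_biUnion.1 hx
      obtain ⟨hyW, hn⟩ := mem_filter.1 hy
      obtain ⟨K, hKW, hyK, hK⟩ := exists_comp G hyW
      exact hn ⟨K, ⟨hKW, hK⟩, hyK, p, hp, y, hyK, x, hxp, hxy.symm⟩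
    · obtain ⟨q, hq, hxq⟩ := mem_biUnion.1 hy
      obtain ⟨hxW, K, hK, hxK, p, hp, ht⟩ := mem_filter.1 hx
      exact hno p hp q hq ⟨fun e => hd hp (e ▸ hq), Or.inr ⟨K, hK, ht, x, hxK, y, hxq, hxy⟩⟩
    · obtain ⟨hxW, K, hK, hxK, ht⟩ := mem_filter.1 hx
      obtain ⟨hyW, hn⟩ := mem_filter.1 hy
      exact hn ⟨K, hK, hK.2.2 x hxK y hyW hxy, ht⟩
  have h4 := hG.fc.2 X Y (subset_univ _) (subset_univ _) (hPn.mono hPX) (hQn.mono hQY) hXY hne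
  have hWXY : ∀ w ∈ W, w ∈ X ∨ w ∈ Y := by
    intro w hw
    by_cases hw' : ∃ K, Comp G W K ∧ w ∈ K ∧ ∃ p ∈ P, Touch G K (β p)
    · exact Or.inl (mem_union_right _ (mem_filter.2 ⟨hw, hw'⟩))
    · exact Or.inr (mem_union_right _ (mem_filter.2 ⟨hw, hw'⟩))
  set C := (univ \ insert u W) \ (P ∪ Q) with hC
  have hsub : univ \ (X ∪ Y) ⊆ insert u C := by
    intro x hx
    simp only [mem_sdiff, mem_union, mem_univ, true_and, not_or] at hx
    by_cases hxu : x = u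
    · simp [hxu]
    · have h1 : x ∉ P := fun h => hx.1 (hPX h)
      have h2 : x ∉ Q := fun h => hx.2 (hQY h)
      have h3 : x ∉ W := fun h => (hWXY x h).elim hx.1 hx.2
      simp [hC, h1, h2, h3, hxu]
  have hvW := h.right
  have huβ : u ∈ β v := by simp [β, edgeBag]
  by_cases huX : u ∈ X ∪ Y
  · refine h4.trans (card_le_card fun x hx => ?_)
    refine (mem_insert.1 (hsub hx)).resolve_left fun e => ?_
    rw [e] at hx
    exact (mem_sdiff.1 hx).2 huX
  · have huC : u ∉ C := by simp [hC]
    have hvX : v ∉ P ∧ v ∉ Q := by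
      constructor
      · exact fun hv => huX (mem_union_left _ (mem_union_left _ (mem_biUnion.2 ⟨v, hv, huβ⟩)))
      · exact fun hv => huX (mem_union_right _ (mem_union_left _ (mem_biUnion.2 ⟨v, hv, huβ⟩)))
    have hvC : v ∈ C := by simp [hC, hvX.1, hvX.2, hvW, huv.ne']
    by_contra hlt
    have hSc : #(insert u C) = #C + 1 := card_insert_of_notMem huC
    have hSeq : univ \ (X ∪ Y) = insert u C := eq_of_subset_of_card_le hsub (by omega)
    have hs : Sep4 G X (univ \ (X ∪ Y)) Y := by
      refine ⟨hPn.mono hPX, hQn.mono hQY, ?_, ?_, ?_, hXY, fun x => ?_, hne⟩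
      · rw [hSeq] at h4 ⊢
        omega
      · rw [Finset.disjoint_left]
        intro x hx hx'
        exact (mem_sdiff.1 hx').2 (mem_union_left _ hx)
      · rw [Finset.disjoint_left]
        intro x hx hx'
        exact (mem_sdiff.1 hx').2 (mem_union_right _ hx)
      · simp only [mem_sdiff, mem_union, mem_univ, true_and]
        tauto
    have huS : u ∈ univ \ (X ∪ Y) := by simp [hSeq]
    have hvS : v ∈ univ \ (X ∪ Y) := by simp [hSeq, hvC]
    have hsmall : ∀ X' Y', Sep4 G X' (univ \ (X ∪ Y)) Y' → (∀ w ∈ W, w ∈ X' ∨ w ∈ Y') →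
        (∃ x ∈ X', x ∉ W) → K42 G (X' ∪ (univ \ (X ∪ Y))) (univ \ (X ∪ Y)) := by
      intro X' Y' hs' hW' ⟨x, hx, hxW⟩
      by_contra hK
      have := hmax _ (h.enlarge hG.fc hs' huS hvS hK hW') subset_union_left
      exact hxW (this ▸ mem_union_right _ hx)
    obtain ⟨p, hp⟩ := hPn
    obtain ⟨q, hq⟩ := hQn
    exact hs.not_both hG huS hvS huv (hsmall X Y hs hWXY ⟨p, hPX hp, (hPW p hp).1⟩)
      (hsmall Y X hs.symm (fun w hw => (hWXY w hw).symm) ⟨q, hQY hq, (hQW q hq).1⟩)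

end

section

open scoped Classical
variable {V : Type} [Fintype V] {G : SimpleGraph V}

lemma le_quo (u v : V) (W : Finset V) : G ≤ quo G u v W := fun a b hab =>
  ⟨hab.ne, Or.inl ⟨a, mem_edgeBag u v a, b, mem_edgeBag u v b, hab⟩⟩

lemma quo_adj_right {u v : V} (W : Finset V) {a : V} (h : G.Adj a u) (ha : a ≠ v) :
    (quo G u v W).Adj a v :=
  ⟨ha, Or.inl ⟨a, mem_edgeBag u v a, u, by simp [edgeBag], h⟩⟩

lemma Comp.eq_or {W K L : Finset V} (hK : Comp G W K) (hL : Comp G W L) :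
    L = K ∨ Comp G (W \ K) L := by
  by_cases h : ∃ x ∈ L, x ∈ K
  · obtain ⟨x, hx, hx'⟩ := h
    exact Or.inl ((hL.2.1.subset_of_closed hL.1 hK.2.2 hx hx').antisymm
      (hK.2.1.subset_of_closed hK.1 hL.2.2 hx' hx))
  · push Not at h
    exact Or.inr ⟨fun x hx => mem_sdiff.2 ⟨hL.1 hx, h x hx⟩, hL.2.1,
      fun x hx y hy => hL.2.2 x hx y (mem_sdiff.1 hy).1⟩

/-- If every set `{a} ∪ D a` is connected and those of `u`, `v`, and the neighbours of `K` touch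
each other, then the clique on the neighbours of `K` is obtained by contraction. -/
lemma quo_model_step {u v : V} {W K : Finset V} (hK : Comp G W K) (huW : u ∉ W)
    {D : V → Finset V} (hDK : ∀ a, D a ⊆ K) (hDd : ∀ a b, a ≠ b → Disjoint (D a) (D b))
    (hD : ∀ a, Conn (quo G u v (W \ K)) (insert a (D a)))
    (hDt : ∀ a ∈ (nb G K).erase u ∪ {v}, ∀ b ∈ (nb G K).erase u ∪ {v}, a ≠ b →
      Touch (quo G u v (W \ K)) (insert a (D a)) (insert b (D b))) :
    Model (quo G u v W) (univ \ insert u W) (quo G u v (W \ K)) (univ \ insert u (W \ K))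
      fun a => insert a (D a) := by
  have hU : ∀ a ∈ univ \ insert u W, a ≠ u ∧ a ∉ W := fun a ha => by simpa using ha
  have hT : ∀ a ∈ univ \ insert u W, Touch G K (edgeBag u v a) → a ∈ (nb G K).erase u ∪ {v} := by
    rintro a ha ⟨k, hk, x, hx, hkx⟩
    by_cases hav : a = v
    · simp [hav]
    · simp only [edgeBag, hav, if_false, mem_singleton] at hx
      subst hx
      exact mem_union_left _ (mem_erase.2 ⟨(hU _ ha).1, mem_nb.2
        ⟨fun h => (hU _ ha).2 (hK.1 h), k, hk, hkx⟩⟩)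
  refine ⟨fun a _ => hD a, fun a ha => ?_, fun a ha b hb hab => ?_, fun a ha b hb hab => ?_⟩
  · have := hU a ha
    refine insert_subset (by simp [this]) ((hDK a).trans fun x hx => ?_)
    have : x ≠ u := by
      rintro rfl
      exact huW (hK.1 hx)
    simp [this, hx]
  · have hxK : ∀ a ∈ univ \ insert u W, ∀ b, a ∉ D b := fun a ha b h =>
      (hU a ha).2 (hK.1 (hDK b h))
    rw [disjoint_insert_left, disjoint_insert_right, mem_insert, not_or]
    exact ⟨⟨hab, hxK a ha b⟩, hxK b hb a, hDd a b hab⟩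
  · obtain ⟨hne, h⟩ := hab
    have h1 : (quo G u v (W \ K)).Adj a b →
        Touch (quo G u v (W \ K)) (insert a (D a)) (insert b (D b)) := fun h =>
      ⟨a, mem_insert_self _ _, b, mem_insert_self _ _, h⟩
    rcases h with h | ⟨L, hL, ha', hb'⟩
    · exact h1 ⟨hne, Or.inl h⟩
    · rcases hK.eq_or hL with rfl | hL'
      · exact hDt a (hT a ha ha') b (hT b hb hb') hne
      · exact h1 ⟨hne, Or.inr ⟨L, hL', ha', hb'⟩⟩

lemma Good.split (hG : FC G univ) {u v : V} {W K : Finset V} (h : Good G u v W)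
    (hK : Comp G W K) {c c' : V} (hc : c ≠ c') (hN : nb G K = {u, v, c, c'}) (hcu : c ≠ u)
    (hcv : c ≠ v) (hcu' : c' ≠ u) (hcv' : c' ≠ v) (h2 : 2 ≤ #K) :
    ∃ D₁ D₂, D₁ ⊆ K ∧ D₂ ⊆ K ∧ Disjoint D₁ D₂ ∧ Conn G (insert c D₁) ∧ Conn G (insert c' D₂) ∧
      (∃ z ∈ D₁, G.Adj z u ∨ G.Adj z v) ∧ (∃ z ∈ D₂, G.Adj z u ∨ G.Adj z v) ∧
      Touch G (insert c D₁) (insert c' D₂) := by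
  obtain ⟨y, hyK, hyN⟩ := h.rest K hK
  have hout : ∀ k ∈ K, ∀ x, x ∉ K → G.Adj k x → x = u ∨ x = v ∨ x = c ∨ x = c' := by
    intro k hk x hx hkx
    have : x ∈ nb G K := mem_nb.2 ⟨hx, k, hk, hkx⟩
    rw [hN] at this
    simpa using this
  have hNK : ∀ x ∈ ({u, v, c, c'} : Finset V), x ∉ K := fun x hx => by
    rw [← hN] at hx
    exact (mem_nb.1 hx).1
  have huK := hNK u (by simp)
  have hvK := hNK v (by simp)
  have hcK := hNK c (by simp)
  have hcK' := hNK c' (by simp)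
  rw [hN] at hyN
  simp only [mem_insert, mem_singleton, not_or] at hyN
  obtain ⟨T, hT, hTc, P, hP, hPd⟩ := menger _ G (K ∪ {c, c'}) {x ∈ K | G.Adj x u ∨ G.Adj x v}
    {c, c'} 2 rfl (fun x hx => mem_union_left _ (mem_filter.1 hx).1) subset_union_right (by
      intro A B hAB hZ hX
      by_contra hlt
      have hcB : c ∈ B := hX (by simp)
      have hcB' : c' ∈ B := hX (by simp)
      have hin : ∀ x ∈ K, x ∈ A ∨ x ∈ B := fun x hx =>
        mem_union.1 (hAB.1 ▸ mem_union_left _ hx)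
      have hZ' : ∀ x ∈ K, G.Adj x u ∨ G.Adj x v → x ∈ A := fun x hx h =>
        hZ (mem_filter.2 ⟨hx, h⟩)
      have hyAB : y ∉ A ∩ B := by
        intro hy
        have := hAB.sub_left (mem_inter.1 hy).1
        simp only [mem_union, mem_insert, mem_singleton] at this
        tauto
      have hBA : ∀ x ∈ K, x ∈ A := by
        intro x hx
        by_contra hxA
        have h4 := hG.le_nb (K := {x ∈ K | x ∉ A}) (S := A ∩ B ∪ {c, c'})
          ⟨x, mem_filter.2 ⟨hx, hxA⟩⟩ (y := y) (fun h => hyK (mem_filter.1 h).1) (by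
            simp only [mem_union, mem_insert, mem_singleton]
            tauto) (by
            intro k hk z hz hkz
            obtain ⟨hkK, hkA⟩ := mem_filter.1 hk
            simp only [mem_union, mem_insert, mem_singleton, mem_inter]
            by_cases hzK : z ∈ K
            · have hzA : z ∈ A := by
                by_contra hzA
                exact hz (mem_filter.2 ⟨hzK, hzA⟩)
              left
              refine ⟨hzA, ?_⟩
              by_contra hzB
              exact hAB.2 z (mem_sdiff.2 ⟨hzA, hzB⟩) k
                (mem_sdiff.2 ⟨(hin k hkK).resolve_left hkA, hkA⟩) hkz.symm
            · rcases hout k hkK z hzK hkz with rfl | rfl | rfl | rfl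
              · exact absurd (hZ' k hkK (Or.inl hkz)) hkA
              · exact absurd (hZ' k hkK (Or.inr hkz)) hkA
              · simp
              · simp)
        have := card_union_le (A ∩ B) {c, c'}
        have := card_le_two (a := c) (b := c')
        omega
      have hAB' : ∀ x ∈ K, x ∈ B := by
        intro x hx
        by_contra hxB
        have h4 := hG.le_nb (K := {x ∈ K | x ∉ B}) (S := A ∩ B ∪ {u, v})
          ⟨x, mem_filter.2 ⟨hx, hxB⟩⟩ (y := y) (fun h => hyK (mem_filter.1 h).1) (by
            simp only [mem_union, mem_insert, mem_singleton]
            tauto) (by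
            intro k hk z hz hkz
            obtain ⟨hkK, hkB⟩ := mem_filter.1 hk
            have key : z ∈ B → z ∈ A := fun hzB => by
              by_contra hzA
              exact hAB.2 k (mem_sdiff.2 ⟨hBA k hkK, hkB⟩) z (mem_sdiff.2 ⟨hzB, hzA⟩) hkz
            simp only [mem_union, mem_insert, mem_singleton, mem_inter]
            by_cases hzK : z ∈ K
            · have hzB : z ∈ B := by
                by_contra hzB
                exact hz (mem_filter.2 ⟨hzK, hzB⟩)
              exact Or.inl ⟨key hzB, hzB⟩
            · rcases hout k hkK z hzK hkz with rfl | rfl | rfl | rfl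
              · simp
              · simp
              · exact Or.inl ⟨key hcB, hcB⟩
              · exact Or.inl ⟨key hcB', hcB'⟩)
        have := card_union_le (A ∩ B) {u, v}
        have := card_le_two (a := u) (b := v)
        omega
      have : K ⊆ A ∩ B := fun x hx => mem_inter.2 ⟨hBA x hx, hAB' x hx⟩
      have := card_le_card this
      omega)
  have hTe : T = {c, c'} := eq_of_subset_of_card_le hT (by rw [hTc]; exact card_le_two)
  subst hTe
  obtain ⟨hcP, hPc, hPU, z, hz⟩ := hP c (by simp)
  obtain ⟨hcP', hPc', hPU', z', hz'⟩ := hP c' (by simp)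
  have hd := hPd c (by simp) c' (by simp) hc
  rw [Finset.disjoint_left] at hd
  simp only [mem_inter, mem_filter] at hz hz'
  have hPK : ∀ x ∈ P c, x ≠ c → x ∈ K := by
    intro x hx hxc
    have := hPU hx
    simp only [mem_union, mem_insert, mem_singleton] at this
    have : x ≠ c' := by
      rintro rfl
      exact hd hx hcP'
    tauto
  obtain ⟨L, hL, hcL, hLc, hLcl⟩ := exists_comp G (W := insert c' K \ P c) (a := c')
    (mem_sdiff.2 ⟨mem_insert_self _ _, fun h => hd h hcP'⟩)
  have hPL : P c' ⊆ L := by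
    refine hPc'.subset_of_closed (W := insert c' K \ P c) (fun x hx => ?_) hLcl hcP' hcL
    refine mem_sdiff.2 ⟨?_, fun h => hd h hx⟩
    have := hPU' hx
    simp only [mem_union, mem_insert, mem_singleton] at this
    have : x ≠ c := by
      rintro rfl
      exact hd hcP hx
    rw [mem_insert]
    tauto
  have hLP : ∀ x ∈ L, x ∉ P c := fun x hx => (mem_sdiff.1 (hL hx)).2
  have e1 : insert c ((P c).erase c) = P c := insert_erase hcP
  have e2 : insert c' (L.erase c') = L := insert_erase hcL
  refine ⟨(P c).erase c, L.erase c', fun x hx => ?_, fun x hx => ?_, ?_, by rw [e1]; exact hPc,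
    by rw [e2]; exact hLc,
    ⟨z, mem_erase.2 ⟨?_, hz.1⟩, hz.2.2⟩, ⟨z', mem_erase.2 ⟨?_, hPL hz'.1⟩, hz'.2.2⟩, ?_⟩
  · exact hPK x (mem_erase.1 hx).2 (mem_erase.1 hx).1
  · exact (mem_insert.1 (mem_sdiff.1 (hL (mem_erase.1 hx).2)).1).resolve_left (mem_erase.1 hx).1
  · rw [Finset.disjoint_left]
    exact fun x hx hx' => hLP x (mem_erase.1 hx').2 (mem_erase.1 hx).2
  · rintro rfl
    exact hcK hz.2.1
  · rintro rfl
    exact hcK' hz'.2.1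
  · rw [e1, e2]
    obtain ⟨a, ha, b, hb, hab⟩ := hK.2.1.2 (K ∩ L) inter_subset_left
      ⟨z', mem_inter.2 ⟨hz'.2.1, hPL hz'.1⟩⟩
      ⟨z, mem_sdiff.2 ⟨hz.2.1, fun h => hLP z (mem_inter.1 h).2 hz.1⟩⟩
    rw [mem_inter] at ha
    simp only [mem_sdiff, mem_inter, not_and] at hb
    refine ⟨b, ?_, a, ha.2, hab.symm⟩
    by_contra hbP
    exact hb.2 hb.1 (hLcl a ha.2 b (mem_sdiff.2 ⟨mem_insert_of_mem hb.1, hbP⟩) hab)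

end

section

open scoped Classical
variable {V : Type} [Fintype V] {G : SimpleGraph V}

lemma quo_empty_model {u v : V} (huv : G.Adj u v) :
    Model (quo G u v ∅) (univ \ insert u ∅) G univ (edgeBag u v) := by
  have h := contr_model (H := G) (X := univ \ insert u ∅) (Y := univ) huv (subset_univ _)
    (by simp) (by simp)
  refine ⟨h.conn, h.sub, h.disj, fun a ha b hb hab => h.touch a ha b hb ⟨hab.1, ?_⟩⟩
  refine hab.2.resolve_right ?_
  rintro ⟨K, hK, -⟩
  exact hK.2.1.1.ne_empty (subset_empty.1 hK.1)

lemma Good.model (hG : FC G univ) {u v : V} (huv : G.Adj u v)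
    (hreal : ∀ y c, G.Adj y u → G.Adj y v → G.Adj y c → ∃ x, G.Adj x y ∧ G.Adj x c)
    {W : Finset V} (h : Good G u v W) :
    ∃ β, Model (quo G u v W) (univ \ insert u W) G univ β := by
  induction hn : #W using Nat.strong_induction_on generalizing W with
  | _ n ih =>
  subst hn
  obtain rfl | ⟨a, ha⟩ := W.eq_empty_or_nonempty
  · exact ⟨_, quo_empty_model huv⟩
  obtain ⟨K, hKW, haK, hK⟩ := exists_comp G ha
  have hC : Comp G W K := ⟨hKW, hK⟩
  have hcard := card_sdiff_add_card_eq_card hKW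
  have hpos := card_pos.2 ⟨a, haK⟩
  obtain ⟨β, hβ⟩ := ih #(W \ K) (by omega) (h.sdiff hC) rfl
  suffices ∃ γ, Model (quo G u v W) (univ \ insert u W) (quo G u v (W \ K))
      (univ \ insert u (W \ K)) γ by
    obtain ⟨γ, hγ⟩ := this
    exact ⟨_, hβ.comp hγ⟩
  have hu := h.mem_left K hC
  have hv := h.mem_right K hC
  have hT : (nb G K).erase u ∪ {v} = (nb G K).erase u :=
    union_eq_left.2 (by simpa [huv.ne'] using hv)
  have hTK : ∀ t ∈ (nb G K).erase u ∪ {v}, ∃ k ∈ K, (quo G u v (W \ K)).Adj k t := by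
    intro t ht
    rw [hT] at ht
    obtain ⟨-, k, hk, hkt⟩ := mem_nb.1 (mem_erase.1 ht).2
    exact ⟨k, hk, le_quo u v _ hkt⟩
  have hle := le_quo (G := G) u v (W \ K)
  by_cases hA : ∃ t ∈ (nb G K).erase u ∪ {v}, ∀ a ∈ (nb G K).erase u ∪ {v},
      ∀ b ∈ (nb G K).erase u ∪ {v}, a ≠ b → a ≠ t → b ≠ t → (quo G u v (W \ K)).Adj a b
  · obtain ⟨t, ht, hadj⟩ := hA
    refine ⟨_, quo_model_step hC h.left (D := fun a => if a = t then K else ∅) (fun a => ?_)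
      (fun a b hab => ?_) (fun a => ?_) fun a ha b hb hab => ?_⟩
    · split_ifs <;> simp
    · by_cases hat : a = t
      · have : b ≠ t := fun e => hab (hat.trans e.symm)
        simp [this]
      · simp [hat]
    · by_cases hat : a = t
      · simp only [hat, if_true]
        obtain ⟨k, hk, hkt⟩ := hTK t ht
        exact Conn.insert (hK.1.mono hle) hk hkt.symm
      · simp only [hat, if_false]
        exact conn_singleton _ _
    · by_cases hat : a = t
      · obtain ⟨k, hk, hkb⟩ := hTK b hb
        exact ⟨k, by simp [hat, hk], b, mem_insert_self _ _, hkb⟩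
      · by_cases hbt : b = t
        · obtain ⟨k, hk, hka⟩ := hTK a ha
          exact ⟨a, mem_insert_self _ _, k, by simp [hbt, hk], hka.symm⟩
        · exact ⟨a, mem_insert_self _ _, b, mem_insert_self _ _, hadj a ha b hb hab hat hbt⟩
  · push Not at hA
    have h2 : #(((nb G K).erase u).erase v) = 2 := by
      rw [card_erase_of_mem (mem_erase.2 ⟨huv.ne', hv⟩), card_erase_of_mem hu, h.card K hC]
    obtain ⟨c, c', hcc, hcc'⟩ := card_eq_two.1 h2
    have hmem : ∀ x, x ∈ nb G K ↔ x = u ∨ x = v ∨ x = c ∨ x = c' := by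
      intro x
      have : x ∈ ((nb G K).erase u).erase v ↔ x = c ∨ x = c' := by rw [hcc']; simp
      simp only [mem_erase] at this
      by_cases hxu : x = u
      · simp [hxu, hu]
      · by_cases hxv : x = v
        · simp [hxv, hv]
        · tauto
    have hN : nb G K = {u, v, c, c'} := by
      ext x
      simp [hmem]
    have hc : c ≠ v ∧ c ≠ u := by
      have : c ∈ ((nb G K).erase u).erase v := by simp [hcc']
      simp only [mem_erase] at this
      tauto
    have hc' : c' ≠ v ∧ c' ≠ u := by
      have : c' ∈ ((nb G K).erase u).erase v := by simp [hcc']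
      simp only [mem_erase] at this
      tauto
    have hT' : ∀ x, x ∈ (nb G K).erase u ∪ {v} ↔ x = v ∨ x = c ∨ x = c' := by
      intro x
      rw [hT, mem_erase, hmem]
      constructor
      · tauto
      · rintro (rfl | rfl | rfl)
        · exact ⟨huv.ne', by simp⟩
        · exact ⟨hc.2, by simp⟩
        · exact ⟨hc'.2, by simp⟩
    have hnon : ∀ t a b, t ∈ ({v, c, c'} : Finset V) → a ∈ ({v, c, c'} : Finset V) →
        b ∈ ({v, c, c'} : Finset V) → a ≠ b → a ≠ t → b ≠ t →
        ¬ (quo G u v (W \ K)).Adj a b := by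
      intro t a b ht ha hb hab hat hbt hadj
      obtain ⟨a', ha', b', hb', h1, h2, h3, h4⟩ := hA t ((hT' t).2 (by simpa using ht))
      rw [hT'] at ha' hb'
      simp only [mem_insert, mem_singleton] at ht ha hb
      have : (a = a' ∧ b = b') ∨ (a = b' ∧ b = a') := by
        clear hA hTK hT' hmem
        grind
      rcases this with ⟨rfl, rfl⟩ | ⟨rfl, rfl⟩
      · exact h4 hadj
      · exact h4 hadj.symm
    have hnc : ¬ (quo G u v (W \ K)).Adj c c' :=
      hnon v c c' (by simp) (by simp) (by simp) hcc hc.1 hc'.1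
    have hncv : ¬ (quo G u v (W \ K)).Adj c v :=
      hnon c' c v (by simp) (by simp) (by simp) hc.1 hcc hc'.1.symm
    by_cases hK1 : #K ≤ 1
    · obtain ⟨y, rfl⟩ := card_eq_one.1 (le_antisymm hK1 hpos)
      have hy : ∀ x, x ∈ nb G {y} → G.Adj y x := fun x hx => by
        obtain ⟨-, k, hk, hkx⟩ := mem_nb.1 hx
        rwa [mem_singleton.1 hk] at hkx
      obtain ⟨x, hxy, hxc⟩ := hreal y c (hy u hu) (hy v hv) (hy c (by simp [hmem]))
      have hx : x ∈ nb G {y} := mem_nb.2 ⟨by simpa using hxy.ne, y, by simp, hxy.symm⟩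
      rcases (hmem x).1 hx with rfl | rfl | rfl | rfl
      · exact absurd (quo_adj_right _ hxc.symm hc.1) hncv
      · exact absurd (hle hxc.symm) hncv
      · exact absurd hxc (G.loopless.irrefl _)
      · exact absurd (hle hxc.symm) hnc
    · obtain ⟨D₁, D₂, hD₁, hD₂, hd, hc₁, hc₂, ⟨z₁, hz₁, hzv₁⟩, ⟨z₂, hz₂, hzv₂⟩, ht⟩ :=
        h.split hG hC hcc hN hc.2 hc.1 hc'.2 hc'.1 (by omega)
      have hvK : v ∉ K := (mem_nb.1 hv).1
      have hzv : ∀ z ∈ K, G.Adj z u ∨ G.Adj z v → (quo G u v (W \ K)).Adj z v := by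
        rintro z hz (h' | h')
        · exact quo_adj_right _ h' fun e => hvK (e ▸ hz)
        · exact hle h'
      let D : V → Finset V := fun a => if a = c then D₁ else if a = c' then D₂ else ∅
      have e1 : D c = D₁ := by simp [D]
      have e2 : D c' = D₂ := by simp [D, hcc.symm]
      have e3 : ∀ a, a ≠ c → a ≠ c' → D a = ∅ := fun a h1 h2 => by simp [D, h1, h2]
      have hcase : ∀ a, a = c ∨ a = c' ∨ (a ≠ c ∧ a ≠ c') := fun a => by tauto
      have ev := e3 v hc.1.symm hc'.1.symm
      have t1 : Touch (quo G u v (W \ K)) (insert v (D v)) (insert c (D c)) :=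
        ⟨v, mem_insert_self _ _, z₁, by simp [e1, hz₁], (hzv z₁ (hD₁ hz₁) hzv₁).symm⟩
      have t2 : Touch (quo G u v (W \ K)) (insert v (D v)) (insert c' (D c')) :=
        ⟨v, mem_insert_self _ _, z₂, by simp [e2, hz₂], (hzv z₂ (hD₂ hz₂) hzv₂).symm⟩
      have t3 : Touch (quo G u v (W \ K)) (insert c (D c)) (insert c' (D c')) := by
        rw [e1, e2]
        exact ht.mono hle subset_rfl subset_rfl
      refine ⟨_, quo_model_step hC h.left (D := D) (fun a => ?_)
        (fun a b hab => ?_) (fun a => ?_) fun a ha b hb hab => ?_⟩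
      · rcases hcase a with rfl | rfl | ⟨h1, h2⟩
        · rwa [e1]
        · rwa [e2]
        · simp [e3 a h1 h2]
      · rcases hcase a with rfl | rfl | ⟨h1, h2⟩
        · rcases hcase b with rfl | rfl | ⟨h3, h4⟩
          · exact absurd rfl hab
          · rwa [e1, e2]
          · simp [e3 b h3 h4]
        · rcases hcase b with rfl | rfl | ⟨h3, h4⟩
          · rw [e1, e2]
            exact hd.symm
          · exact absurd rfl hab
          · simp [e3 b h3 h4]
        · simp [e3 a h1 h2]
      · rcases hcase a with rfl | rfl | ⟨h1, h2⟩
        · rw [e1]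
          exact hc₁.mono hle
        · rw [e2]
          exact hc₂.mono hle
        · rw [e3 a h1 h2]
          exact conn_singleton _ _
      · rw [hT'] at ha hb
        rcases ha with rfl | rfl | rfl <;> rcases hb with rfl | rfl | rfl
        · exact absurd rfl hab
        · exact t1
        · exact t2
        · exact t1.symm
        · exact absurd rfl hab
        · exact t3
        · exact t2.symm
        · exact t3.symm
        · exact absurd rfl hab

end

section

open scoped Classical
variable {V : Type} [Fintype V] {G : SimpleGraph V}

lemma adj_of_eI_le {H H' : SimpleGraph V} {A : Finset V}
    (hle : ∀ a ∈ A, ∀ b ∈ A, H.Adj a b → H'.Adj a b) (h : eI H' A ≤ eI H A) {a b : V}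
    (ha : a ∈ A) (hb : b ∈ A) (hab : H'.Adj a b) : H.Adj a b := by
  have he : ({e ∈ A.sym2 | e ∈ H.edgeSet} : Finset (Sym2 V)) =
      {e ∈ A.sym2 | e ∈ H'.edgeSet} := by
    refine eq_of_subset_of_card_le (fun e => ?_) h
    simp only [mem_eI]
    induction e with
    | _ x y =>
      rintro ⟨h1, h2⟩
      exact ⟨h1, hle x (h1 x (by simp)) y (h1 y (by simp)) h2⟩
  have hm : s(a, b) ∈ ({e ∈ A.sym2 | e ∈ H'.edgeSet} : Finset (Sym2 V)) := by
    simp [mem_eI, ha, hb, hab]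
  rw [← he, mem_eI] at hm
  exact hm.2

lemma contr_le_quo (u v : V) (W : Finset V) : contr G (edgeBag u v) ≤ quo G u v W :=
  fun _ _ h => ⟨h.1, Or.inl h.2⟩

/-- Contracting an edge with few common neighbours can only lead to an octahedral graph. -/
lemma Crit.octa_of_few (hG : Crit G) {u v : V} (huv : G.Adj u v)
    (hreal : ∀ y c, G.Adj y u → G.Adj y v → G.Adj y c → ∃ x, G.Adj x y ∧ G.Adj x c)
    (hfew : 4 * #(univ : Finset V) + #{x | G.Adj u x ∧ G.Adj v x} ≤ eI G univ + 11) :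
    ∃ U : Finset V, u ∉ U ∧ v ∈ U ∧ IsOcta (contr G (edgeBag u v)) U ∧
      3 ≤ #{x ∈ U | G.Adj u x ∧ G.Adj v x} := by
  obtain ⟨W, hW, hWmax⟩ := exists_max_image (univ.filter fun W : Finset V => Good G u v W) card
    ⟨∅, by simpa using good_empty u v⟩
  simp only [mem_filter, mem_univ, true_and] at hW hWmax
  have hmax : ∀ W', Good G u v W' → W ⊆ W' → W' = W := fun W' h1 h2 =>
    (eq_of_subset_of_card_le h2 (hWmax W' h1)).symm
  obtain ⟨β, hβ⟩ := hW.model hG.fc huv hreal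
  set U := univ \ insert u W with hU
  have huU : u ∉ U := by simp [hU]
  have hvU : v ∈ U := by simp [hU, hW.right, huv.ne']
  have hins : insert u U = univ \ W := by
    ext x
    have := hW.left
    simp only [hU, mem_insert, mem_sdiff, mem_univ, true_and, not_or]
    constructor
    · rintro (rfl | h)
      · exact this
      · exact h.2
    · tauto
  have hc1 := card_insert_of_notMem huU
  have hc2 := card_sdiff_add_card_eq_card (subset_univ W)
  have hcon := eI_contr huv huU hvU
  have hcount := hW.count hG.fc
  have hed := hG.edges
  have hle : #{x ∈ U | G.Adj u x ∧ G.Adj v x} ≤ #{x | G.Adj u x ∧ G.Adj v x} :=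
    card_le_card (filter_subset_filter _ (subset_univ _))
  have hq : eI (contr G (edgeBag u v)) U ≤ eI (quo G u v W) U :=
    eI_mono_graph fun a _ b _ h => contr_le_quo u v W h
  rw [hins] at hcon hc1
  have h4 : 4 * #U ≤ eI (contr G (edgeBag u v)) U + 8 := by omega
  have h3 : 3 ≤ #U := by
    obtain rfl | ⟨a, ha⟩ := W.eq_empty_or_nonempty
    · have := hG.fc.1
      simp only [card_empty] at hc2
      omega
    · obtain ⟨K, hKW, haK, hK⟩ := exists_comp G ha
      have hC : Comp G W K := ⟨hKW, hK⟩
      have h5 : (nb G K).erase u ⊆ U := fun x hx => by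
        simp [hU, (mem_erase.1 hx).1, hC.nb_notMem (mem_erase.1 hx).2]
      have h6 := card_le_card h5
      rw [card_erase_of_mem (hW.mem_left K hC), hW.card K hC] at h6
      exact h6
  have h5 : 5 ≤ #U := by
    have := eI_le_choose (contr G (edgeBag u v)) U
    by_contra hlt
    have : #U = 3 ∨ #U = 4 := by omega
    rcases this with h | h <;> rw [h] at this h4 <;> omega
  have hoct := hG.min _ U β hβ (hW.fc hG huv hmax h5) (by omega) (by omega)
  have h24 := eI_of_isOcta hoct
  obtain ⟨h8, hanti⟩ := hoct
  refine ⟨U, huU, hvU, ⟨h8, fun a ha => ?_⟩, by omega⟩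
  obtain ⟨a', ha', hne, hadj⟩ := hanti a ha
  refine ⟨a', ha', hne, fun b hb => ?_⟩
  rw [← hadj b hb]
  exact ⟨fun h => contr_le_quo u v W h, fun h =>
    adj_of_eI_le (fun a _ b _ h => contr_le_quo u v W h) (by omega) ha hb h⟩

end

section

open scoped Classical
variable {V : Type} {G : SimpleGraph V}

/-- The set `O` induces an octahedron with antipodal pairs `b b'`, `c c'`, `d d'`. -/
structure Octahedron (G : SimpleGraph V) (O : Finset V) (b b' c c' d d' : V) : Prop where
  eq : O = {b, b', c, c', d, d'}
  ne_b : b ≠ b'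
  ne_c : c ≠ c'
  ne_d : d ≠ d'
  bc : G.Adj b c ∧ G.Adj b c' ∧ G.Adj b' c ∧ G.Adj b' c'
  bd : G.Adj b d ∧ G.Adj b d' ∧ G.Adj b' d ∧ G.Adj b' d'
  cd : G.Adj c d ∧ G.Adj c d' ∧ G.Adj c' d ∧ G.Adj c' d'
  not_b : ¬ G.Adj b b'
  not_c : ¬ G.Adj c c'
  not_d : ¬ G.Adj d d'

lemma Octahedron.swap_b {O : Finset V} {b b' c c' d d' : V}
    (h : Octahedron G O b b' c c' d d') : Octahedron G O b' b c c' d d' := by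
  obtain ⟨h0, h1, h2, h3, h4, h5, h6, h7, h8, h9⟩ := h
  exact ⟨by rw [h0, insert_comm], h1.symm, h2, h3, by tauto, by tauto, h6, fun h => h7 h.symm,
    h8, h9⟩

lemma Octahedron.rotate {O : Finset V} {b b' c c' d d' : V}
    (h : Octahedron G O b b' c c' d d') : Octahedron G O c c' d d' b b' := by
  obtain ⟨h0, h1, h2, h3, h4, h5, h6, h7, h8, h9⟩ := h
  have hs := fun a b => G.adj_comm a b
  refine ⟨?_, h2, h3, h1, h6, ?_, ?_, h8, h9, h7⟩
  · rw [h0]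
    ext x
    simp only [mem_insert, mem_singleton]
    tauto
  · rw [hs c, hs c, hs c', hs c']
    tauto
  · rw [hs d, hs d, hs d', hs d']
    tauto

lemma exists_octahedron {O : Finset V} (h6 : #O = 6)
    (hp : ∀ a ∈ O, ∃ a' ∈ O, a' ≠ a ∧ ∀ b ∈ O, G.Adj a b ↔ b ≠ a ∧ b ≠ a') {b b' : V} (hb : b ∈ O)
    (hb' : b' ∈ O) (hne : b' ≠ b) (hadj : ¬ G.Adj b b') :
    ∃ c c' d d', Octahedron G O b b' c c' d d' := by
  obtain ⟨b₂, hb₂, -, h1⟩ := hp b hb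
  obtain rfl : b' = b₂ := by
    by_contra h
    exact hadj ((h1 b' hb').2 ⟨hne, h⟩)
  have hlt : #({b, b'} : Finset V) < #O := by
    have := card_le_two (a := b) (b := b')
    omega
  obtain ⟨c, hc, hcn⟩ := exists_mem_notMem_of_card_lt_card hlt
  obtain ⟨c', hc', hcc, h2⟩ := hp c hc
  have hlt : #({b, b', c, c'} : Finset V) < #O := by
    have := card_le_four (a := b) (b := b') (c := c) (d := c')
    omega
  obtain ⟨d, hd, hdn⟩ := exists_mem_notMem_of_card_lt_card hlt
  obtain ⟨d', hd', hdd, h3⟩ := hp d hd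
  obtain ⟨b₃, hb₃, -, h4⟩ := hp b' hb'
  obtain ⟨c₃, hc₃, -, h5⟩ := hp c' hc'
  simp only [mem_insert, mem_singleton, not_or] at hcn hdn
  have hs : ∀ a b, G.Adj a b ↔ G.Adj b a := G.adj_comm
  obtain rfl : b = b₃ := by
    by_contra h
    exact hadj ((h4 b hb).2 ⟨hne.symm, h⟩).symm
  obtain rfl : c = c₃ := by
    by_contra h
    exact ((h2 c' hc').1 ((h5 c hc).2 ⟨hcc.symm, h⟩).symm).2 rfl
  have hcb : c' ≠ b := by
    rintro rfl
    exact ((h2 c' hc').1 ((h1 c hc).2 hcn).symm).2 rfl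
  have hcb' : c' ≠ b' := by
    rintro rfl
    exact ((h2 c' hc').1 ((h4 c hc).2 ⟨hcn.2, hcn.1⟩).symm).2 rfl
  have key : ∀ x ∈ O, G.Adj x d → d' ≠ x := by
    rintro x hx hxd rfl
    exact ((h3 d' hd').1 hxd.symm).2 rfl
  have hd1 : d' ≠ b := key b hb ((h1 d hd).2 ⟨hdn.1, hdn.2.1⟩)
  have hd2 : d' ≠ b' := key b' hb' ((h4 d hd).2 ⟨hdn.2.1, hdn.1⟩)
  have hd3 : d' ≠ c := key c hc ((h2 d hd).2 ⟨hdn.2.2.1, hdn.2.2.2⟩)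
  have hd4 : d' ≠ c' := key c' hc' ((h5 d hd).2 ⟨hdn.2.2.2, hdn.2.2.1⟩)
  refine ⟨c, c', d, d', (eq_of_subset_of_card_le ?_ ?_).symm, hne.symm, hcc.symm, hdd.symm,
    ?_, ?_, ?_, hadj, fun h => ((h2 c' hc').1 h).2 rfl, fun h => ((h3 d' hd').1 h).2 rfl⟩
  · simp [insert_subset_iff, *]
  · rw [h6]
    have : [b, b', c, c', d, d'].Nodup := by
      simp only [List.nodup_cons, List.mem_cons, List.not_mem_nil, or_false, not_or,
        List.nodup_nil, not_false_eq_true, and_true]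
      grind
    rw [← List.toFinset_card_of_nodup this |>.trans (by rfl : _ = 6)]
    apply card_le_card
    intro x
    simp
  · exact ⟨(h1 c hc).2 hcn, (h1 c' hc').2 ⟨hcb, hcb'⟩, (h4 c hc).2 ⟨hcn.2, hcn.1⟩,
      (h4 c' hc').2 ⟨hcb', hcb⟩⟩
  · exact ⟨(h1 d hd).2 ⟨hdn.1, hdn.2.1⟩, (h1 d' hd').2 ⟨hd1, hd2⟩,
      (h4 d hd).2 ⟨hdn.2.1, hdn.1⟩, (h4 d' hd').2 ⟨hd2, hd1⟩⟩
  · exact ⟨(h2 d hd).2 hdn.2.2, (h2 d' hd').2 ⟨hd3, hd4⟩,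
      (h5 d hd).2 ⟨hdn.2.2.2, hdn.2.2.1⟩, (h5 d' hd').2 ⟨hd4, hd3⟩⟩

variable [Fintype V]

lemma Crit.no_four (hG : Crit G) (B : Fin 4 → Finset V)
    {D C₀ C₁ : Finset V} (hB : ∀ z, Conn G (B z)) (hD : Conn G D) (h₀ : Conn G C₀)
    (h₁ : Conn G C₁) (hBd : ∀ z y, z < y → Disjoint (B z) (B y))
    (hDd : ∀ z, Disjoint D (B z)) (h₀d : ∀ z, Disjoint C₀ (B z))
    (h₁d : ∀ z, Disjoint C₁ (B z)) (hD₀ : Disjoint D C₀) (hD₁ : Disjoint D C₁)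
    (h₀₁ : Disjoint C₀ C₁) (hBt : ∀ z y, z < y → Touch G (B z) (B y))
    (hDt : ∀ z, Touch G D (B z)) (h₀t : ∀ z, Touch G C₀ (B z))
    (h₁t : ∀ z, Touch G C₁ (B z)) (h₀₁t : Touch G C₀ C₁) : False :=
  hG.no_bags (S := univ) (by simp) (fun z _ => hB z) hD h₀ h₁
    (fun z _ y _ h => (lt_or_gt_of_ne h).elim (hBd z y) fun h => (hBd y z h).symm)
    (fun z _ => hDd z) (fun z _ => h₀d z) (fun z _ => h₁d z) hD₀ hD₁ h₀₁
    (fun z _ y _ h => (lt_or_gt_of_ne h).elim (hBt z y) fun h => (hBt y z h).symm)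
    (fun z _ => hDt z) (fun z _ => h₀t z) (fun z _ => h₁t z) h₀₁t

lemma Octahedron.false_of_pair (hG : Crit G) {O : Finset V} {b b' c c' d d' u v w : V}
    (h : Octahedron G O b b' c c' d d') (hw : ∀ x ∈ O, G.Adj w x) (huv : G.Adj u v) (hu : u ∉ O)
    (hv : v ∉ O) (hwu : w ≠ u) (hwv : w ≠ v) (hvb : G.Adj v b) (hvb' : G.Adj v b')
    (huc : G.Adj u c') (hud : G.Adj u d') (hucd : G.Adj u c ∨ G.Adj u d) : False := by
  obtain ⟨rfl, n1, n2, n3, ⟨a1, a2, a3, a4⟩, ⟨a5, a6, a7, a8⟩, ⟨a9, a10, a11, a12⟩, -⟩ := h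
  simp only [mem_insert, mem_singleton, forall_eq_or_imp, forall_eq, not_or] at hw hu hv
  obtain ⟨w1, w2, w3, w4, w5, w6⟩ := hw
  obtain ⟨u1, u2, u3, u4, u5, u6⟩ := hu
  obtain ⟨v1, v2, v3, v4, v5, v6⟩ := hv
  have := huv.ne
  have := a1.ne; have := a2.ne; have := a3.ne; have := a4.ne; have := a5.ne; have := a6.ne
  have := a7.ne; have := a8.ne; have := a9.ne; have := a10.ne; have := a11.ne; have := a12.ne
  have := w1.ne; have := w2.ne; have := w3.ne; have := w4.ne; have := w5.ne; have := w6.ne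
  refine hG.no_four ![{v, b}, {c, d}, {c'}, {d'}] (D := {u}) (C₀ := {w}) (C₁ := {b'})
    ?_ (conn_singleton _ _) (conn_singleton _ _) (conn_singleton _ _) ?_ ?_ ?_ ?_ ?_ ?_ ?_
    ?_ ?_ ?_ ?_ ?_
  · simp [Fin.forall_fin_succ, conn_singleton, conn_pair, hvb, a9]
  all_goals try simp only [Fin.forall_fin_succ, Fin.isValue, Matrix.cons_val_zero,
    Matrix.cons_val_succ, IsEmpty.forall_iff, and_true, Matrix.cons_val_fin_one,
    Fin.succ_lt_succ_iff, Fin.succ_pos, Fin.not_lt_zero, lt_irrefl, forall_const, true_and]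
  all_goals simp only [Touch, mem_insert, mem_singleton, exists_eq_or_imp, exists_eq_left,
    disjoint_insert_left, disjoint_insert_right, disjoint_singleton_left,
    disjoint_singleton_right, not_or]
  all_goals grind [G.adj_comm]

lemma Octahedron.false_of_triangle (hG : Crit G) {O : Finset V} {b b' c c' d d' u v w : V}
    (h : Octahedron G O b b' c c' d d') (hw : ∀ x ∈ O, G.Adj w x) (huv : G.Adj u v) (hu : u ∉ O)
    (hv : v ∉ O) (hwu : w ≠ u) (hwv : w ≠ v) (hvb : G.Adj v b) (hvc : G.Adj v c)
    (hvd : G.Adj v d) (hO : ∀ x ∈ O, G.Adj u x) : False := by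
  obtain ⟨rfl, n1, n2, n3, ⟨a1, a2, a3, a4⟩, ⟨a5, a6, a7, a8⟩, ⟨a9, a10, a11, a12⟩, -⟩ := h
  simp only [mem_insert, mem_singleton, forall_eq_or_imp, forall_eq, not_or] at hw hu hv hO
  obtain ⟨w1, w2, w3, w4, w5, w6⟩ := hw
  obtain ⟨u1, u2, u3, u4, u5, u6⟩ := hu
  obtain ⟨v1, v2, v3, v4, v5, v6⟩ := hv
  have := huv.ne
  have := a1.ne; have := a2.ne; have := a3.ne; have := a4.ne; have := a5.ne; have := a6.ne
  have := a7.ne; have := a8.ne; have := a9.ne; have := a10.ne; have := a11.ne; have := a12.ne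
  have := w1.ne; have := w2.ne; have := w3.ne; have := w4.ne; have := w5.ne; have := w6.ne
  refine hG.no_four ![{u}, {b}, {d}, {c, d'}] (D := {v}) (C₀ := {w, b'}) (C₁ := {c'})
    ?_ (conn_singleton _ _) (conn_pair w2) (conn_singleton _ _) ?_ ?_ ?_ ?_ ?_ ?_ ?_
    ?_ ?_ ?_ ?_ ?_
  · simp [Fin.forall_fin_succ, conn_singleton, conn_pair, a10]
  all_goals try simp only [Fin.forall_fin_succ, Fin.isValue, Matrix.cons_val_zero,
    Matrix.cons_val_succ, IsEmpty.forall_iff, and_true, Matrix.cons_val_fin_one,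
    Fin.succ_lt_succ_iff, Fin.succ_pos, Fin.not_lt_zero, lt_irrefl, forall_const, true_and]
  all_goals simp only [Touch, mem_insert, mem_singleton, exists_eq_or_imp, exists_eq_left,
    disjoint_insert_left, disjoint_insert_right, disjoint_singleton_left,
    disjoint_singleton_right, not_or]
  all_goals grind [G.adj_comm]

lemma card_filter_insert_le {α : Type} (p : α → Prop) (a : α) (s : Finset α) :
    #{x ∈ insert a s | p x} ≤ (if p a then 1 else 0) + #{x ∈ s | p x} := by
  rw [filter_insert]
  split_ifs
  · have := card_insert_le a {x ∈ s | p x}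
    omega
  · simp

lemma ite_add_ite_le {p q : Prop} (h : ¬ (p ∧ q)) :
    (if p then 1 else 0) + (if q then 1 else 0) ≤ 1 := by
  split_ifs <;> simp_all

lemma or_of_ite_add_ite {p q : Prop} (h : 1 ≤ (if p then 1 else 0) + (if q then 1 else 0)) :
    p ∨ q := by
  split_ifs at h <;> simp_all

lemma Crit.false_of_octahedron (hG : Crit G) {O : Finset V} {u v w : V} (h6 : #O = 6)
    (hp : ∀ a ∈ O, ∃ a' ∈ O, a' ≠ a ∧ ∀ b ∈ O, G.Adj a b ↔ b ≠ a ∧ b ≠ a')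
    (hw : ∀ x ∈ O, G.Adj w x) (huv : G.Adj u v) (hu : u ∉ O) (hv : v ∉ O) (hwu : w ≠ u)
    (hwv : w ≠ v) (h : ∀ x ∈ O, G.Adj u x ∨ G.Adj v x)
    (h3 : 3 ≤ #{x ∈ O | G.Adj u x ∧ G.Adj v x})
    (hA : ∀ x ∈ O, ∀ y ∈ O, x ≠ y → G.Adj u x ∨ G.Adj u y) : False := by
  by_cases hpair : ∃ b ∈ O, ∃ b' ∈ O, b' ≠ b ∧ ¬ G.Adj b b' ∧ G.Adj v b ∧ G.Adj v b'
  · obtain ⟨b, hb, b', hb', hne, hn, hvb, hvb'⟩ := hpair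
    obtain ⟨c, c', d, d', hO⟩ := exists_octahedron h6 hp hb hb' hne hn
    wlog hc : G.Adj u c' generalizing c c'
    · exact this c' c hO.rotate.swap_b.rotate.rotate <| by
        have := hA c (by simp [hO.eq]) c' (by simp [hO.eq]) hO.ne_c
        tauto
    wlog hd : G.Adj u d' generalizing d d'
    · exact this d' d hO.rotate.rotate.swap_b.rotate <| by
        have := hA d (by simp [hO.eq]) d' (by simp [hO.eq]) hO.ne_d
        tauto
    exact hO.false_of_pair hG hw huv hu hv hwu hwv hvb hvb' hc hd
      (hA c (by simp [hO.eq]) d (by simp [hO.eq]) hO.cd.1.ne)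
  · obtain ⟨b, hb⟩ := card_pos.1 (by omega : 0 < #O)
    obtain ⟨b', hb', hne, hn⟩ := hp b hb
    obtain ⟨c, c', d, d', hO⟩ := exists_octahedron h6 hp hb hb' hne fun h => ((hn b' hb').1 h).2 rfl
    have hv2 : ∀ x ∈ O, ∀ y ∈ O, y ≠ x → ¬ G.Adj x y → ¬ (G.Adj v x ∧ G.Adj v y) :=
      fun x hx y hy hxy hn h => hpair ⟨x, hx, y, hy, hxy, hn, h.1, h.2⟩
    have m : b ∈ O ∧ b' ∈ O ∧ c ∈ O ∧ c' ∈ O ∧ d ∈ O ∧ d' ∈ O := by simp [hO.eq]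
    obtain ⟨m1, m2, m3, m4, m5, m6⟩ := m
    have n1 := hv2 b m1 b' m2 hO.ne_b.symm hO.not_b
    have n2 := hv2 c m3 c' m4 hO.ne_c.symm hO.not_c
    have n3 := hv2 d m5 d' m6 hO.ne_d.symm hO.not_d
    have k : (G.Adj u b ∧ G.Adj v b ∨ G.Adj u b' ∧ G.Adj v b') ∧
        (G.Adj u c ∧ G.Adj v c ∨ G.Adj u c' ∧ G.Adj v c') ∧
        (G.Adj u d ∧ G.Adj v d ∨ G.Adj u d' ∧ G.Adj v d') := by
      obtain ⟨p, hpx⟩ : ∃ p : V → Prop, ∀ x, p x ↔ G.Adj u x ∧ G.Adj v x := ⟨_, fun _ => Iff.rfl⟩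
      simp only [← hpx] at h3 ⊢
      have s1 := card_filter_insert_le p b {b', c, c', d, d'}
      have s2 := card_filter_insert_le p b' {c, c', d, d'}
      have s3 := card_filter_insert_le p c {c', d, d'}
      have s4 := card_filter_insert_le p c' {d, d'}
      have s5 := card_filter_insert_le p d {d'}
      have s6 := card_filter_insert_le p d' ∅
      rw [filter_empty, card_empty] at s6
      rw [hO.eq] at h3
      have e1 := ite_add_ite_le (p := p b) (q := p b') fun h =>
        n1 ⟨((hpx _).1 h.1).2, ((hpx _).1 h.2).2⟩
      have e2 := ite_add_ite_le (p := p c) (q := p c') fun h =>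
        n2 ⟨((hpx _).1 h.1).2, ((hpx _).1 h.2).2⟩
      have e3 := ite_add_ite_le (p := p d) (q := p d') fun h =>
        n3 ⟨((hpx _).1 h.1).2, ((hpx _).1 h.2).2⟩
      rw [← insert_empty_eq d'] at s5 s4 s3 s2 s1 h3
      refine ⟨or_of_ite_add_ite ?_,
        or_of_ite_add_ite ?_,
        or_of_ite_add_ite ?_⟩ <;> clear hp hw h hpair hv2 <;> omega
    have hu' : ∀ x ∈ O, G.Adj u x := by
      have aux : ∀ {p q p' q' : Prop}, p ∨ q → p' ∨ q' → ¬ (q ∧ q') → p ∧ q ∨ p' ∧ q' → p ∧ p' := by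
        tauto
      rw [hO.eq]
      simp only [mem_insert, mem_singleton, forall_eq_or_imp, forall_eq]
      have k1 := aux (h b m1) (h b' m2) n1 k.1
      have k2 := aux (h c m3) (h c' m4) n2 k.2.1
      have k3 := aux (h d m5) (h d' m6) n3 k.2.2
      exact ⟨k1.1, k1.2, k2.1, k2.2, k3.1, k3.2⟩
    have fin : ∀ b b' c c' d d', Octahedron G O b b' c c' d d' → G.Adj v b → G.Adj v c →
        G.Adj v d → False := fun b b' c c' d d' hO h1 h2 h3 =>
      hO.false_of_triangle hG hw huv hu hv hwu hwv h1 h2 h3 hu'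
    obtain ⟨⟨-, k1⟩ | ⟨-, k1⟩, ⟨-, k2⟩ | ⟨-, k2⟩, ⟨-, k3⟩ | ⟨-, k3⟩⟩ := k
    · exact fin _ _ _ _ _ _ hO k1 k2 k3
    · exact fin _ _ _ _ _ _ hO.rotate.rotate.swap_b k3 k1 k2
    · exact fin _ _ _ _ _ _ hO.rotate.swap_b k2 k3 k1
    · exact fin _ _ _ _ _ _ hO.rotate.swap_b.rotate.swap_b k3 k1 k2
    · exact fin _ _ _ _ _ _ hO.swap_b k1 k2 k3
    · exact fin _ _ _ _ _ _ hO.swap_b.rotate.rotate.swap_b k3 k1 k2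
    · exact fin _ _ _ _ _ _ hO.swap_b.rotate.swap_b k2 k3 k1
    · exact fin _ _ _ _ _ _ hO.swap_b.rotate.swap_b.rotate.swap_b k3 k1 k2

/-- An edge whose contraction gives the octahedral graph on eight vertices. -/
lemma Crit.not_octa (hG : Crit G) {u v : V} (huv : G.Adj u v) {U : Finset V} (hu : u ∉ U)
    (hv : v ∈ U) (hU : IsOcta (contr G (edgeBag u v)) U)
    (h3 : 3 ≤ #{x ∈ U | G.Adj u x ∧ G.Adj v x}) : False := by
  obtain ⟨w, hw, hwv, hvw⟩ := hU.2 v hv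
  have hadj : ∀ x ∈ U, x ≠ v → x ≠ w → G.Adj v x ∨ G.Adj u x := fun x hx h1 h2 =>
    (contr_adj_iff h1).1 ((hvw x hx).2 ⟨h1, h2⟩)
  have hvw' := mt (hvw w hw).1 (fun h => h.2 rfl)
  have hnw : ¬ G.Adj v w ∧ ¬ G.Adj u w := by
    rw [contr_adj_iff hwv] at hvw'
    tauto
  set O := (U.erase v).erase w with hO
  have hmem : ∀ x, x ∈ O ↔ x ∈ U ∧ x ≠ v ∧ x ≠ w := fun x => by
    simp only [hO, mem_erase]
    tauto
  have h6 : #O = 6 := by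
    rw [card_erase_of_mem (mem_erase.2 ⟨hwv, hw⟩), card_erase_of_mem hv, hU.1]
  have hne : ∀ x ∈ U, x ≠ u := fun x hx e => hu (e ▸ hx)
  have hwO : ∀ x ∈ O, G.Adj w x := by
    intro x hx
    obtain ⟨hxU, hxv, hxw⟩ := (hmem x).1 hx
    obtain ⟨w', hw', -, h1⟩ := hU.2 w hw
    rw [← contr_adj_iff_of_ne hwv hxv, h1 x hxU]
    refine ⟨hxw, fun e => ?_⟩
    subst e
    have := mt (h1 v hv).2 fun h => hvw' h.symm
    exact this ⟨hwv.symm, hxv.symm⟩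
  have hp : ∀ a ∈ O, ∃ a' ∈ O, a' ≠ a ∧ ∀ b ∈ O, G.Adj a b ↔ b ≠ a ∧ b ≠ a' := by
    intro a ha
    obtain ⟨haU, hav, haw⟩ := (hmem a).1 ha
    obtain ⟨a', ha', h1, h2⟩ := hU.2 a haU
    refine ⟨a', (hmem a').2 ⟨ha', ?_, ?_⟩, h1, fun b hb => ?_⟩
    · rintro rfl
      exact ((h2 a' ha').1 ((hvw a haU).2 ⟨hav, haw⟩).symm).2 rfl
    · rintro rfl
      exact ((h2 a' ha').1 ((contr_adj_iff_of_ne hav hwv).2 (hwO a ha).symm)).2 rfl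
    · rw [← contr_adj_iff_of_ne hav ((hmem b).1 hb).2.1]
      exact h2 b ((hmem b).1 hb).1
  have hor : ∀ x ∈ O, G.Adj u x ∨ G.Adj v x := fun x hx => by
    obtain ⟨h1, h2, h3⟩ := (hmem x).1 hx
    exact (hadj x h1 h2 h3).symm
  have h3' : 3 ≤ #{x ∈ O | G.Adj u x ∧ G.Adj v x} := by
    refine h3.trans (card_le_card fun x hx => ?_)
    obtain ⟨h1, h2, h4⟩ := mem_filter.1 hx
    refine mem_filter.2 ⟨(hmem x).2 ⟨h1, h4.ne', ?_⟩, h2, h4⟩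
    rintro rfl
    exact hnw.1 h4
  have huO : u ∉ O := fun h => hu ((hmem u).1 h).1
  have hvO : v ∉ O := fun h => ((hmem v).1 h).2.1 rfl
  by_cases hA : ∀ x ∈ O, ∀ y ∈ O, x ≠ y → G.Adj u x ∨ G.Adj u y
  · exact hG.false_of_octahedron h6 hp hwO huv huO hvO (hne w hw) hwv hor h3' hA
  by_cases hB : ∀ x ∈ O, ∀ y ∈ O, x ≠ y → G.Adj v x ∨ G.Adj v y
  · exact hG.false_of_octahedron h6 hp hwO huv.symm hvO huO hwv (hne w hw)
      (fun x hx => (hor x hx).symm) (by simpa only [and_comm] using h3') hB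
  push Not at hA hB
  obtain ⟨x, hx, y, hy, hxy, h1, h2⟩ := hA
  obtain ⟨x', hx', y', hy', hxy', h1', h2'⟩ := hB
  have hd : Disjoint ({x, y, x', y'} : Finset V) {x ∈ O | G.Adj u x ∧ G.Adj v x} := by
    rw [Finset.disjoint_left]
    intro z hz hz'
    obtain ⟨-, h4, h5⟩ := mem_filter.1 hz'
    simp only [mem_insert, mem_singleton] at hz
    rcases hz with rfl | rfl | rfl | rfl
    · exact h1 h4
    · exact h2 h4
    · exact h1' h5
    · exact h2' h5
  have hsub : ({x, y, x', y'} : Finset V) ∪ {x ∈ O | G.Adj u x ∧ G.Adj v x} ⊆ O :=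
    union_subset (insert_subset hx (insert_subset hy (insert_subset hx'
      (singleton_subset_iff.2 hy')))) (filter_subset _ _)
  have hc := card_le_card hsub
  rw [card_union_of_disjoint hd, h6] at hc
  have h4 : #({x, y, x', y'} : Finset V) = 4 := by
    have := hor x hx
    have := hor y hy
    have e1 : x ≠ x' := by
      rintro rfl
      tauto
    have e2 : x ≠ y' := by
      rintro rfl
      tauto
    have e3 : y ≠ x' := by
      rintro rfl
      tauto
    have e4 : y ≠ y' := by
      rintro rfl
      tauto
    rw [card_insert_of_notMem, card_insert_of_notMem, card_insert_of_notMem, card_singleton] <;>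
      simp [*]
  omega

end

section

/-- The entry of index `i` in the list of the six arguments. -/
def pick6 (i : Fin 6) (a b c d e f : Bool) : Bool :=
  match i.val with
  | 0 => a
  | 1 => b
  | 2 => c
  | 3 => d
  | 4 => e
  | _ => f

/-- The symmetric Boolean matrix with the given entries above the diagonal. -/
def symMat (x01 x02 x03 x04 x05 x12 x13 x14 x15 x23 x24 x25 x34 x35 x45 : Bool)
    (i j : Fin 6) : Bool :=
  pick6 i (pick6 j false x01 x02 x03 x04 x05) (pick6 j x01 false x12 x13 x14 x15)
    (pick6 j x02 x12 false x23 x24 x25) (pick6 j x03 x13 x23 false x34 x35)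
    (pick6 j x04 x14 x24 x34 false x45) (pick6 j x05 x15 x25 x35 x45 false)

/-- Bounded existential quantification, as a Boolean. -/
def any6 (p : Fin 6 → Bool) : Bool :=
  p ⟨0, by decide⟩ || (p ⟨1, by decide⟩ || (p ⟨2, by decide⟩ || (p ⟨3, by decide⟩ ||
    (p ⟨4, by decide⟩ || p ⟨5, by decide⟩))))

/-- Bounded universal quantification, as a Boolean. -/
def all6 (p : Fin 6 → Bool) : Bool :=
  p ⟨0, by decide⟩ && (p ⟨1, by decide⟩ && (p ⟨2, by decide⟩ && (p ⟨3, by decide⟩ &&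
    (p ⟨4, by decide⟩ && p ⟨5, by decide⟩))))

/-- Disequality of indices, as a Boolean. -/
def ne6 (i j : Fin 6) : Bool := !(Nat.beq i.val j.val)

/-- After contracting `{a, b}`, all missing edges are among `pq`, `pr`. -/
def pairStar (f : Fin 6 → Fin 6 → Bool) : Bool :=
  any6 fun a => any6 fun b => Nat.blt a.val b.val && (!f a b && (all6 fun p => !(f a p && f b p)) &&
    any6 fun p => ne6 p a && (ne6 p b && any6 fun s => ne6 s a && (ne6 s b && (ne6 s p && (!f p s &&
    any6 fun q => ne6 q a && (ne6 q b && (ne6 q p && (ne6 q s && (!f q s &&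
    any6 fun r => Nat.blt q.val r.val && (ne6 r a && (ne6 r b && (ne6 r p && (ne6 r s &&
      (!f q r && !f r s))))))))))))))

/-- The variant in which the edge `xy` may be added provided it avoids `m` and `m'`. -/
def pairEdge (f : Fin 6 → Fin 6 → Bool) (sat : Fin 6 → Bool) (m m' : Fin 6) : Bool :=
  any6 fun x => ne6 x m && (ne6 x m' && any6 fun y => ne6 y m && (ne6 y m' && (ne6 y x && (sat y &&
    any6 fun b => ne6 b x && (ne6 b y && (sat b &&
    any6 fun a => ne6 a x && (ne6 a y && (ne6 a b && (!f a b &&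
    ((all6 fun p => !(f a p && f b p)) &&
    any6 fun s => ne6 s x && (ne6 s y && (ne6 s a && (ne6 s b && (sat s && (!f y s &&
    any6 fun t => ne6 t x && (ne6 t y && (ne6 t a && (ne6 t b && (ne6 t s && (sat t && (!f y t &&
      !f x t)))))))))))))))))))))

/-- Row sums are at most two. -/
def le2 (a b c d e : Bool) : Bool := (a.toNat + b.toNat + c.toNat + d.toNat + e.toNat).ble 2

/-- The row sum of index `i` is exactly two. -/
def eq2 (f : Fin 6 → Fin 6 → Bool) (i : Fin 6) : Bool :=
  Nat.beq ((f i 0).toNat + (f i 1).toNat + (f i 2).toNat + (f i 3).toNat + (f i 4).toNat +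
    (f i 5).toNat) 2

/-- One of the two patterns occurs in `f`. -/
def hasPair (f : Fin 6 → Fin 6 → Bool) : Bool :=
  pairStar f || all6 fun m => all6 fun m' => pairEdge f (eq2 f) m m'

set_option maxRecDepth 100000 in
lemma symMat_pair : ∀ x01 x02 x03 x04 x05 : Bool, le2 x01 x02 x03 x04 x05 →
    ∀ x12 x13 x14 x15 : Bool, le2 x01 x12 x13 x14 x15 →
    ∀ x23 x24 x25 : Bool, le2 x02 x12 x23 x24 x25 →
    ∀ x34 x35 : Bool, le2 x03 x13 x23 x34 x35 →
    ∀ x45 : Bool, le2 x04 x14 x24 x34 x45 → le2 x05 x15 x25 x35 x45 →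
    hasPair (symMat x01 x02 x03 x04 x05 x12 x13 x14 x15 x23 x24 x25 x34 x35 x45) := by
  decide +kernel

end

section

lemma any6_iff (p : Fin 6 → Bool) : any6 p = true ↔ ∃ i, p i = true := by
  simp [any6, Fin.exists_fin_succ]

lemma all6_iff (p : Fin 6 → Bool) : all6 p = true ↔ ∀ i, p i = true := by
  simp [all6, Fin.forall_fin_succ]

lemma ne6_iff (i j : Fin 6) : ne6 i j = true ↔ i ≠ j := by
  rw [ne6, Bool.not_eq_true', ← Bool.not_eq_true, Nat.beq_eq, Ne, Fin.ext_iff]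

lemma pairStar_spec {f : Fin 6 → Fin 6 → Bool} (h : pairStar f = true) :
    ∃ a b p s q r : Fin 6, [a, b, p, s, q, r].Nodup ∧ f a b = false ∧
      (∀ i, f a i = false ∨ f b i = false) ∧ f p s = false ∧ f q s = false ∧ f q r = false ∧
      f r s = false := by
  simp only [pairStar, any6_iff, all6_iff, ne6_iff, Bool.and_eq_true, Bool.not_eq_true',
    Bool.and_eq_false_iff, Nat.blt_eq] at h
  obtain ⟨a, b, hab, ⟨h1, h2⟩, p, hpa, hpb, s, hsa, hsb, hsp, h3, q, hqa, hqb, hqp, hqs, h4, r,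
    hrq, hra, hrb, hrp, hrs, h5, h6⟩ := h
  refine ⟨a, b, p, s, q, r, ?_, h1, h2, h3, h4, h5, h6⟩
  have e1 : a ≠ b := (Fin.lt_def.2 hab).ne
  have e2 : q ≠ r := (Fin.lt_def.2 hrq).ne
  simp only [List.nodup_cons, List.mem_cons, List.not_mem_nil, not_or, List.nodup_nil]
  refine ⟨⟨e1, hpa.symm, hsa.symm, hqa.symm, hra.symm, id⟩, ⟨hpb.symm, hsb.symm, hqb.symm,
    hrb.symm, id⟩, ⟨hsp.symm, hqp.symm, hrp.symm, id⟩, ⟨hqs.symm, hrs.symm, id⟩, ⟨e2, id⟩, id,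
    trivial⟩

lemma pairEdge_spec {f : Fin 6 → Fin 6 → Bool} {sat : Fin 6 → Bool} {m m' : Fin 6}
    (h : pairEdge f sat m m' = true) :
    ∃ x y b a s t : Fin 6, [x, y, b, a, s, t].Nodup ∧ x ≠ m ∧ x ≠ m' ∧ y ≠ m ∧ y ≠ m' ∧
      sat y = true ∧ sat b = true ∧ sat s = true ∧ sat t = true ∧ f a b = false ∧
      (∀ i, f a i = false ∨ f b i = false) ∧ f y s = false ∧ f y t = false ∧ f x t = false := by
  simp only [pairEdge, any6_iff, all6_iff, ne6_iff, Bool.and_eq_true, Bool.not_eq_true',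
    Bool.and_eq_false_iff] at h
  obtain ⟨x, hxm, hxm', y, hym, hym', hyx, hy, b, hbx, hby, hb, a, hax, hay, hab, h1, h2, s, hsx,
    hsy, hsa, hsb, hs, h3, t, htx, hty, hta, htb, hts, ht, h4, h5⟩ := h
  refine ⟨x, y, b, a, s, t, ?_, hxm, hxm', hym, hym', hy, hb, hs, ht, h1, h2, h3, h4, h5⟩
  simp only [List.nodup_cons, List.mem_cons, List.not_mem_nil, not_or, List.nodup_nil]
  exact ⟨⟨hyx.symm, hbx.symm, hax.symm, hsx.symm, htx.symm, id⟩, ⟨hby.symm, hay.symm, hsy.symm,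
    hty.symm, id⟩, ⟨hab.symm, hsb.symm, htb.symm, id⟩, ⟨hsa.symm, hta.symm, id⟩, ⟨hts.symm, id⟩,
    id, trivial⟩

lemma card_filter_eq_true (g : Fin 6 → Bool) : #{j | g j = true} =
    (g 0).toNat + (g 1).toNat + (g 2).toNat + (g 3).toNat + (g 4).toNat + (g 5).toNat := by
  have e : ∀ b : Bool, (if b = true then 1 else 0) = b.toNat := by decide
  rw [card_filter, Fin.sum_univ_six]
  simp only [e]

lemma hasPair_of_le {f : Fin 6 → Fin 6 → Bool} (hs : ∀ i j, f i j = f j i)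
    (hi : ∀ i, f i i = false) (h2 : ∀ i, #{j | f i j = true} ≤ 2) :
    pairStar f = true ∨ ∀ m m', pairEdge f (eq2 f) m m' = true := by
  have e : f = symMat (f 0 1) (f 0 2) (f 0 3) (f 0 4) (f 0 5) (f 1 2) (f 1 3) (f 1 4) (f 1 5)
      (f 2 3) (f 2 4) (f 2 5) (f 3 4) (f 3 5) (f 4 5) := by
    funext i j
    fin_cases i <;> fin_cases j <;> first | exact hi _ | rfl | exact hs _ _
  have hc : ∀ i, (f i 0).toNat + (f i 1).toNat + (f i 2).toNat + (f i 3).toNat + (f i 4).toNat +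
      (f i 5).toNat ≤ 2 := fun i => by
    rw [← card_filter_eq_true]
    exact h2 i
  have h := symMat_pair (f 0 1) (f 0 2) (f 0 3) (f 0 4) (f 0 5)
    (by have := hc 0; rw [le2, Nat.ble_eq]; simp only [hi, Bool.toNat_false] at this; omega)
    (f 1 2) (f 1 3) (f 1 4) (f 1 5)
    (by have := hc 1; rw [le2, Nat.ble_eq]; simp only [hi, hs 1 0, Bool.toNat_false] at this; omega)
    (f 2 3) (f 2 4) (f 2 5)
    (by have := hc 2; rw [le2, Nat.ble_eq]
        simp only [hi, hs 2 0, hs 2 1, Bool.toNat_false] at this; omega)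
    (f 3 4) (f 3 5)
    (by have := hc 3; rw [le2, Nat.ble_eq]
        simp only [hi, hs 3 0, hs 3 1, hs 3 2, Bool.toNat_false] at this; omega)
    (f 4 5)
    (by have := hc 4; rw [le2, Nat.ble_eq]
        simp only [hi, hs 4 0, hs 4 1, hs 4 2, hs 4 3, Bool.toNat_false] at this; omega)
    (by have := hc 5; rw [le2, Nat.ble_eq]
        simp only [hi, hs 5 0, hs 5 1, hs 5 2, hs 5 3, hs 5 4, Bool.toNat_false] at this; omega)
  rw [← e, hasPair, Bool.or_eq_true] at h
  simpa only [all6_iff] using h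

lemma eq2_iff {f : Fin 6 → Fin 6 → Bool} {i : Fin 6} :
    eq2 f i = true ↔ #{j | f i j = true} = 2 := by
  rw [eq2, Nat.beq_eq, card_filter_eq_true]

end

section

open scoped Classical
variable {V : Type} [Fintype V] {G : SimpleGraph V}

lemma Crit.common (hG : Crit G) {u v : V} (huv : G.Adj u v) :
    eI G univ + 12 ≤ 4 * #(univ : Finset V) + #{x | G.Adj u x ∧ G.Adj v x} := by
  have key : ∀ u v, G.Adj u v →
      (∀ y c, G.Adj y u → G.Adj y v → G.Adj y c → ∃ x, G.Adj x y ∧ G.Adj x c) →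
      eI G univ + 12 ≤ 4 * #(univ : Finset V) + #{x | G.Adj u x ∧ G.Adj v x} := by
    intro u v huv hreal
    by_contra hn
    have he := hG.edges
    obtain ⟨U, hu, hv, hU, h3⟩ := hG.octa_of_few huv hreal (by
      by_contra hlt
      obtain ⟨x, hx⟩ : ∃ x, G.Adj x u ∧ G.Adj x v := by
        by_contra hno
        push Not at hno
        have : #{x | G.Adj u x ∧ G.Adj v x} = 0 := by
          rw [card_eq_zero, filter_eq_empty_iff]
          exact fun x _ hx => hno x hx.1.symm hx.2.symm
        omega
      have : 0 < #{x | G.Adj u x ∧ G.Adj v x} :=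
        card_pos.2 ⟨x, by simp [hx.1.symm, hx.2.symm]⟩
      omega)
    exact hG.not_octa huv hu hv hU h3
  refine key u v huv fun y c _ _ hyc => ?_
  by_contra hno
  push Not at hno
  have h1 := key y c hyc fun z c' hzy hzc _ => absurd hzc (hno z hzy)
  have : #{x | G.Adj y x ∧ G.Adj c x} = 0 := by
    rw [card_eq_zero, filter_eq_empty_iff]
    exact fun x _ hx => hno x hx.1.symm hx.2.symm
  have he := hG.edges
  omega

lemma Crit.four_le_common (hG : Crit G) {u v : V} (huv : G.Adj u v) :
    4 ≤ #{x | G.Adj u x ∧ G.Adj v x} := by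
  have h1 := hG.common huv
  have h2 := hG.edges
  omega

lemma Crit.deg_ge (hG : Crit G) (v : V) :
    eI G univ + 13 ≤ 4 * #(univ : Finset V) + #{x | G.Adj v x} := by
  obtain ⟨u, hu⟩ : ∃ u, G.Adj v u := by
    by_contra hno
    push Not at hno
    obtain ⟨y, hy⟩ : ∃ y, y ≠ v := by
      by_contra h
      push Not at h
      have h5 := hG.fc.1
      have : #(univ : Finset V) ≤ #{v} := card_le_card fun x _ => mem_singleton.2 (h x)
      simp only [card_singleton] at this
      omega
    have := hG.fc.le_nb (K := {v}) (S := ∅) (singleton_nonempty v) (y := y) (by simpa using hy)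
      (by simp) (fun k hk x _ hkx => by
        rw [mem_singleton.1 hk] at hkx
        exact absurd hkx (hno x))
    simp at this
  have h1 := hG.common hu
  have : #(insert u ({x | G.Adj v x ∧ G.Adj u x} : Finset V)) ≤ #{x | G.Adj v x} :=
    card_le_card (insert_subset (by simpa using hu)
      (monotone_filter_right _ fun x _ hx => hx.1))
  rw [card_insert_of_notMem (by simp)] at this
  omega

lemma Crit.eI_le (hG : Crit G) : eI G univ + 6 ≤ 4 * #(univ : Finset V) := by
  have h5 := hG.fc.1
  have h1 := sum_deg G univ
  have h2 : ∑ v ∈ (univ : Finset V), (eI G univ + 13 - 4 * #(univ : Finset V)) ≤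
      ∑ v ∈ (univ : Finset V), #{x ∈ (univ : Finset V) | G.Adj v x} :=
    sum_le_sum fun v _ => by
      have := hG.deg_ge v
      omega
  rw [h1, sum_const, smul_eq_mul] at h2
  by_contra hlt
  push Not at hlt
  obtain ⟨k, hk⟩ := Nat.exists_eq_add_of_lt hlt
  have h3 : eI G univ + 13 - 4 * #(univ : Finset V) = k + 8 := by omega
  rw [h3] at h2
  nlinarith

lemma Crit.exists_deg_le (hG : Crit G) : ∃ v, #{x | G.Adj v x} ≤ 7 := by
  by_contra hno
  push Not at hno
  have h1 := sum_deg G univ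
  have h2 : ∑ v ∈ (univ : Finset V), 8 ≤
      ∑ v ∈ (univ : Finset V), #{x ∈ (univ : Finset V) | G.Adj v x} :=
    sum_le_sum fun v _ => hno v
  have h3 := hG.eI_le
  rw [h1, sum_const, smul_eq_mul] at h2
  omega

lemma Crit.deg_ne_five (hG : Crit G) (v : V) : #{x | G.Adj v x} ≠ 5 := by
  intro h5
  have he := hG.edges
  have hd := hG.deg_ge v
  set N : Finset V := {x | G.Adj v x} with hN
  have hmN : ∀ x, x ∈ N ↔ G.Adj v x := fun x => by simp [hN]
  have hcl : ∀ x ∈ N, ∀ y ∈ N, x ≠ y → G.Adj x y := by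
    intro x hx y hy hxy
    have h4 := hG.four_le_common ((hmN x).1 hx)
    have hsub : ({z | G.Adj v z ∧ G.Adj x z} : Finset V) ⊆ N.erase x := fun z hz => by
      obtain ⟨-, h1, h2⟩ := mem_filter.1 hz
      exact mem_erase.2 ⟨h2.ne', (hmN z).2 h1⟩
    have := eq_of_subset_of_card_le hsub (by rw [card_erase_of_mem hx]; omega)
    have hy' : y ∈ N.erase x := mem_erase.2 ⟨hxy.symm, hy⟩
    rw [← this] at hy'
    exact (mem_filter.1 hy').2.2
  have hvN : v ∉ N := fun h => G.irrefl ((hmN v).1 h)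
  obtain ⟨a, ha⟩ : ∃ a, a ∉ insert v N := by
    by_contra hno
    push Not at hno
    have : (univ : Finset V) = insert v N := (eq_univ_of_forall hno).symm
    have h6 : #(univ : Finset V) = 6 := by rw [this, card_insert_of_notMem hvN, h5]
    have := eI_le_choose G univ
    rw [h6] at this he
    omega
  obtain ⟨C, hCW, haC, hC, hcl'⟩ :=
    exists_comp G (W := univ \ insert v N) (a := a) (by simpa using ha)
  have hCN : ∀ x ∈ C, x ≠ v ∧ x ∉ N := fun x hx => by
    have := hCW hx
    simpa [not_or] using this
  have h4 : 4 ≤ #(nb G C) := by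
    refine hG.fc.le_nb (y := v) hC.1 (fun h => (hCN v h).1 rfl) (fun h => ?_)
      fun k hk x hx hkx => mem_nb.2 ⟨hx, k, hk, hkx⟩
    obtain ⟨-, k, hk, hkv⟩ := mem_nb.1 h
    exact (hCN k hk).2 ((hmN k).2 hkv.symm)
  have hnb : nb G C ⊆ N := fun x hx => by
    obtain ⟨hxC, k, hk, hkx⟩ := mem_nb.1 hx
    by_contra hxN
    refine hxC (hcl' k hk x ?_ hkx)
    simp only [mem_sdiff, mem_univ, mem_insert, true_and, not_or]
    exact ⟨fun h => (hCN k hk).2 ((hmN k).2 (h ▸ hkx.symm)), hxN⟩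
  obtain ⟨S, hS, hS4⟩ := exists_subset_card_eq h4
  obtain ⟨m, hm, hmS⟩ := exists_mem_notMem_of_card_lt_card (s := S) (t := N) (by omega)
  have hSN : ∀ z ∈ S, z ∈ N := fun z hz => hnb (hS hz)
  refine hG.no_bags hS4 (B := fun z => {z}) (D := C) (C₀ := {v}) (C₁ := {m})
    (fun z _ => conn_singleton G z) hC (conn_singleton G v) (conn_singleton G m)
    (fun z _ y _ hzy => by simpa using hzy) (fun z hz => ?_) (fun z hz => ?_) (fun z hz => ?_)
    ?_ ?_ ?_ (fun z hz y hy hzy => ?_) (fun z hz => ?_) (fun z hz => ?_) (fun z hz => ?_) ?_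
  · exact disjoint_singleton_right.2 fun h => (hCN z h).2 (hSN z hz)
  · simpa using fun h : v = z => hvN (h ▸ hSN z hz)
  · simpa using fun h : m = z => hmS (h ▸ hz)
  · exact disjoint_singleton_right.2 fun h => (hCN v h).1 rfl
  · exact disjoint_singleton_right.2 fun h => (hCN m h).2 hm
  · simpa using fun h : v = m => hvN (h ▸ hm)
  · exact ⟨z, by simp, y, by simp, hcl z (hSN z hz) y (hSN y hy) hzy⟩
  · obtain ⟨-, k, hk, hkz⟩ := mem_nb.1 (hS hz)
    exact ⟨k, hk, z, by simp, hkz⟩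
  · exact ⟨v, by simp, z, by simp, (hmN z).1 (hSN z hz)⟩
  · exact ⟨m, by simp, z, by simp, hcl m hm z (hSN z hz) fun h => hmS (h ▸ hz)⟩
  · exact ⟨v, by simp, m, by simp, (hmN m).1 hm⟩

end

section

open scoped Classical
variable {V : Type} [Fintype V] {G : SimpleGraph V}

lemma Crit.no_star (hG : Crit G) {v a b p s q r : V} {X : Finset V} (hX : Conn G X)
    (nd : [a, b, p, s, q, r].Nodup) (hv : ∀ z ∈ [a, b, p, s, q, r], G.Adj v z)
    (hXv : ∀ z ∈ [v, a, b, p, s, q, r], z ∉ X ∧ ∃ c ∈ X, G.Adj c z) (hab : G.Adj a b)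
    (h : ∀ z ∈ [p, s, q, r], G.Adj a z ∨ G.Adj b z) (hps : G.Adj p s) (hqs : G.Adj q s)
    (hqr : G.Adj q r) (hrs : G.Adj r s) : False := by
  simp only [List.nodup_cons, List.mem_cons, List.not_mem_nil, not_or, List.nodup_nil, or_false,
    forall_eq_or_imp, forall_eq, not_false_eq_true, and_true] at nd hv hXv h
  obtain ⟨v1, v2, v3, v4, v5, v6⟩ := hv
  obtain ⟨⟨x0, y0⟩, ⟨x1, y1⟩, ⟨x2, y2⟩, ⟨x3, y3⟩, ⟨x4, y4⟩, ⟨x5, y5⟩, ⟨x6, y6⟩⟩ := hXv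
  obtain ⟨h1, h2, h3, h4⟩ := h
  obtain ⟨⟨n1, n2, n3, n4, n5⟩, ⟨n6, n7, n8, n9⟩, ⟨m1, m2, m3⟩, ⟨m4, m5⟩, m6⟩ := nd
  have := v1.ne; have := v2.ne; have := v3.ne; have := v4.ne; have := v5.ne; have := v6.ne
  refine hG.no_four ![{v}, X, {a, b}, {s}] (D := {p}) (C₀ := {q}) (C₁ := {r})
    ?_ (conn_singleton _ _) (conn_singleton _ _) (conn_singleton _ _) ?_ ?_ ?_ ?_ ?_ ?_ ?_
    ?_ ?_ ?_ ?_ ?_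
  · simp [Fin.forall_fin_succ, conn_singleton, conn_pair, hX, hab]
  all_goals try simp only [Fin.forall_fin_succ, Fin.isValue, Matrix.cons_val_zero,
    Matrix.cons_val_succ, IsEmpty.forall_iff, and_true, Matrix.cons_val_fin_one,
    Fin.succ_lt_succ_iff, Fin.succ_pos, Fin.not_lt_zero, lt_irrefl, forall_const, true_and]
  all_goals simp only [Touch, mem_insert, mem_singleton, exists_eq_or_imp, exists_eq_left,
    disjoint_insert_left, disjoint_insert_right, disjoint_singleton_left,
    disjoint_singleton_right, not_or]
  all_goals grind [G.adj_comm]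

lemma Crit.no_edge_star (hG : Crit G) {v w y b a s t : V} {X : Finset V} (hX : Conn G X)
    (nd : [w, y, b, a, s, t].Nodup) (hv : ∀ z ∈ [w, y, b, a, s, t], G.Adj v z)
    (hXv : ∀ z ∈ [v, w, y, b, a, s, t], z ∉ X)
    (hXt : ∀ z ∈ [v, w, y, t], ∃ c ∈ X, G.Adj c z)
    (hXab : ∃ c ∈ X, G.Adj c a ∨ G.Adj c b) (hab : G.Adj a b)
    (hw : ∀ z ∈ [y, b, s, t], G.Adj z w)
    (h : ∀ z ∈ [y, s, t], G.Adj a z ∨ G.Adj b z) (hys : G.Adj y s) (hyt : G.Adj y t) : False := by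
  simp only [List.nodup_cons, List.mem_cons, List.not_mem_nil, not_or, List.nodup_nil, or_false,
    forall_eq_or_imp, forall_eq, not_false_eq_true, and_true] at nd hv hXv hXt hw h
  obtain ⟨v1, v2, v3, v4, v5, v6⟩ := hv
  obtain ⟨x0, x1, x2, x3, x4, x5, x6⟩ := hXv
  obtain ⟨y1, y2, y3, y4⟩ := hXt
  obtain ⟨h1, h2, h3⟩ := h
  obtain ⟨w1, w2, w3, w4⟩ := hw
  obtain ⟨⟨n1, n2, n3, n4, n5⟩, ⟨n6, n7, n8, n9⟩, ⟨m1, m2, m3⟩, ⟨m4, m5⟩, m6⟩ := nd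
  have := v1.ne; have := v2.ne; have := v3.ne; have := v4.ne; have := v5.ne; have := v6.ne
  refine hG.no_four ![{v}, {w}, {y}, {a, b}] (D := {s}) (C₀ := X) (C₁ := {t})
    ?_ (conn_singleton _ _) hX (conn_singleton _ _) ?_ ?_ ?_ ?_ ?_ ?_ ?_
    ?_ ?_ ?_ ?_ ?_
  · simp [Fin.forall_fin_succ, conn_singleton, conn_pair, hab]
  all_goals try simp only [Fin.forall_fin_succ, Fin.isValue, Matrix.cons_val_zero,
    Matrix.cons_val_succ, IsEmpty.forall_iff, and_true, Matrix.cons_val_fin_one,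
    Fin.succ_lt_succ_iff, Fin.succ_pos, Fin.not_lt_zero, lt_irrefl, forall_const, true_and]
  all_goals simp only [Touch, mem_insert, mem_singleton, exists_eq_or_imp, exists_eq_left,
    disjoint_insert_left, disjoint_insert_right, disjoint_singleton_left,
    disjoint_singleton_right, not_or]
  all_goals grind [G.adj_comm]

lemma Sep4.K42_of_deg (hG : Crit G) {X S Y : Finset V} (h : Sep4 G X S Y) {v : V} (hv : v ∈ X)
    (h7 : #{x | G.Adj v x} ≤ 7) : K42 G (X ∪ S) S := by
  have hXS := h.disjXS
  have hYS := h.disjYS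
  have hXY := h.disjXY
  rw [Finset.disjoint_left] at hXS hYS hXY
  set N : Finset V := {x | G.Adj v x} with hN
  have hmN : ∀ x, x ∈ N ↔ G.Adj v x := fun x => by simp [hN]
  have hNX : ∀ k ∈ X, ∀ x, G.Adj k x → x ∈ X ∪ S := fun k hk x hx => by
    rcases h.cover x with h1 | h1 | h1
    · exact mem_union_left _ h1
    · exact mem_union_right _ h1
    · exact absurd hx (h.no_edge k hk x h1)
  have hNB : N ⊆ X ∪ S := fun x hx => hNX v hv x ((hmN x).1 hx)
  obtain ⟨y, hy⟩ := h.right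
  have hyXS : y ∉ X ∪ S := by
    rw [mem_union, not_or]
    exact ⟨fun h => hXY h hy, hYS hy⟩
  obtain ⟨P, e, hP, hPd⟩ := link_trim (H := G) (U := (X ∪ S).erase v) (Z := S) (X := N)
    (fun x hx => mem_erase.2 ⟨fun h => hXS hv (h ▸ hx), mem_union_right _ hx⟩)
    (fun x hx => mem_erase.2 ⟨((hmN x).1 hx).ne', hNB hx⟩) fun A B hAB hSA hNB' => by
      have hA : A ⊆ (X ∪ S).erase v := hAB.1 ▸ subset_union_left
      have hB : B ⊆ (X ∪ S).erase v := hAB.1 ▸ subset_union_right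
      rw [h.card]
      refine hG.fc.le_nb (K := insert v (B \ A)) (insert_nonempty _ _) (y := y)
        (fun hy' => ?_) (fun hy' => hyXS (mem_of_mem_erase (hA (mem_inter.1 hy').1)))
        fun k hk x hx hkx => ?_
      · rcases mem_insert.1 hy' with rfl | hy'
        · exact hXY hv hy
        · exact hyXS (mem_of_mem_erase (hB (mem_sdiff.1 hy').1))
      · rw [mem_insert, not_or] at hx
        have hkX : k ∈ X := by
          rcases mem_insert.1 hk with rfl | hk
          · exact hv
          · obtain ⟨h1, h2⟩ := mem_sdiff.1 hk
            exact (mem_union.1 (mem_of_mem_erase (hB h1))).resolve_right fun h => h2 (hSA h)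
        have hxU : x ∈ A ∪ B := by
          rw [hAB.1]
          exact mem_erase.2 ⟨hx.1, hNX k hkX x hkx⟩
        have hxA : x ∈ A := by
          by_contra hxA
          exact hx.2 (mem_sdiff.2 ⟨(mem_union.1 hxU).resolve_left hxA, hxA⟩)
        refine mem_inter.2 ⟨hxA, ?_⟩
        rcases mem_insert.1 hk with rfl | hk
        · exact hNB' ((hmN x).2 hkx)
        · by_contra hxB
          exact hAB.2 x (mem_sdiff.2 ⟨hxA, hxB⟩) k hk hkx.symm
  have hd := hG.deg_ge v
  have he := hG.edges
  rw [← hN] at hd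
  refine K42.of_nbrs (mem_union_left _ hv) hNB (fun x hx => (hmN x).1 hx) h.card.le (by omega) h7
    (fun x hx => ?_) hP hPd
  refine (hG.four_le_common ((hmN x).1 hx)).trans (card_le_card fun z hz => ?_)
  obtain ⟨-, h1, h2⟩ := mem_filter.1 hz
  exact mem_filter.2 ⟨(hmN z).2 h1, h2⟩

lemma Sep4.K42_left (hG : Crit G) {X S Y : Finset V} (h : Sep4 G X S Y)
    (hS : ∀ s ∈ S, ∃ x ∈ X, G.Adj s x) : K42 G (X ∪ S) S := by
  by_cases hd : ∃ v ∈ X, #{x | G.Adj v x} ≤ 7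
  · obtain ⟨v, hv, h7⟩ := hd
    exact h.K42_of_deg hG hv h7
  push Not at hd
  refine h.K42_of_dense hG.fc ?_
  have hXS := h.disjXS
  have h1 := sum_deg G (X ∪ S)
  have h2 := sum_deg G S
  rw [sum_union hXS] at h1
  have h3 : ∑ v ∈ X, 8 ≤ ∑ v ∈ X, #{x ∈ X ∪ S | G.Adj v x} := sum_le_sum fun v hv => by
    refine Nat.lt_of_lt_of_le (hd v hv) (card_le_card fun x hx => ?_)
    refine mem_filter.2 ⟨?_, (mem_filter.1 hx).2⟩
    rcases h.cover x with h1 | h1 | h1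
    · exact mem_union_left _ h1
    · exact mem_union_right _ h1
    · exact absurd (mem_filter.1 hx).2 (h.no_edge v hv x h1)
  have h4 : ∑ v ∈ S, (#{x ∈ S | G.Adj v x} + 1) ≤ ∑ v ∈ S, #{x ∈ X ∪ S | G.Adj v x} :=
    sum_le_sum fun v hv => by
      obtain ⟨x, hx, hvx⟩ := hS v hv
      rw [← card_insert_of_notMem (a := x) (s := {x ∈ S | G.Adj v x})
        fun h => Finset.disjoint_left.1 hXS hx (mem_filter.1 h).1]
      refine card_le_card (insert_subset (by simp [hx, hvx]) (filter_subset_filter _ ?_))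
      exact subset_union_right
  rw [sum_add_distrib, h2, sum_const, h.card] at h4
  rw [sum_const] at h3
  simp only [smul_eq_mul] at h3 h4
  omega

end

section

open scoped Classical
variable {V : Type} [Fintype V] {G : SimpleGraph V}

lemma exists_pair_of_card_le_two {I : Finset (Fin 6)} (h : #I ≤ 2) : ∃ m m', I ⊆ {m, m'} := by
  rcases Nat.lt_or_ge #I 2 with h1 | h1
  · rcases card_le_one_iff_subset_singleton.1 (Nat.le_of_lt_succ h1) with ⟨m, hm⟩
    exact ⟨m, m, by simpa using hm⟩
  · obtain ⟨m, m', -, rfl⟩ := card_eq_two.1 (le_antisymm h h1)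
    exact ⟨m, m', Subset.rfl⟩

lemma Crit.deg_ne_seven (hG : Crit G) (hmin : ∀ x, 7 ≤ #{y | G.Adj x y}) (v : V) :
    #{x | G.Adj v x} ≠ 7 := by
  intro h7
  have he := hG.eI_le
  set N : Finset V := {x | G.Adj v x} with hN
  have hmN : ∀ x, x ∈ N ↔ G.Adj v x := fun x => by simp [hN]
  have hvN : v ∉ N := fun h => G.irrefl ((hmN v).1 h)
  have hmiss : ∀ x ∈ N, #{z ∈ N | z ≠ x ∧ ¬ G.Adj x z} ≤ 2 := by
    intro x hx
    have h4 := hG.four_le_common ((hmN x).1 hx)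
    have e : ({z | G.Adj v z ∧ G.Adj x z} : Finset V) = {z ∈ N.erase x | G.Adj x z} := by
      ext z
      simp only [mem_filter, mem_univ, true_and, mem_erase, hmN]
      exact ⟨fun h => ⟨⟨h.2.ne', h.1⟩, h.2⟩, fun h => ⟨h.1.2, h.2⟩⟩
    have e' : ({z ∈ N | z ≠ x ∧ ¬ G.Adj x z} : Finset V) = {z ∈ N.erase x | ¬ G.Adj x z} := by
      ext z
      simp only [mem_filter, mem_erase]
      tauto
    have := card_filter_add_card_filter_not (s := N.erase x) (fun z => G.Adj x z)
    rw [card_erase_of_mem hx] at this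
    rw [e] at h4
    rw [e']
    omega
  obtain ⟨a, ha⟩ : ∃ a, a ∉ insert v N := by
    by_contra hno
    push Not at hno
    have h8 : #(univ : Finset V) = 8 := by
      rw [← eq_univ_of_forall hno, card_insert_of_notMem hvN, h7]
    have h1 := sum_deg G univ
    have h2 : ∑ v ∈ (univ : Finset V), 7 ≤
        ∑ v ∈ (univ : Finset V), #{x ∈ (univ : Finset V) | G.Adj v x} :=
      sum_le_sum fun v _ => hmin v
    rw [h1, sum_const, smul_eq_mul] at h2
    omega
  obtain ⟨C, hCW, haC, hC, hcl⟩ :=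
    exists_comp G (W := univ \ insert v N) (a := a) (by simpa using ha)
  have hCN : ∀ x ∈ C, x ≠ v ∧ x ∉ N := fun x hx => by
    have := hCW hx
    simpa [not_or] using this
  have hvC : v ∉ C := fun h => (hCN v h).1 rfl
  have hnb : nb G C ⊆ N := fun x hx => by
    obtain ⟨hxC, k, hk, hkx⟩ := mem_nb.1 hx
    by_contra hxN
    refine hxC (hcl k hk x ?_ hkx)
    simp only [mem_sdiff, mem_univ, mem_insert, true_and, not_or]
    exact ⟨fun h => (hCN k hk).2 ((hmN k).2 (h ▸ hkx.symm)), hxN⟩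
  have hvT : v ∉ nb G C := fun h => hvN (hnb h)
  have h4 : 4 ≤ #(nb G C) := hG.fc.le_nb hC.1 hvC hvT
      fun k hk x hx hkx => mem_nb.2 ⟨hx, k, hk, hkx⟩
  have h5 : #(nb G C) ≠ 4 := by
    intro h4'
    have hsep := sep4_nb hC.1 h4' hvC hvT
    obtain ⟨x, hx⟩ := card_pos.1 (by omega : 0 < #(nb G C))
    obtain ⟨y, hy, hxy⟩ : ∃ y ∈ nb G C, G.Adj x y := by
      by_contra hno
      push Not at hno
      have := (card_le_card (fun y hy => mem_filter.2 ⟨hnb (mem_of_mem_erase hy),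
        ne_of_mem_erase hy, hno y (mem_of_mem_erase hy)⟩ :
        (nb G C).erase x ⊆ {z ∈ N | z ≠ x ∧ ¬ G.Adj x z})).trans (hmiss x (hnb hx))
      rw [card_erase_of_mem hx] at this
      omega
    refine hsep.not_both hG hx hy hxy (hsep.K42_left hG fun s hs => ?_)
      (hsep.symm.K42_of_deg hG (v := v) (by simp [hvC, hvT]) h7.le)
    obtain ⟨-, k, hk, hks⟩ := mem_nb.1 hs
    exact ⟨k, hk, hks.symm⟩
  set T := nb G C with hT
  have hNT : #(N \ T) ≤ 2 := by
    rw [card_sdiff_of_subset hnb]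
    omega
  obtain ⟨w, hwT, hw⟩ : ∃ w ∈ T, ∀ z ∈ N, z ∉ T → G.Adj z w := by
    by_contra hno
    push Not at hno
    have hsub : T ⊆ (N \ T).biUnion fun z => {y ∈ N | y ≠ z ∧ ¬ G.Adj z y} := fun w hw => by
      obtain ⟨z, hz, hzT, hzw⟩ := hno w hw
      exact mem_biUnion.2 ⟨z, mem_sdiff.2 ⟨hz, hzT⟩, mem_filter.2 ⟨hnb hw,
        fun h => hzT (h ▸ hw), hzw⟩⟩
    have := (card_le_card hsub).trans (card_biUnion_le_card_mul _ _ 2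
      fun z hz => hmiss z (mem_sdiff.1 hz).1)
    omega
  have hwN := hnb hwT
  let e : Fin 6 ≃ N.erase w :=
    ((N.erase w).equivFinOfCardEq (by rw [card_erase_of_mem hwN, h7])).symm
  let g : Fin 6 → V := fun i => e i
  have hg : Function.Injective g := fun i j h => e.injective (Subtype.ext h)
  have hgN : ∀ i, g i ∈ N := fun i => mem_of_mem_erase (e i).2
  have hgw : ∀ i, g i ≠ w := fun i => ne_of_mem_erase (e i).2
  let f : Fin 6 → Fin 6 → Bool := fun i j => decide (g j ≠ g i ∧ ¬ G.Adj (g i) (g j))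
  have hf : ∀ i j, f i j = true ↔ g j ≠ g i ∧ ¬ G.Adj (g i) (g j) := fun i j => decide_eq_true_iff
  have hf' : ∀ i j, i ≠ j → f i j = false → G.Adj (g i) (g j) := fun i j hij h => by
    by_contra hn
    rw [(hf i j).2 ⟨fun h => hij (hg h).symm, hn⟩] at h
    exact Bool.noConfusion h
  have himg : ∀ i, ({j | f i j = true} : Finset (Fin 6)).image g ⊆
      {z ∈ N | z ≠ g i ∧ ¬ G.Adj (g i) z} := fun i => by
    intro z hz
    obtain ⟨j, hj, rfl⟩ := mem_image.1 hz
    exact mem_filter.2 ⟨hgN j, (hf i j).1 (mem_filter.1 hj).2⟩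
  have hci : ∀ i, #(({j | f i j = true} : Finset (Fin 6)).image g) = #{j | f i j = true} :=
    fun i => card_image_of_injective _ hg
  have hsat : ∀ i, eq2 f i = true → G.Adj (g i) w := fun i hi => by
    rw [eq2_iff] at hi
    by_contra hn
    have h1 : insert w (({j | f i j = true} : Finset (Fin 6)).image g) ⊆
        {z ∈ N | z ≠ g i ∧ ¬ G.Adj (g i) z} :=
      insert_subset (mem_filter.2 ⟨hwN, (hgw i).symm, hn⟩) (himg i)
    have h2 := (card_le_card h1).trans (hmiss _ (hgN i))
    rw [card_insert_of_notMem, hci, hi] at h2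
    · omega
    · intro h
      obtain ⟨j, -, hj⟩ := mem_image.1 h
      exact hgw j hj
  have hfab : ∀ i j k, i ≠ k → j ≠ k → (f i k = false ∨ f j k = false) →
      G.Adj (g i) (g k) ∨ G.Adj (g j) (g k) := fun i j k hik hjk h =>
    h.imp (hf' i k hik) (hf' j k hjk)
  have hgC : ∀ i, g i ∉ C := fun i h => (hCN _ h).2 (hgN i)
  have hTC : ∀ z ∈ T, ∃ c ∈ C, G.Adj c z := fun z hz => (mem_nb.1 hz).2
  have hgv : ∀ i, G.Adj v (g i) := fun i => (hmN _).1 (hgN i)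
  have hvw := (hmN w).1 hwN
  have hwC : w ∉ C := fun h => (hCN w h).2 hwN
  rcases hasPair_of_le (f := f) (fun i j => by
      rw [Bool.eq_iff_iff, hf, hf, G.adj_comm, ne_comm]) (fun i => by
      rw [← Bool.not_eq_true, hf]; simp) (fun i => by
      rw [← hci]
      exact (card_le_card (himg i)).trans (hmiss _ (hgN i))) with h | h
  · obtain ⟨a, b, p, s, q, r, nd, hab, h2, hps, hqs, hqr, hrs⟩ := pairStar_spec h
    obtain ⟨c₀, hc₀, hcw⟩ := hTC w hwT
    have hX : ∀ i, g i ∉ insert w C ∧ ∃ c ∈ insert w C, G.Adj c (g i) := fun i => by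
      refine ⟨fun h => (mem_insert.1 h).elim (hgw i) (hgC i), ?_⟩
      by_cases hi : g i ∈ T
      · obtain ⟨c, hc, hci⟩ := hTC _ hi
        exact ⟨c, mem_insert_of_mem hc, hci⟩
      · exact ⟨w, mem_insert_self _ _, (hw _ (hgN i) hi).symm⟩
    have nd' := nd
    simp only [List.nodup_cons, List.mem_cons, List.not_mem_nil, not_or, List.nodup_nil, or_false,
      not_false_eq_true, and_true] at nd'
    obtain ⟨⟨n1, n2, n3, n4, n5⟩, ⟨n6, n7, n8, n9⟩, ⟨m1, m2, m3⟩, ⟨m4, m5⟩, m6⟩ := nd'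
    refine hG.no_star (v := v) (a := g a) (b := g b) (p := g p) (s := g s) (q := g q) (r := g r)
      (X := insert w C) (hC.insert hc₀ hcw.symm) (nd.map hg) ?_ ?_ (hf' a b n1 hab) ?_
      (hf' p s m1 hps) (hf' q s (Ne.symm m4) hqs) (hf' q r m6 hqr) (hf' r s (Ne.symm m5) hrs)
    · simp [hgv]
    · simp only [List.mem_cons, List.not_mem_nil, or_false, forall_eq_or_imp, forall_eq]
      exact ⟨⟨fun h => (mem_insert.1 h).elim hvw.ne hvC, w, mem_insert_self _ _, hvw.symm⟩,
        hX a, hX b, hX p, hX s, hX q, hX r⟩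
    · simp only [List.mem_cons, List.not_mem_nil, or_false, forall_eq_or_imp, forall_eq]
      exact ⟨hfab a b p n2 n6 (h2 p), hfab a b s n3 n7 (h2 s), hfab a b q n4 n8 (h2 q),
        hfab a b r n5 n9 (h2 r)⟩
  · obtain ⟨m, m', hm⟩ := exists_pair_of_card_le_two (I := ({i | g i ∉ T} : Finset (Fin 6))) (by
      rw [← card_image_of_injective _ hg]
      refine (card_le_card fun z hz => ?_).trans hNT
      obtain ⟨i, hi, rfl⟩ := mem_image.1 hz
      exact mem_sdiff.2 ⟨hgN i, (mem_filter.1 hi).2⟩)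
    have hmT : ∀ i, i ≠ m → i ≠ m' → g i ∈ T := fun i h1 h2 => by
      by_contra hn
      have := hm (mem_filter.2 ⟨mem_univ _, hn⟩)
      simp [h1, h2] at this
    obtain ⟨x, y, b, a, s, t, nd, hxm, hxm', hym, hym', hy, hb, hs, ht, hab, h2, hys, hyt, hxt⟩ :=
      pairEdge_spec (h m m')
    simp only [List.nodup_cons, List.mem_cons, List.not_mem_nil, not_or, List.nodup_nil, or_false,
      not_false_eq_true, and_true] at nd
    obtain ⟨⟨n1, n2, n3, n4, n5⟩, ⟨n6, n7, n8, n9⟩, ⟨m1, m2, m3⟩, ⟨m4, m5⟩, m6⟩ := nd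
    obtain ⟨c₁, hc₁, hcx⟩ := hTC _ (hmT x hxm hxm')
    obtain ⟨c₂, hc₂, hcy⟩ := hTC _ (hmT y hym hym')
    obtain ⟨c₀, hc₀, hcw⟩ := hTC w hwT
    have hgX : ∀ i, i ≠ x → g i ∉ insert (g x) C := fun i hi h =>
      (mem_insert.1 h).elim (fun h => hi (hg h)) (hgC i)
    refine hG.no_edge_star (v := v) (w := w) (a := g a) (b := g b) (y := g y) (s := g s) (t := g t)
      (X := insert (g x) C) (hC.insert hc₁ hcx.symm) ?_ ?_ ?_ ?_ ?_
      (hf' a b (Ne.symm m1) hab) ?_ ?_ (hf' y s n8 hys) (hf' y t n9 hyt)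
    · simp only [List.nodup_cons, List.mem_cons, List.not_mem_nil, not_or, List.nodup_nil, or_false,
        not_false_eq_true, and_true, hg.eq_iff]
      exact ⟨⟨(hgw y).symm, (hgw b).symm, (hgw a).symm, (hgw s).symm, (hgw t).symm⟩,
        ⟨n6, n7, n8, n9⟩, ⟨m1, m2, m3⟩, ⟨m4, m5⟩, m6⟩
    · simp [hgv, hvw]
    · simp only [List.mem_cons, List.not_mem_nil, or_false, forall_eq_or_imp, forall_eq]
      exact ⟨fun h => (mem_insert.1 h).elim (hgv x).ne hvC,
        fun h => (mem_insert.1 h).elim (hgw x).symm hwC, hgX y (Ne.symm n1), hgX b (Ne.symm n2),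
        hgX a (Ne.symm n3), hgX s (Ne.symm n4), hgX t (Ne.symm n5)⟩
    · simp only [List.mem_cons, List.not_mem_nil, or_false, forall_eq_or_imp, forall_eq]
      exact ⟨⟨g x, mem_insert_self _ _, (hgv x).symm⟩, ⟨c₀, mem_insert_of_mem hc₀, hcw⟩,
        ⟨c₂, mem_insert_of_mem hc₂, hcy⟩, g x, mem_insert_self _ _, hf' x t n5 hxt⟩
    · exact ⟨g x, mem_insert_self _ _, (hfab a b x (Ne.symm n3) (Ne.symm n2) (h2 x)).imp
        G.adj_symm G.adj_symm⟩
    · simp only [List.mem_cons, List.not_mem_nil, or_false, forall_eq_or_imp, forall_eq]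
      exact ⟨hsat y hy, hsat b hb, hsat s hs, hsat t ht⟩
    · simp only [List.mem_cons, List.not_mem_nil, or_false, forall_eq_or_imp, forall_eq]
      exact ⟨hfab a b y (Ne.symm n7) (Ne.symm n6) (h2 y), hfab a b s m4 m2 (h2 s),
        hfab a b t m5 m3 (h2 t)⟩

lemma Crit.six_le_deg (hG : Crit G) :
    (∀ v, 6 ≤ #{x | G.Adj v x}) ∧ ∃ v, #{x | G.Adj v x} = 6 := by
  have he := hG.edges
  have h6 : ∀ v, 6 ≤ #{x | G.Adj v x} := fun v => by
    have h1 := hG.deg_ge v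
    have h2 := hG.deg_ne_five v
    omega
  refine ⟨h6, ?_⟩
  obtain ⟨v, hv⟩ := hG.exists_deg_le
  by_contra hno
  push Not at hno
  have h7 : ∀ x, 7 ≤ #{y | G.Adj x y} := fun x => by
    have h1 := h6 x
    have h2 := hno x
    omega
  exact hG.deg_ne_seven h7 v (le_antisymm hv (h7 v))

lemma degree_eq_card_filter [DecidableRel G.Adj] (v : V) :
    G.degree v = #(univ.filter fun x => G.Adj v x) := by
  rw [← card_neighborFinset_eq_degree]
  congr 1
  ext x
  simp

end

end MinEnemy

/-- the minimum degree of a minor-minimal enemy is exactly 6. -/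
theorem statement_14 (V : Type) [Fintype V] (G : SimpleGraph V) [DecidableRel G.Adj]
    (h : MinorMinimalEnemy G) : G.minDegree = 6 := by
  obtain ⟨h1, v, hv⟩ := (MinEnemy.crit_of_minorMinimal h).six_le_deg
  have : Nonempty V := ⟨v⟩
  refine le_antisymm ((G.minDegree_le_degree v).trans ?_)
    (G.le_minDegree_of_forall_le_degree _ fun x => ?_)
  · rw [MinEnemy.degree_eq_card_filter]
    convert hv.le
  · rw [MinEnemy.degree_eq_card_filter]
    convert h1 x
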